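/- arXiv:1409.3177 — 2 statements merged into one kernel-verified Lean document; each statement's English description precedes it below -/
import Mathlib

section
/- Fix a prime g ≥ 3. For every ε > 0 there exists a constant C = C(g, ε) such that for all real X ≥ 2 and all real Z with (1/4)·X^{1/(2g)} ≤ Z ≤ X, there exists a set E of integers in [X, 2X) with #E ≤ C · X^ε such that every squarefree integer d ∈ [X, 2X) not in E satisfies h_g(-d) ≤ C · X^ε · ( d^{1/2} Z^{-1} + d^{1/2} Z^{-2} S_g(d;Z) ). -/
/-- The imaginary quadratic field `ℚ(√-d)`, realized as the subfield of `ℂ`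
generated over `ℚ` by `√d · i`. -/
noncomputable def Kneg (d : ℕ) : IntermediateField ℚ ℂ :=
  IntermediateField.adjoin ℚ {(Real.sqrt d : ℂ) * Complex.I}

/-- `hneg g d` is the `g`-part of the class number of `ℚ(√-d)`: the number of
ideal classes `c` of the ring of integers of `ℚ(√-d)` with `c ^ g = 1`. -/
noncomputable def hneg (g d : ℕ) : ℕ :=
  Nat.card {c : ClassGroup (NumberField.RingOfIntegers (Kneg d)) // c ^ g = 1}

/-- `Sg g d Z` is the number of ordered pairs `(p, p')` of distinct primes with
`Z ≤ p, p' < 2Z` for which there exist nonzero integers `u, v` with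
`gcd(v, p·p') = 1` and `4(p·p')^g = u² + d·v²`. -/
noncomputable def Sg (g d : ℕ) (Z : ℝ) : ℕ :=
  Nat.card {pq : ℕ × ℕ // pq.1.Prime ∧ pq.2.Prime ∧ pq.1 ≠ pq.2 ∧
    Z ≤ pq.1 ∧ (pq.1 : ℝ) < 2 * Z ∧ Z ≤ pq.2 ∧ (pq.2 : ℝ) < 2 * Z ∧
    ∃ u v : ℤ, u ≠ 0 ∧ v ≠ 0 ∧ Int.gcd v ((pq.1 : ℤ) * pq.2) = 1 ∧
      4 * ((pq.1 : ℤ) * pq.2) ^ g = u ^ 2 + (d : ℤ) * v ^ 2}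


/-- If `q` is prime and `q ∤ m`, then `q * m` has Jacobi symbol `-1` at some odd integer. -/
theorem exists_odd_jacobiSym_prime_mul_eq_neg_one {q m : ℕ} (hq : q.Prime) (hm : m ≠ 0)
    (hqm : ¬ q ∣ m) : ∃ n : ℕ, Odd n ∧ jacobiSym ((q * m : ℕ) : ℤ) n = -1 := by
  rcases hq.eq_two_or_odd' with rfl | hodd
  · have hmo : Odd m := by rwa [← Nat.not_even_iff_odd, even_iff_two_dvd]
    have hco : Nat.Coprime 8 m := by
      rw [show 8 = 2 ^ 3 by norm_num]
      exact Nat.Coprime.pow_left 3 ((Nat.Prime.coprime_iff_not_dvd hq).2 hqm)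
    obtain ⟨n, hn8, hnm⟩ := Nat.chineseRemainder hco 5 1
    have h8 : n % 8 = 5 := hn8
    have hno : Odd n := Nat.odd_iff.2 (by omega)
    refine ⟨n, hno, ?_⟩
    push_cast
    rw [jacobiSym.mul_left, jacobiSym.at_two hno,
      jacobiSym.quadratic_reciprocity_one_mod_four' hmo (by omega : n % 4 = 1),
      jacobiSym.mod_left' (a₂ := 1) (by exact_mod_cast hnm), jacobiSym.one_left]
    rw [ZMod.χ₈_nat_eq_if_mod_eight]
    simp [h8, show n % 2 = 1 by omega]
  · have := Fact.mk hq
    have hq2 : q ≠ 2 := by rintro rfl; exact absurd hodd (by decide)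
    have hco : Nat.Coprime (8 * m) q := by
      refine Nat.Coprime.mul_left ?_ ?_
      · rw [show 8 = 2 ^ 3 by norm_num]
        exact Nat.Coprime.pow_left 3 ((Nat.coprime_primes Nat.prime_two hq).2 (Ne.symm hq2))
      · exact (Nat.coprime_comm.1 ((Nat.Prime.coprime_iff_not_dvd hq).2 hqm))
    obtain ⟨a, ha⟩ := FiniteField.exists_nonsquare (F := ZMod q) (by
      simpa [ZMod.ringChar_zmod_n] using hq2)
    obtain ⟨n, hn8, hnq⟩ := Nat.chineseRemainder hco 1 a.val
    have h8 : n % 8 = 1 := by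
      have : n ≡ 1 [MOD 8] := Nat.ModEq.of_mul_right m hn8
      exact this
    have hno : Odd n := Nat.odd_iff.2 (by omega)
    refine ⟨n, hno, ?_⟩
    push_cast
    rw [jacobiSym.mul_left, jacobiSym.quadratic_reciprocity_one_mod_four' hodd (by omega : n % 4 = 1)]
    have h1 : jacobiSym (n : ℤ) q = -1 := by
      rw [← jacobiSym.legendreSym.to_jacobiSym, legendreSym.eq_neg_one_iff]
      have : ((n : ℤ) : ZMod q) = a := by
        have := (ZMod.natCast_eq_natCast_iff n a.val q).2 hnq
        rw [Int.cast_natCast, this, ZMod.natCast_zmod_val]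
      rwa [this]
    have h2 : jacobiSym (m : ℤ) n = 1 := by
      have h4 : n ≡ 1 [MOD 4 * m] := by
        refine Nat.ModEq.of_mul_right 2 ?_
        rwa [show 4 * m * 2 = 8 * m by ring]
      rw [jacobiSym.mod_right' m hno, show n % (4 * m) = 1 % (4 * m) from h4,
        Nat.mod_eq_of_lt (by omega), jacobiSym.one_right]
    rw [h1, h2]; norm_num

/-- Partial sums of a `T`-periodic function with zero sum over a period and values bounded by one
are bounded by `T`. -/
theorem abs_sum_range_le_of_periodic {f : ℕ → ℤ} {T : ℕ} (hT : 0 < T)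
    (hper : ∀ n, f (T + n) = f n) (hsum : ∑ n ∈ Finset.range T, f n = 0)
    (hf : ∀ n, |f n| ≤ 1) (N : ℕ) : |∑ n ∈ Finset.range N, f n| ≤ T := by
  induction N using Nat.strong_induction_on with
  | _ N ih =>
    rcases lt_or_ge N T with h | h
    · calc |∑ n ∈ Finset.range N, f n| ≤ ∑ n ∈ Finset.range N, |f n| := Finset.abs_sum_le_sum_abs _ _
        _ ≤ ∑ n ∈ Finset.range N, 1 := Finset.sum_le_sum fun n _ => hf n
        _ = N := by simp
        _ ≤ T := by exact_mod_cast h.le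
    · obtain ⟨M, rfl⟩ := Nat.exists_eq_add_of_le h
      rw [Finset.sum_range_add, hsum, zero_add, Finset.sum_congr rfl fun n _ => hper n]
      exact ih M (by omega)

theorem abs_jacobiSym_le_one (a : ℤ) (b : ℕ) : |jacobiSym a b| ≤ 1 := by
  rcases jacobiSym.trichotomy a b with h | h | h <;> rw [h] <;> norm_num

/-- A character sum bound: if `q` is prime and `q ∤ m`, the sum of Jacobi symbols `(q m / n)` over
odd `n < N` is at most `4 q m` in absolute value. -/
theorem abs_sum_odd_jacobiSym_le {q m : ℕ} (hq : q.Prime) (hm : m ≠ 0) (hqm : ¬ q ∣ m) (N : ℕ) :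
    |∑ n ∈ (Finset.range N).filter Odd, jacobiSym ((q * m : ℕ) : ℤ) n| ≤ 4 * (q * m : ℕ) := by
  obtain ⟨c, hc, hcJ⟩ := exists_odd_jacobiSym_prime_mul_eq_neg_one hq hm hqm
  set M := q * m with hM
  have hM0 : 0 < M := Nat.mul_pos hq.pos (Nat.pos_of_ne_zero hm)
  set T := 4 * M with hTdef
  have hT : 0 < T := by omega
  have : NeZero T := ⟨hT.ne'⟩
  set f : ℕ → ℤ := fun n => if Odd n then jacobiSym (M : ℤ) n else 0 with hf
  have hoddmod : ∀ n, Odd (n % T) ↔ Odd n := by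
    intro n
    simp only [Nat.odd_iff]
    rw [Nat.mod_mod_of_dvd n (by rw [hTdef]; exact ⟨2 * M, by ring⟩)]
  have hmod : ∀ n, f (n % T) = f n := by
    intro n
    simp only [hf, hoddmod]
    split_ifs with h
    · rw [jacobiSym.mod_right' M h]
    · rfl
  have hfc : ∀ n, f (n * c) = -f n := by
    intro n
    simp only [hf, Nat.odd_mul, hc, and_true]
    split_ifs with h
    · rw [jacobiSym.mul_right' _ h.pos.ne' hc.pos.ne', hcJ]; ring
    · simp
  have hcop : Nat.Coprime c T := by
    have h1 : Int.gcd (M : ℤ) c = 1 := by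
      by_contra h
      have := (jacobiSym.eq_zero_iff (a := (M : ℤ)) (b := c)).2 ⟨hc.pos.ne', h⟩
      rw [this] at hcJ; norm_num at hcJ
    refine Nat.Coprime.mul_right ?_ ?_
    · rw [show 4 = 2 ^ 2 by norm_num]
      exact Nat.Coprime.pow_right 2 hc.coprime_two_right
    · rw [Int.gcd_natCast_natCast] at h1
      exact Nat.coprime_comm.1 h1
  have hsum : ∑ n ∈ Finset.range T, f n = 0 := by
    have h1 : ∑ n ∈ Finset.range T, f n = ∑ z : ZMod T, f z.val := by
      refine Finset.sum_bij' (fun n _ => (n : ZMod T)) (fun z _ => z.val) ?_ ?_ ?_ ?_ ?_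
      · simp
      · intro z _; simpa using ZMod.val_lt z
      · intro n hn; exact ZMod.val_cast_of_lt (by simpa using hn)
      · intro z _; simp
      · intro n hn; rw [ZMod.val_cast_of_lt (by simpa using hn)]
    have h2 : ∑ z : ZMod T, f z.val = ∑ z : ZMod T, f (z * (ZMod.unitOfCoprime c hcop : ZMod T)).val :=
      (Fintype.sum_equiv (Units.mulRight (ZMod.unitOfCoprime c hcop)) _ _ (fun z => rfl)).symm
    have h3 : ∀ z : ZMod T, f (z * (ZMod.unitOfCoprime c hcop : ZMod T)).val = - f z.val := by
      intro z
      rw [ZMod.coe_unitOfCoprime, ZMod.val_mul, ZMod.val_natCast, hmod, ← hmod, Nat.mul_mod_mod,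
        hmod, hfc]
    rw [Finset.sum_congr rfl fun z _ => h3 z, Finset.sum_neg_distrib] at h2
    rw [h1]; linarith
  rw [Finset.sum_filter]
  have := abs_sum_range_le_of_periodic hT (fun n => by rw [← hmod, Nat.add_mod_left, hmod]) hsum
    (fun n => by simp only [hf]; split_ifs; exacts [abs_jacobiSym_le_one _ _, by norm_num]) N
  rw [hTdef] at this
  exact_mod_cast this

/-- Character sum bound for `n ↦ (-d / n) (-e / n)` over odd `n`, with `d ≠ e` squarefree. -/
theorem abs_sum_odd_jacobiSym_mul_le {d e : ℕ} (hd : Squarefree d) (he : Squarefree e)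
    (hne : d ≠ e) (N : ℕ) :
    |∑ n ∈ (Finset.range N).filter Odd, jacobiSym (-d : ℤ) n * jacobiSym (-e : ℤ) n|
      ≤ 4 * (d * e : ℕ) := by
  have key : ∀ d e : ℕ, Squarefree d → Squarefree e → ∀ q : ℕ, q.Prime → q ∣ d → ¬ q ∣ e →
      |∑ n ∈ (Finset.range N).filter Odd, jacobiSym (-d : ℤ) n * jacobiSym (-e : ℤ) n|
      ≤ 4 * (d * e : ℕ) := by
    intro d e hd he q hq hqd hqe
    obtain ⟨k, rfl⟩ := hqd
    have hqk : ¬ q ∣ k := by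
      rintro ⟨l, rfl⟩
      exact hq.one_lt.ne' (Nat.isUnit_iff.1 (hd q ⟨l, by ring⟩))
    have hk0 : k ≠ 0 := by rintro rfl; simp at hqk
    have := abs_sum_odd_jacobiSym_le hq (mul_ne_zero hk0 he.ne_zero)
      (fun h => (hq.dvd_mul.1 h).elim hqk hqe) N
    rw [← mul_assoc] at this
    refine le_trans (le_of_eq ?_) this
    congr 1
    refine Finset.sum_congr rfl fun n _ => ?_
    rw [← jacobiSym.mul_left]
    push_cast
    ring_nf
  by_cases h : ∃ q : ℕ, q.Prime ∧ q ∣ d ∧ ¬ q ∣ e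
  · obtain ⟨q, hq, h1, h2⟩ := h
    exact key d e hd he q hq h1 h2
  · push Not at h
    have h' : ∃ q : ℕ, q.Prime ∧ q ∣ e ∧ ¬ q ∣ d := by
      by_contra h'
      push Not at h'
      apply hne
      rw [← Nat.prod_primeFactors_of_squarefree hd, ← Nat.prod_primeFactors_of_squarefree he]
      congr 1
      ext q
      simp only [Nat.mem_primeFactors]
      exact ⟨fun ⟨a, b, _⟩ => ⟨a, h q a b, he.ne_zero⟩, fun ⟨a, b, _⟩ => ⟨a, h' q a b, hd.ne_zero⟩⟩
    obtain ⟨q, hq, h1, h2⟩ := h'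
    have := key e d he hd q hq h1 h2
    rw [mul_comm e d] at this
    simpa only [mul_comm] using this

/-- Mean square bound for the sums over `d ∈ D` of the Jacobi symbols `(-d / n)`. -/
theorem sum_sq_sum_jacobiSym_le {D : Finset ℕ} {Y N : ℕ} (hsq : ∀ d ∈ D, Squarefree d)
    (hY : ∀ d ∈ D, d ≤ Y) (hN : D.card * (4 * Y ^ 2) ≤ N) :
    ∑ n ∈ (Finset.range N).filter Odd, (∑ d ∈ D, jacobiSym (-d : ℤ) n) ^ 2
      ≤ 2 * (D.card : ℤ) * N := by
  have h1 : ∑ n ∈ (Finset.range N).filter Odd, (∑ d ∈ D, jacobiSym (-d : ℤ) n) ^ 2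
      = ∑ d ∈ D, ∑ e ∈ D, ∑ n ∈ (Finset.range N).filter Odd,
          jacobiSym (-d : ℤ) n * jacobiSym (-e : ℤ) n := by
    simp_rw [sq, Finset.sum_mul_sum]
    rw [Finset.sum_comm]
    exact Finset.sum_congr rfl fun d _ => Finset.sum_comm
  rw [h1]
  have hcell : ∀ d ∈ D, ∀ e ∈ D, ∑ n ∈ (Finset.range N).filter Odd,
      jacobiSym (-d : ℤ) n * jacobiSym (-e : ℤ) n ≤ (if d = e then (N : ℤ) else 0) + 4 * Y ^ 2 := by
    intro d hd e he
    split_ifs with h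
    · refine le_add_of_le_of_nonneg ?_ (by positivity)
      calc _ ≤ ∑ n ∈ (Finset.range N).filter Odd, (1 : ℤ) := Finset.sum_le_sum fun n _ => by
            refine (le_abs_self _).trans ?_
            rw [abs_mul]
            exact mul_le_one₀ (abs_jacobiSym_le_one _ _) (abs_nonneg _) (abs_jacobiSym_le_one _ _)
        _ ≤ N := by
          rw [Finset.sum_const, nsmul_one]
          exact_mod_cast (Finset.card_filter_le _ _).trans (Finset.card_range N).le
    · have := (le_abs_self _).trans (abs_sum_odd_jacobiSym_mul_le (hsq d hd) (hsq e he) h N)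
      have h2 : d * e ≤ Y ^ 2 := by rw [sq]; exact Nat.mul_le_mul (hY d hd) (hY e he)
      have h3 : ((d * e : ℕ) : ℤ) ≤ (Y : ℤ) ^ 2 := by exact_mod_cast h2
      linarith
  calc _ ≤ ∑ d ∈ D, ∑ e ∈ D, ((if d = e then (N : ℤ) else 0) + 4 * Y ^ 2) :=
        Finset.sum_le_sum fun d hd => Finset.sum_le_sum fun e he => hcell d hd e he
    _ = D.card * (N : ℤ) + D.card * (D.card * (4 * Y ^ 2)) := by
      simp [Finset.sum_add_distrib]
    _ ≤ _ := by
      have : (D.card : ℤ) * (4 * Y ^ 2) ≤ N := by exact_mod_cast hN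
      nlinarith [mul_le_mul_of_nonneg_left this (Int.natCast_nonneg D.card)]

theorem jacobiSym_prod_right {ι : Type*} (a : ℤ) (s : Finset ι) (x : ι → ℕ)
    (hx : ∀ i ∈ s, x i ≠ 0) : jacobiSym a (∏ i ∈ s, x i) = ∏ i ∈ s, jacobiSym a (x i) := by
  classical
  induction s using Finset.induction_on with
  | empty => simp
  | insert i s hi ih =>
    rw [Finset.prod_insert hi, Finset.prod_insert hi,
      jacobiSym.mul_right' _ (hx i (by simp))
        (Finset.prod_ne_zero_iff.2 fun j hj => hx j (by simp [hj])),
      ih fun j hj => hx j (by simp [hj])]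

/-- A number has at most `k ^ k` ordered factorizations into `k` primes. -/
theorem card_prime_tuples_le (P : Finset ℕ) (hP : ∀ p ∈ P, p.Prime) (k n : ℕ) :
    ((Fintype.piFinset fun _ : Fin k => P).filter fun t => ∏ i, t i = n).card ≤ k ^ k := by
  classical
  rcases Finset.eq_empty_or_nonempty
    ((Fintype.piFinset fun _ : Fin k => P).filter fun t => ∏ i, t i = n) with h | ⟨s, hs⟩
  · rw [h]; simp
  · simp only [Finset.mem_filter, Fintype.mem_piFinset] at hs
    have hsub : ((Fintype.piFinset fun _ : Fin k => P).filter fun t => ∏ i, t i = n) ⊆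
        Fintype.piFinset fun _ : Fin k => Finset.univ.image s := by
      intro t ht
      simp only [Finset.mem_filter, Fintype.mem_piFinset] at ht ⊢
      intro i
      have hdvd : t i ∣ ∏ j, s j := by
        rw [hs.2, ← ht.2]; exact Finset.dvd_prod_of_mem t (Finset.mem_univ i)
      obtain ⟨j, _, hj⟩ := (Prime.dvd_finsetProd_iff (hP _ (ht.1 i)).prime _).1 hdvd
      rw [(Nat.prime_dvd_prime_iff_eq (hP _ (ht.1 i)) (hP _ (hs.1 j))).1 hj]
      exact Finset.mem_image_of_mem s (Finset.mem_univ j)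
    refine (Finset.card_le_card hsub).trans ?_
    rw [Fintype.card_piFinset_const]
    exact Nat.pow_le_pow_left (Finset.card_image_le.trans (by simp)) k

/-- Large-sieve type bound: few squarefree `d` have most primes of `P` inert in `ℚ(√-d)`. -/
theorem card_mul_card_pow_le {D P : Finset ℕ} {Y W k : ℕ} (hsq : ∀ d ∈ D, Squarefree d)
    (hY : ∀ d ∈ D, d ≤ Y) (hk : 0 < k) (hN : D.card * (4 * Y ^ 2) ≤ W ^ k)
    (hP : ∀ p ∈ P, p.Prime) (hPodd : ∀ p ∈ P, Odd p) (hPW : ∀ p ∈ P, p < W) (hP0 : P.Nonempty)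
    (hbad : ∀ d ∈ D, (P.card : ℤ) ≤ -4 * ∑ p ∈ P, jacobiSym (-d : ℤ) p) :
    D.card * P.card ^ k ≤ 2 * (16 * k) ^ k * W ^ k := by
  classical
  set T := Fintype.piFinset fun _ : Fin k => P with hT
  have hTc : T.card = P.card ^ k := Fintype.card_piFinset_const _ _
  set G : ℕ → ℤ := fun n => ∑ d ∈ D, jacobiSym (-d : ℤ) n with hG
  have hpow : ∀ d : ℕ, (∑ p ∈ P, jacobiSym (-d : ℤ) p) ^ k
      = ∑ t ∈ T, jacobiSym (-d : ℤ) (∏ i, t i) := by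
    intro d
    have := Finset.prod_univ_sum (fun _ : Fin k => P) (fun _ p => jacobiSym (-d : ℤ) p)
    rw [Finset.prod_const, Finset.card_univ, Fintype.card_fin] at this
    rw [this]
    refine Finset.sum_congr rfl fun t ht => ?_
    rw [jacobiSym_prod_right]
    intro i _
    exact (hP _ (Fintype.mem_piFinset.1 ht i)).ne_zero
  have hlow : (D.card : ℤ) * P.card ^ k ≤ (-4) ^ k * ∑ t ∈ T, G (∏ i, t i) := by
    rw [hG, Finset.sum_comm, Finset.mul_sum, ← nsmul_eq_mul, ← Finset.sum_const]
    refine Finset.sum_le_sum fun d hd => ?_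
    rw [← hpow, ← mul_pow]
    exact pow_le_pow_left₀ (by positivity) (hbad d hd) k
  have hmap : ∀ t ∈ T, ∏ i, t i ∈ (Finset.range (W ^ k)).filter Odd := by
    intro t ht
    rw [hT, Fintype.mem_piFinset] at ht
    have : Nonempty (Fin k) := ⟨⟨0, hk⟩⟩
    rw [Finset.mem_filter, Finset.mem_range]
    constructor
    · calc ∏ i, t i < ∏ _i : Fin k, W := Finset.prod_lt_prod_of_nonempty
            (fun i _ => (hP _ (ht i)).pos) (fun i _ => hPW _ (ht i)) Finset.univ_nonempty
        _ = W ^ k := by simp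
    · exact Finset.prod_induction _ Odd (fun _ _ => Odd.mul) odd_one fun i _ => hPodd _ (ht i)
  have hfib : ∑ t ∈ T, G (∏ i, t i) ^ 2 ≤ (k : ℤ) ^ k * (2 * D.card * (W ^ k : ℕ)) := by
    rw [← Finset.sum_fiberwise_of_maps_to hmap]
    calc _ = ∑ n ∈ (Finset.range (W ^ k)).filter Odd,
          ((T.filter fun t => ∏ i, t i = n).card : ℤ) * G n ^ 2 := by
          refine Finset.sum_congr rfl fun n _ => ?_
          rw [← nsmul_eq_mul, ← Finset.sum_const]
          refine Finset.sum_congr rfl fun t ht => ?_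
          rw [(Finset.mem_filter.1 ht).2]
      _ ≤ ∑ n ∈ (Finset.range (W ^ k)).filter Odd, (k : ℤ) ^ k * G n ^ 2 := by
          refine Finset.sum_le_sum fun n _ => mul_le_mul_of_nonneg_right ?_ (sq_nonneg _)
          exact_mod_cast card_prime_tuples_le P hP k n
      _ = (k : ℤ) ^ k * ∑ n ∈ (Finset.range (W ^ k)).filter Odd, G n ^ 2 := by rw [Finset.mul_sum]
      _ ≤ _ := mul_le_mul_of_nonneg_left (sum_sq_sum_jacobiSym_le hsq hY hN) (by positivity)
  have hCS : (∑ t ∈ T, G (∏ i, t i)) ^ 2 ≤ (T.card : ℤ) * ∑ t ∈ T, G (∏ i, t i) ^ 2 :=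
    sq_sum_le_card_mul_sum_sq
  have hsq2 : ((D.card : ℤ) * P.card ^ k) ^ 2 ≤
      16 ^ k * (P.card ^ k * ((k : ℤ) ^ k * (2 * D.card * (W ^ k : ℕ)))) := by
    calc ((D.card : ℤ) * P.card ^ k) ^ 2 ≤ ((-4) ^ k * ∑ t ∈ T, G (∏ i, t i)) ^ 2 :=
          pow_le_pow_left₀ (by positivity) hlow 2
      _ = 16 ^ k * (∑ t ∈ T, G (∏ i, t i)) ^ 2 := by
          rw [mul_pow, ← pow_mul, mul_comm k 2, pow_mul]; norm_num
      _ ≤ 16 ^ k * ((T.card : ℤ) * ∑ t ∈ T, G (∏ i, t i) ^ 2) := by gcongr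
      _ ≤ 16 ^ k * ((T.card : ℤ) * ((k : ℤ) ^ k * (2 * D.card * (W ^ k : ℕ)))) := by gcongr
      _ = _ := by rw [hTc]; push_cast; rfl
  rcases Nat.eq_zero_or_pos D.card with h0 | h0
  · rw [h0]; simp
  · have hPc : 0 < P.card ^ k := pow_pos (Finset.card_pos.2 hP0) k
    have h3 : (D.card * P.card ^ k) * (D.card * P.card ^ k) ≤
        (D.card * P.card ^ k) * (2 * (16 * k) ^ k * W ^ k) := by
      have : (D.card * P.card ^ k) ^ 2 ≤
        16 ^ k * (P.card ^ k * (k ^ k * (2 * D.card * W ^ k))) := by exact_mod_cast hsq2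
      calc _ = (D.card * P.card ^ k) ^ 2 := by ring
        _ ≤ _ := this
        _ = _ := by rw [mul_pow]; ring
    exact Nat.le_of_mul_le_mul_left h3 (Nat.mul_pos h0 hPc)

open Nat in
/-- Chebyshev's bound for the central binomial coefficient in terms of the number of primes in
`(n, 2n]`. -/
theorem centralBinom_le_mul_pow_card_primes {n : ℕ} (hn : 2 < n) :
    centralBinom n ≤ (2 * n) ^ sqrt (2 * n) * 4 ^ (2 * n / 3) *
      (2 * n) ^ ((Finset.Ioc n (2 * n)).filter Nat.Prime).card := by
  classical
  have n2_pos : 1 ≤ 2 * n := by omega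
  set f : ℕ → ℕ := fun x => x ^ n.centralBinom.factorization x with hf
  have hf2 : ∀ p, f p ≤ 2 * n := fun p => pow_factorization_choose_le (by omega)
  set S := (Finset.range (2 * n + 1)).filter Nat.Prime with hS
  have h0 : ∏ p ∈ S, f p = n.centralBinom := by
    rw [← prod_pow_factorization_centralBinom n]
    refine Finset.prod_filter_of_ne fun p _ h => ?_
    contrapose h
    rw [hf]
    dsimp only
    rw [factorization_eq_zero_of_not_prime n.centralBinom h, _root_.pow_zero]
  rw [← h0, ← Finset.prod_filter_mul_prod_filter_not S (· ≤ n),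
    ← Finset.prod_filter_mul_prod_filter_not (S.filter (· ≤ n)) (· ≤ sqrt (2 * n))]
  refine Nat.mul_le_mul (Nat.mul_le_mul ?_ ?_) ?_
  · refine (Finset.prod_le_pow_card _ _ _ fun p _ => hf2 p).trans ?_
    have : (Finset.Icc 1 (sqrt (2 * n))).card = sqrt (2 * n) := by rw [card_Icc, Nat.add_sub_cancel]
    refine Nat.pow_le_pow_right n2_pos ((Finset.card_le_card fun x hx => ?_).trans this.le)
    simp only [hS, Finset.mem_filter] at hx
    exact Finset.mem_Icc.mpr ⟨hx.1.1.2.one_lt.le, hx.2⟩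
  · refine le_trans ?_ (primorial_le_four_pow (2 * n / 3))
    rw [primorial_eq_prod_primesLE]
    have hsub : ∀ p ∈ (S.filter (· ≤ n)).filter (fun p => ¬ p ≤ sqrt (2 * n)),
        f p ≤ if p ∈ primesLE (2 * n / 3) then p else 1 := by
      intro p hp
      simp only [hS, Finset.mem_filter, Finset.mem_range] at hp
      have hle : n.centralBinom.factorization p ≤ 1 :=
        Nat.factorization_choose_le_one (sqrt_lt'.mp <| not_le.1 hp.2)
      split_ifs with h
      · exact (pow_right_mono₀ hp.1.1.2.one_lt.le hle).trans (pow_one p).le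
      · rw [mem_primesLE] at h
        have h3 : 2 * n < 3 * p := by
          by_contra h3
          exact h ⟨by omega, hp.1.1.2⟩
        have hp2 : 2 < p := by omega
        rw [hf]
        dsimp only
        rw [factorization_centralBinom_of_two_mul_self_lt_three_mul hn hp.1.2 h3, _root_.pow_zero]
    refine (Finset.prod_le_prod' hsub).trans ?_
    rw [Finset.prod_ite, Finset.prod_const_one, mul_one]
    refine Finset.prod_le_prod_of_subset_of_one_le' ?_ ?_
    · intro p hp; exact (Finset.mem_filter.1 hp).2
    · intro p hp _; exact (mem_primesLE.1 hp).2.one_lt.le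
  · refine (Finset.prod_le_pow_card _ _ _ fun p _ => hf2 p).trans ?_
    refine Nat.pow_le_pow_right n2_pos (Finset.card_le_card fun x hx => ?_)
    simp only [hS, Finset.mem_filter, Finset.mem_range, Finset.mem_Ioc] at hx ⊢
    exact ⟨⟨by omega, by omega⟩, hx.1.2⟩

theorem eventually_rpow_le_card_primes_Ioc {η : ℝ} (hη : 0 < η) (hη2 : η ≤ 1 / 2) :
    ∀ᶠ n : ℕ in Filter.atTop,
      (n : ℝ) ^ (1 - η) ≤ ((Finset.Ioc n (2 * n)).filter Nat.Prime).card := by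
  have ht : Filter.Tendsto (fun n : ℕ => (n : ℝ) ^ (η / 2)) Filter.atTop Filter.atTop :=
    (tendsto_rpow_atTop (by positivity)).comp tendsto_natCast_atTop_atTop
  filter_upwards [ht.eventually_gt_atTop (48 / η), Filter.eventually_ge_atTop 4] with n hn hn4
  by_contra! hlt
  set c := ((Finset.Ioc n (2 * n)).filter Nat.Prime).card with hc
  have hn0 : (0 : ℝ) < n := by positivity
  have hn1 : (1 : ℝ) ≤ n := by exact_mod_cast (by omega : 1 ≤ n)
  have h1 : 4 ^ n < n * ((2 * n) ^ Nat.sqrt (2 * n) * 4 ^ (2 * n / 3) * (2 * n) ^ c) :=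
    (Nat.four_pow_lt_mul_centralBinom n hn4).trans_le
      (Nat.mul_le_mul_left n (centralBinom_le_mul_pow_card_primes (by omega)))
  have h2 : (4 : ℝ) ^ n ≤ n * ((2 * n) ^ Nat.sqrt (2 * n) * 4 ^ (2 * n / 3) * (2 * n) ^ c) := by
    exact_mod_cast h1.le
  have h3 := Real.log_le_log (by positivity) h2
  rw [Real.log_mul (by positivity) (by positivity), Real.log_mul (by positivity) (by positivity),
    Real.log_mul (by positivity) (by positivity), Real.log_pow, Real.log_pow, Real.log_pow,
    Real.log_pow] at h3
  have hL0 : 0 ≤ Real.log (2 * n) := Real.log_nonneg (by linarith)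
  have hlogn : Real.log n ≤ Real.log (2 * n) := Real.log_le_log hn0 (by linarith)
  have hdiv : ((2 * n / 3 : ℕ) : ℝ) ≤ 2 * n / 3 := by
    refine Nat.cast_div_le.trans ?_
    push_cast; rfl
  have hlog4 : 1 ≤ Real.log 4 := by
    rw [Real.le_log_iff_exp_le (by norm_num)]
    exact Real.exp_one_lt_d9.le.trans (by norm_num)
  have hsqrt : ((Nat.sqrt (2 * n) : ℕ) : ℝ) ≤ 2 * (n : ℝ) ^ (1 - η) := by
    calc ((Nat.sqrt (2 * n) : ℕ) : ℝ) ≤ √((2 * n : ℕ) : ℝ) := Real.nat_sqrt_le_real_sqrt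
      _ ≤ √((2 * 2) * n) := Real.sqrt_le_sqrt (by push_cast; linarith)
      _ = 2 * √n := by
        rw [Real.sqrt_mul (by norm_num), Real.sqrt_mul_self (by norm_num)]
      _ ≤ 2 * (n : ℝ) ^ (1 - η) := by
        rw [Real.sqrt_eq_rpow]
        gcongr
        · linarith
  have hone : 1 ≤ (n : ℝ) ^ (1 - η) := Real.one_le_rpow hn1 (by linarith)
  have hlog : Real.log (2 * n) ≤ 4 / η * (n : ℝ) ^ (η / 2) := by
    calc Real.log (2 * n) ≤ (2 * n : ℝ) ^ (η / 2) / (η / 2) :=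
          Real.log_le_rpow_div (by positivity) (by positivity)
      _ = 2 ^ (η / 2) * (n : ℝ) ^ (η / 2) / (η / 2) := by
          rw [Real.mul_rpow (by norm_num) hn0.le]
      _ ≤ 2 ^ (1 : ℝ) * (n : ℝ) ^ (η / 2) / (η / 2) := by
          gcongr
          · norm_num
          · linarith
      _ = _ := by rw [Real.rpow_one]; ring
  have h4 : (n : ℝ) / 3 ≤ (1 + Nat.sqrt (2 * n) + c) * Real.log (2 * n) := by
    have h5 : ((2 * n / 3 : ℕ) : ℝ) * Real.log 4 ≤ 2 * n / 3 * Real.log 4 := by gcongr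
    have h6 : (n : ℝ) / 3 * 1 ≤ n / 3 * Real.log 4 := by gcongr
    linarith
  have h7 : (n : ℝ) / 3 ≤ (4 * (n : ℝ) ^ (1 - η)) * (4 / η * (n : ℝ) ^ (η / 2)) := by
    refine h4.trans (mul_le_mul ?_ hlog hL0 (by positivity))
    linarith
  have h8 : (n : ℝ) ^ (1 - η) * (n : ℝ) ^ (η / 2) * (n : ℝ) ^ (η / 2) = n := by
    rw [← Real.rpow_add hn0, ← Real.rpow_add hn0]
    conv_rhs => rw [← Real.rpow_one (n : ℝ)]
    congr 1; ring
  have h9 : (n : ℝ) ^ (1 - η) * (n : ℝ) ^ (η / 2) * (48 / η) < n := by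
    conv_rhs => rw [← h8]
    gcongr
  have h10 : (4 * (n : ℝ) ^ (1 - η)) * (4 / η * (n : ℝ) ^ (η / 2)) * 3
      = (n : ℝ) ^ (1 - η) * (n : ℝ) ^ (η / 2) * (48 / η) := by ring
  linarith

/-- The primes in `[Z, 2Z)`. -/
noncomputable def dyadicPrimes (Z : ℝ) : Finset ℕ :=
  (Finset.range ⌈2 * Z⌉₊).filter fun p => p.Prime ∧ Z ≤ p

theorem mem_dyadicPrimes {Z : ℝ} {p : ℕ} :
    p ∈ dyadicPrimes Z ↔ p.Prime ∧ Z ≤ p ∧ (p : ℝ) < 2 * Z := by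
  rw [dyadicPrimes, Finset.mem_filter, Finset.mem_range, Nat.lt_ceil]
  tauto

theorem exists_rpow_le_card_dyadicPrimes {η : ℝ} (hη : 0 < η) (hη2 : η ≤ 1 / 2) :
    ∃ Z₀ : ℝ, ∀ Z, Z₀ ≤ Z → Z ^ (1 - η) / 2 ≤ (dyadicPrimes Z).card := by
  obtain ⟨N, hN⟩ := Filter.eventually_atTop.1 (eventually_rpow_le_card_primes_Ioc hη hη2)
  refine ⟨max (N + 1) 2, fun Z hZ => ?_⟩
  have hZ2 : 2 ≤ Z := (le_max_right _ _).trans hZ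
  have hZN : (N : ℝ) + 1 ≤ Z := (le_max_left _ _).trans hZ
  have hfl : Z < ⌊Z⌋₊ + 1 := Nat.lt_floor_add_one Z
  have hfl2 : (⌊Z⌋₊ : ℝ) ≤ Z := Nat.floor_le (by linarith)
  have hn2 : 2 ≤ ⌊Z⌋₊ := Nat.le_floor (by exact_mod_cast hZ2)
  have h1 := hN ⌊Z⌋₊ (Nat.le_floor (by linarith))
  have hsub : (Finset.Ioc ⌊Z⌋₊ (2 * ⌊Z⌋₊)).filter Nat.Prime ⊆ dyadicPrimes Z := by
    intro p hp
    rw [Finset.mem_filter, Finset.mem_Ioc] at hp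
    obtain ⟨⟨ha, hb⟩, hp⟩ := hp
    rw [mem_dyadicPrimes]
    refine ⟨hp, ?_, ?_⟩
    · have : ((⌊Z⌋₊ + 1 : ℕ) : ℝ) ≤ p := by exact_mod_cast ha
      push_cast at this
      linarith
    · have hne : p ≠ 2 * ⌊Z⌋₊ := by
        rintro rfl
        exact Nat.not_prime_mul (by norm_num) (by omega) hp
      have : (p : ℝ) < (2 * ⌊Z⌋₊ : ℕ) := by exact_mod_cast lt_of_le_of_ne hb hne
      push_cast at this
      linarith
  have h2 : Z ^ (1 - η) / 2 ≤ (⌊Z⌋₊ : ℝ) ^ (1 - η) := by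
    have h3 : (Z / 2) ^ (1 - η) ≤ (⌊Z⌋₊ : ℝ) ^ (1 - η) := by
      gcongr
      · linarith
      · linarith
    refine le_trans ?_ h3
    rw [Real.div_rpow (by linarith) (by norm_num)]
    gcongr
    calc (2 : ℝ) ^ (1 - η) ≤ 2 ^ (1 : ℝ) := by
          gcongr
          · norm_num
          · linarith
      _ = 2 := Real.rpow_one 2
  exact h2.trans (h1.trans (by exact_mod_cast Finset.card_le_card hsub))

/-- The divisor bound `τ(n) ≪ n ^ ε`. -/
theorem exists_card_divisors_le_mul_rpow {ε : ℝ} (hε : 0 < ε) :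
    ∃ C : ℝ, 0 < C ∧ ∀ n : ℕ, n ≠ 0 → (n.divisors.card : ℝ) ≤ C * (n : ℝ) ^ ε := by
  set B := ⌈(2 : ℝ) ^ (1 / ε)⌉₊ with hB
  set K : ℝ := 1 + 1 / (ε * Real.log 2) with hK
  have hlog2 : 0 < Real.log 2 := Real.log_pos (by norm_num)
  have hK1 : 1 ≤ K := by rw [hK]; linarith [show 0 < 1 / (ε * Real.log 2) by positivity]
  refine ⟨K ^ B, by positivity, fun n hn => ?_⟩
  have hloc : ∀ p ∈ n.primeFactors, ((n.factorization p + 1 : ℕ) : ℝ) ≤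
      (if p < B then K else 1) * ((p : ℝ) ^ n.factorization p) ^ ε := by
    intro p hp
    have hp2 : (2 : ℝ) ≤ p := by exact_mod_cast (Nat.prime_of_mem_primeFactors hp).two_le
    set a := n.factorization p
    have hswap : ((p : ℝ) ^ a) ^ ε = ((p : ℝ) ^ ε) ^ a := by
      rw [← Real.rpow_natCast, ← Real.rpow_mul (by linarith), mul_comm, Real.rpow_mul (by linarith),
        Real.rpow_natCast]
    rw [hswap]
    push_cast
    split_ifs with h
    · have h1 : 1 + (a : ℝ) * (ε * Real.log 2) ≤ ((p : ℝ) ^ ε) ^ a := by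
        have h2 : 1 + ε * Real.log 2 ≤ (p : ℝ) ^ ε := by
          calc 1 + ε * Real.log 2 ≤ Real.exp (Real.log 2 * ε) := by
                linarith [Real.add_one_le_exp (Real.log 2 * ε)]
            _ = 2 ^ ε := by rw [Real.rpow_def_of_pos (by norm_num)]
            _ ≤ (p : ℝ) ^ ε := by gcongr
        calc 1 + (a : ℝ) * (ε * Real.log 2) ≤ (1 + ε * Real.log 2) ^ a :=
              one_add_mul_le_pow (by linarith [mul_pos hε hlog2]) a
          _ ≤ _ := by gcongr
      calc (a : ℝ) + 1 ≤ K * (1 + (a : ℝ) * (ε * Real.log 2)) := by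
            have h3 : K * (1 + (a : ℝ) * (ε * Real.log 2))
              = 1 + a + 1 / (ε * Real.log 2) + a * (ε * Real.log 2) := by
              rw [hK]; field_simp; ring
            rw [h3]
            have : 0 ≤ 1 / (ε * Real.log 2) + a * (ε * Real.log 2) := by positivity
            linarith
        _ ≤ _ := by gcongr
    · have h2 : (2 : ℝ) ≤ (p : ℝ) ^ ε := by
        have h3 : (2 : ℝ) ^ (1 / ε) ≤ p := (Nat.le_ceil _).trans (by exact_mod_cast not_lt.1 h)
        calc (2 : ℝ) = ((2 : ℝ) ^ (1 / ε)) ^ ε := by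
              rw [← Real.rpow_mul (by norm_num), one_div_mul_cancel hε.ne', Real.rpow_one]
          _ ≤ _ := by gcongr
      have h4 : (a : ℝ) + 1 ≤ 2 ^ a := by exact_mod_cast Nat.lt_two_pow_self
      rw [one_mul]
      exact h4.trans (by gcongr)
  have hprod : ∏ p ∈ n.primeFactors, ((p : ℝ) ^ n.factorization p) ^ ε = (n : ℝ) ^ ε := by
    rw [Real.finsetProd_rpow _ _ fun p _ => by positivity]
    congr 1
    have := Nat.prod_factorization_pow_eq_self hn
    rw [Finsupp.prod, Nat.support_factorization] at this
    exact_mod_cast this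
  have hconst : ∏ p ∈ n.primeFactors, (if p < B then K else 1) ≤ K ^ B := by
    rw [Finset.prod_ite, Finset.prod_const_one, mul_one, Finset.prod_const]
    refine pow_le_pow_right₀ hK1 ?_
    refine (Finset.card_le_card fun p hp => ?_).trans (Finset.card_range B).le
    exact Finset.mem_range.2 (Finset.mem_filter.1 hp).2
  rw [Nat.card_divisors hn]
  push_cast at hloc ⊢
  calc _ ≤ ∏ p ∈ n.primeFactors, ((if p < B then K else 1) * ((p : ℝ) ^ n.factorization p) ^ ε) :=
        Finset.prod_le_prod (fun _ _ => by positivity) hloc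
    _ = (∏ p ∈ n.primeFactors, if p < B then K else 1) * (n : ℝ) ^ ε := by
        rw [Finset.prod_mul_distrib, hprod]
    _ ≤ _ := by gcongr

open NumberField in
/-- `IsSqrtNeg b δ d` says that `δ` is an algebraic integer of `K` with `δ² = -d` and that
`(1, δ)` is the `ℚ`-basis `b` of `K`. -/
structure IsSqrtNeg {K : Type*} [Field K] [NumberField K] (b : Module.Basis (Fin 2) ℚ K) (δ : 𝓞 K)
    (d : ℕ) : Prop where
  basis_zero : b 0 = 1
  basis_one : b 1 = (δ : K)
  mul_self : δ * δ = -(d : 𝓞 K)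
  squarefree : Squarefree d

theorem Rat.exists_int_eq_of_squarefree_mul_sq {d : ℕ} (hd : Squarefree d) {w : ℚ} {m : ℤ}
    (h : (d : ℚ) * w ^ 2 = m) : ∃ k : ℤ, w = k := by
  have hden : (w.den : ℚ) ≠ 0 := by exact_mod_cast w.den_nz
  have h1 : (d : ℤ) * w.num ^ 2 = m * (w.den : ℤ) ^ 2 := by
    have : (d : ℚ) * w.num ^ 2 = m * (w.den : ℚ) ^ 2 := by
      rw [← h]
      conv_rhs => rw [← Rat.num_div_den w]
      rw [Rat.num_div_den]
      have := Rat.mul_den_eq_num w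
      rw [← this]; ring
    exact_mod_cast this
  have hcop : IsCoprime ((w.den : ℤ) ^ 2) (w.num ^ 2) := by
    refine IsCoprime.pow ?_
    rw [Int.isCoprime_iff_gcd_eq_one, Int.gcd_comm]
    exact w.reduced
  have h2 : ((w.den : ℤ) ^ 2) ∣ (d : ℤ) := hcop.dvd_of_dvd_mul_right ⟨m, by rw [h1]; ring⟩
  have h3 : w.den * w.den ∣ d := by
    rw [← sq]; exact_mod_cast h2
  have h4 : w.den = 1 := Nat.isUnit_iff.1 (hd _ h3)
  exact ⟨w.num, by rw [Rat.den_eq_one_iff] at h4; exact h4.symm⟩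

namespace IsSqrtNeg

open NumberField

variable {K : Type*} [Field K] [NumberField K] {b : Module.Basis (Fin 2) ℚ K} {δ : 𝓞 K} {d : ℕ}

theorem leftMulMatrix_eq (h : IsSqrtNeg b δ d) (A B : ℚ) :
    Algebra.leftMulMatrix b (algebraMap ℚ K A + algebraMap ℚ K B * δ) = !![A, -(d * B); B, A] := by
  have hδ : (δ : K) * δ = -(d : K) := by
    simpa only [map_mul, map_neg, map_natCast] using congrArg (algebraMap (𝓞 K) K) h.mul_self
  have e0 : b.repr 1 = Finsupp.single 0 1 := by rw [← h.basis_zero, b.repr_self]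
  have e1 : b.repr (δ : K) = Finsupp.single 1 1 := by rw [← h.basis_one, b.repr_self]
  have k0 : (algebraMap ℚ K A + algebraMap ℚ K B * δ) * 1 = A • (1 : K) + B • (δ : K) := by
    rw [Algebra.smul_def, Algebra.smul_def]; ring
  have k1 : (algebraMap ℚ K A + algebraMap ℚ K B * δ) * δ = (-(d * B)) • (1 : K) + A • (δ : K) := by
    rw [Algebra.smul_def, Algebra.smul_def, add_mul, mul_assoc, hδ]
    simp only [map_neg, map_mul, map_natCast]; ring
  ext i j
  rw [Algebra.leftMulMatrix_eq_repr_mul]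
  fin_cases j
  · simp only [Fin.zero_eta, h.basis_zero, k0, map_add, map_smul, e0, e1]
    fin_cases i <;> simp
  · simp only [Fin.mk_one, h.basis_one, k1, map_add, map_smul, e0, e1]
    fin_cases i <;> simp

theorem norm_eq (h : IsSqrtNeg b δ d) (A B : ℚ) :
    Algebra.norm ℚ (algebraMap ℚ K A + algebraMap ℚ K B * δ) = A ^ 2 + d * B ^ 2 := by
  rw [Algebra.norm_eq_matrix_det b, h.leftMulMatrix_eq, Matrix.det_fin_two_of]; ring

theorem trace_eq (h : IsSqrtNeg b δ d) (A B : ℚ) :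
    Algebra.trace ℚ K (algebraMap ℚ K A + algebraMap ℚ K B * δ) = 2 * A := by
  rw [Algebra.trace_eq_matrix_trace b, h.leftMulMatrix_eq, Matrix.trace_fin_two_of]; ring

theorem exists_rat_coords (h : IsSqrtNeg b δ d) (x : K) :
    ∃ A B : ℚ, x = algebraMap ℚ K A + algebraMap ℚ K B * δ := by
  refine ⟨b.repr x 0, b.repr x 1, ?_⟩
  have := b.sum_repr x
  rw [Fin.sum_univ_two, h.basis_zero, h.basis_one, Algebra.smul_def, Algebra.smul_def,
    mul_one] at this
  exact this.symm

theorem coords_unique (h : IsSqrtNeg b δ d) {u v u' v' : ℤ}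
    (he : (u : 𝓞 K) + v * δ = u' + v' * δ) : u = u' ∧ v = v' := by
  have e0 : b.repr 1 = Finsupp.single 0 1 := by rw [← h.basis_zero, b.repr_self]
  have e1 : b.repr (δ : K) = Finsupp.single 1 1 := by rw [← h.basis_one, b.repr_self]
  have he' : (u : ℚ) • (1 : K) + (v : ℚ) • (δ : K) = (u' : ℚ) • (1 : K) + (v' : ℚ) • (δ : K) := by
    simp only [Algebra.smul_def, mul_one, map_intCast]
    simpa only [map_add, map_mul, map_intCast] using congrArg (algebraMap (𝓞 K) K) he
  have := congrArg b.repr he'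
  simp only [map_add, map_smul, e0, e1] at this
  have h0 := DFunLike.congr_fun this 0
  have h1 := DFunLike.congr_fun this 1
  simp at h0 h1
  exact ⟨h0, h1⟩

theorem exists_int_coords (h : IsSqrtNeg b δ d) (x : 𝓞 K) :
    ∃ u v : ℤ, 2 * x = u + v * δ ∧ 4 * Algebra.norm ℤ x = u ^ 2 + d * v ^ 2 := by
  obtain ⟨A, B, hx⟩ := h.exists_rat_coords (x : K)
  have ht : ((Algebra.trace ℤ (𝓞 K) x : ℤ) : ℚ) = 2 * A := by
    rw [Algebra.coe_trace_int, hx, h.trace_eq]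
  have hn : ((Algebra.norm ℤ x : ℤ) : ℚ) = A ^ 2 + d * B ^ 2 := by
    rw [Algebra.coe_norm_int, hx, h.norm_eq]
  set u := Algebra.trace ℤ (𝓞 K) x
  set n := Algebra.norm ℤ x
  obtain ⟨v, hv⟩ := Rat.exists_int_eq_of_squarefree_mul_sq h.squarefree
    (w := 2 * B) (m := 4 * n - u ^ 2) (by push_cast; rw [hn, ht]; ring)
  refine ⟨u, v, ?_, ?_⟩
  · apply FaithfulSMul.algebraMap_injective (𝓞 K) K
    have h1 : (u : K) = algebraMap ℚ K (2 * A) := by rw [← ht, map_intCast]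
    have h2 : (v : K) = algebraMap ℚ K (2 * B) := by rw [hv, map_intCast]
    simp only [map_mul, map_ofNat] at h1 h2
    simp only [map_add, map_mul, map_intCast, map_ofNat]
    have hx' : algebraMap (𝓞 K) K x
      = algebraMap ℚ K A + algebraMap ℚ K B * algebraMap (𝓞 K) K δ := hx
    rw [h1, h2, hx']; ring
  · have : (4 * n : ℚ) = u ^ 2 + d * v ^ 2 := by rw [hn, ht, ← hv]; ring
    exact_mod_cast this

/-- The ring of integers is `ℤ + ℤ ω` with `2 ω = t + s δ`, `t ∈ {0, 1}`, `s ∈ {1, 2}`. -/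
theorem exists_generator (h : IsSqrtNeg b δ d) :
    ∃ (ω : 𝓞 K) (t s : ℤ), 2 * ω = t + s * δ ∧ 0 ≤ t ∧ t ≤ 1 ∧ 1 ≤ s ∧ s ≤ 2 ∧
      ∀ x : 𝓞 K, ∃ m n : ℤ, x = m + n * ω := by
  have two_ne : (2 : 𝓞 K) ≠ 0 := two_ne_zero
  have hrat : ∀ (x : 𝓞 K) (u : ℤ), 2 * x = u → ∃ m : ℤ, x = m := by
    intro x u hu
    obtain ⟨u', v', h1, h2⟩ := h.exists_int_coords x
    have h3 := h.coords_unique (u := u) (v := 0) (u' := u') (v' := v') (by rw [← h1, hu]; simp)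
    obtain ⟨rfl, rfl⟩ := h3
    have hev : Even u := by
      have : Even (u ^ 2) := ⟨2 * Algebra.norm ℤ x, by linarith⟩
      simpa [Int.even_pow] using this
    obtain ⟨m, rfl⟩ := hev
    refine ⟨m, mul_left_cancel₀ two_ne ?_⟩
    rw [hu]; push_cast; ring
  by_cases hodd : ∃ (x : 𝓞 K) (u k : ℤ), 2 * x = u + (2 * k + 1 : ℤ) * δ
  · obtain ⟨x, u, k, hx⟩ := hodd
    set ω : 𝓞 K := x - k * δ - (u / 2 : ℤ) with hω
    have h2ω : 2 * ω = (u % 2 : ℤ) + (1 : ℤ) * δ := by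
      have hu : (u : 𝓞 K) = (u % 2 : ℤ) + 2 * (u / 2 : ℤ) := by
        exact_mod_cast (Int.emod_add_mul_ediv u 2).symm
      have : 2 * ω = 2 * x - 2 * k * δ - 2 * (u / 2 : ℤ) := by rw [hω]; ring
      rw [this, hx, hu]; push_cast; ring
    refine ⟨ω, u % 2, 1, h2ω, Int.emod_nonneg _ (by norm_num), by omega, le_rfl, by norm_num,
      fun y => ?_⟩
    obtain ⟨u', v', h1, -⟩ := h.exists_int_coords y
    obtain ⟨m, hm⟩ := hrat (y - v' * ω) (u' - v' * (u % 2)) (by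
      calc 2 * (y - v' * ω) = 2 * y - v' * (2 * ω) := by ring
        _ = _ := by rw [h1, h2ω]; push_cast; ring)
    exact ⟨m, v', by rw [← hm]; ring⟩
  · refine ⟨δ, 0, 2, by push_cast; ring, le_rfl, by norm_num, by norm_num, le_rfl, fun y => ?_⟩
    obtain ⟨u', v', h1, -⟩ := h.exists_int_coords y
    rcases Int.even_or_odd' v' with ⟨k, rfl | rfl⟩
    · obtain ⟨m, hm⟩ := hrat (y - k * δ) u' (by
        calc 2 * (y - k * δ) = 2 * y - 2 * k * δ := by ring
          _ = _ := by rw [h1]; push_cast; ring)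
      exact ⟨m, k, by rw [← hm]; ring⟩
    · exact absurd ⟨y, u', k, h1⟩ hodd

end IsSqrtNeg

/-- The class `C` contains an ideal `(a, k + ω)` of `R` with `a > 0` dividing `k² + t k + n`. -/
def HasPresentation {R : Type*} [CommRing R] [IsDedekindDomain R] (ω : R) (t n : ℤ)
    (C : ClassGroup R) (a : ℕ) (k : ℤ) : Prop :=
  0 < a ∧ (a : ℤ) ∣ k ^ 2 + t * k + n ∧ ∃ I : nonZeroDivisors (Ideal R),
    ClassGroup.mk0 I = C ∧ (I : Ideal R) = Ideal.span {(a : R), k + ω}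

theorem add_mul_conj_eq {R : Type*} [CommRing R] {ω : R} {t n : ℤ}
    (hω : ω * (t - ω) = n) (k : ℤ) :
    ((k : R) + ω) * (k + t - ω) = ((k ^ 2 + t * k + n : ℤ) : R) := by
  push_cast
  rw [← hω]; ring

section Presentation

variable {R : Type*} [CommRing R] [IsDedekindDomain R] {ω : R} {t n : ℤ}

theorem exists_hasPresentation [CharZero R] (hω : ω * (t - ω) = n)
    (hgen : ∀ x : R, ∃ m l : ℤ, x = m + l * ω) (hInt : ∀ I : Ideal R, I ≠ ⊥ →
      ∃ a : ℤ, a ≠ 0 ∧ (a : R) ∈ I) (C : ClassGroup R) :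
    ∃ a k, HasPresentation ω t n C a k := by
  obtain ⟨I, rfl⟩ := ClassGroup.mk0_surjective C
  have hI0 : (I : Ideal R) ≠ ⊥ := nonZeroDivisors.ne_zero I.2
  let H : AddSubgroup ℤ :=
    { carrier := {l | ∃ m : ℤ, (m + l * ω : R) ∈ (I : Ideal R)}
      zero_mem' := ⟨0, by simp⟩
      add_mem' := by
        rintro l l' ⟨m, hm⟩ ⟨m', hm'⟩
        exact ⟨m + m', by convert (I : Ideal R).add_mem hm hm' using 1; push_cast; ring⟩
      neg_mem' := by
        rintro l ⟨m, hm⟩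
        exact ⟨-m, by convert (I : Ideal R).neg_mem hm using 1; push_cast; ring⟩ }
  obtain ⟨c, hc⟩ := Int.subgroup_cyclic H
  have hmemH : ∀ l, l ∈ H ↔ c ∣ l := by
    intro l
    rw [hc, ← AddSubgroup.zmultiples_eq_closure, Int.mem_zmultiples_iff]
  have hdvd : ∀ m l : ℤ, (m + l * ω : R) ∈ (I : Ideal R) → c ∣ l ∧ c ∣ m := by
    intro m l hml
    have h1 : c ∣ l := (hmemH l).1 ⟨m, hml⟩
    refine ⟨h1, ?_⟩
    have h2 : c ∣ m + l * t := (hmemH _).1 ⟨-(l * n), by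
      convert (I : Ideal R).mul_mem_left ω hml using 1
      push_cast
      rw [← hω]; ring⟩
    exact (Int.dvd_add_left (h1.mul_right t)).1 h2
  obtain ⟨a₀, ha₀, ha₀I⟩ := hInt I hI0
  have hc0 : c ≠ 0 := by
    rintro rfl
    exact ha₀ (zero_dvd_iff.1 (hdvd a₀ 0 (by simpa using ha₀I)).2)
  have hcR : (c : R) ≠ 0 := by exact_mod_cast hc0
  have hle : (I : Ideal R) ≤ Ideal.span {(c : R)} := by
    intro x hx
    obtain ⟨m, l, rfl⟩ := hgen x
    obtain ⟨⟨l', rfl⟩, ⟨m', rfl⟩⟩ := hdvd m l hx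
    exact Ideal.mem_span_singleton.2 ⟨m' + l' * ω, by push_cast; ring⟩
  obtain ⟨J, hJ⟩ := Ideal.dvd_iff_le.2 hle
  have hJ0 : J ≠ ⊥ := by
    rintro rfl
    exact hI0 (by rw [hJ]; simp)
  obtain ⟨m₀, hm₀⟩ : ∃ m : ℤ, ((m : R) + ω) ∈ J := by
    obtain ⟨m, hm⟩ := (hmemH c).2 dvd_rfl
    obtain ⟨m', rfl⟩ := (hdvd m c hm).2
    rw [hJ, Ideal.mem_span_singleton_mul] at hm
    obtain ⟨z, hz, hzc⟩ := hm
    refine ⟨m', ?_⟩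
    have : z = m' + ω := mul_left_cancel₀ hcR (by rw [hzc]; push_cast; ring)
    rwa [← this]
  let A : AddSubgroup ℤ :=
    { carrier := {m | (m : R) ∈ J}
      zero_mem' := by simp
      add_mem' := by
        intro l l' hl hl'
        simpa using J.add_mem hl hl'
      neg_mem' := by
        intro l hl
        simpa using J.neg_mem hl }
  obtain ⟨a, ha⟩ := Int.subgroup_cyclic A
  have hmemA : ∀ m : ℤ, (m : R) ∈ J ↔ a ∣ m := by
    intro m
    rw [← Int.mem_zmultiples_iff, AddSubgroup.zmultiples_eq_closure, ← ha]
    rfl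
  obtain ⟨a₁, ha₁, ha₁J⟩ := hInt J hJ0
  have ha0 : a ≠ 0 := by
    rintro rfl
    exact ha₁ (zero_dvd_iff.1 ((hmemA a₁).1 ha₁J))
  refine ⟨a.natAbs, m₀, Int.natAbs_pos.2 ha0, ?_, ⟨J, mem_nonZeroDivisors_of_ne_zero hJ0⟩, ?_, ?_⟩
  · rw [Int.natAbs_dvd, ← hmemA, ← add_mul_conj_eq hω]
    exact J.mul_mem_right _ hm₀
  · rw [ClassGroup.mk0_eq_mk0_iff]
    exact ⟨c, 1, hcR, one_ne_zero, by
      rw [Ideal.span_singleton_one, Ideal.one_eq_top.symm, one_mul, hJ]⟩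
  · have haJ : ((a.natAbs : ℕ) : R) ∈ J := by
      have : (((a.natAbs : ℕ) : ℤ) : R) ∈ J := (hmemA _).2 (by simp)
      simpa only [Int.cast_natCast] using this
    refine le_antisymm (fun x hx => ?_) (Ideal.span_le.2 ?_)
    · change x ∈ J at hx
      obtain ⟨m, l, rfl⟩ := hgen x
      have h1 : ((m - l * m₀ : ℤ) : R) ∈ J := by
        convert J.sub_mem hx (J.mul_mem_left (l : R) hm₀) using 1
        push_cast; ring
      rw [hmemA, ← Int.natAbs_dvd] at h1
      obtain ⟨e, he⟩ := h1
      rw [Ideal.mem_span_pair]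
      refine ⟨e, l, ?_⟩
      have : (m : R) = l * m₀ + (a.natAbs : ℕ) * e := by
        have : m = l * m₀ + (a.natAbs : ℕ) * e := by rw [← he]; ring
        simpa only [Int.cast_add, Int.cast_mul, Int.cast_natCast] using
          congrArg (Int.cast : ℤ → R) this
      rw [this]; ring
    · rintro x (rfl | rfl)
      exacts [haJ, hm₀]

theorem HasPresentation.shift {C : ClassGroup R} {a : ℕ} {k : ℤ} (h : HasPresentation ω t n C a k)
    (j : ℤ) : HasPresentation ω t n C a (k + j * a) := by
  obtain ⟨h1, h2, I, hI, hI'⟩ := h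
  refine ⟨h1, ?_, I, hI, ?_⟩
  · have : (k + j * a) ^ 2 + t * (k + j * a) + n
      = (k ^ 2 + t * k + n) + a * (j * (2 * k + j * a + t)) := by ring
    rw [this]
    exact dvd_add h2 (dvd_mul_right _ _)
  · rw [hI', Ideal.span_pair_comm,
      ← Ideal.span_pair_add_mul_right (x := (k + ω : R)) (y := (a : R)) (j : R), Ideal.span_pair_comm]
    congr 2
    push_cast; ring_nf

theorem HasPresentation.flip [CharZero R] (hω : ω * (t - ω) = n) {C : ClassGroup R} {a c : ℕ}
    {k : ℤ}
    (h : HasPresentation ω t n C a k) (hc0 : 0 < c) (hc : k ^ 2 + t * k + n = a * c) :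
    HasPresentation ω t n C c (-k - t) := by
  obtain ⟨h1, h2, I, hI, hI'⟩ := h
  have hcR : (c : R) ≠ 0 := by exact_mod_cast hc0.ne'
  have haR : (a : R) ≠ 0 := by exact_mod_cast h1.ne'
  have hmul : ((k : R) + ω) * (k + t - ω) = a * c := by
    rw [add_mul_conj_eq hω, hc]; push_cast; ring
  have hconj : (k + t - ω : R) ≠ 0 := by
    intro h0
    rw [h0, mul_zero] at hmul
    exact mul_ne_zero haR hcR hmul.symm
  refine ⟨hc0, ⟨a, by linear_combination hc⟩,
    ⟨Ideal.span {(c : R), ((-k - t : ℤ) : R) + ω}, mem_nonZeroDivisors_of_ne_zero ?_⟩, ?_, rfl⟩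
  · intro h0
    have hmem : (c : R) ∈ Ideal.span {(c : R), ((-k - t : ℤ) : R) + ω} :=
      Ideal.subset_span (by simp)
    rw [h0] at hmem
    exact hcR (by simpa using hmem)
  · rw [← hI, ClassGroup.mk0_eq_mk0_iff]
    refine ⟨a, k + t - ω, haR, hconj, ?_⟩
    rw [hI', Ideal.span_mul_span', Ideal.span_mul_span']
    simp only [Set.singleton_mul, Set.image_pair]
    have e1 : (k + t - ω : R) * (k + ω) = a * c := by rw [mul_comm, hmul]
    have e2 : (a : R) * (((-k - t : ℤ) : R) + ω) = -((k + t - ω) * a) := by push_cast; ring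
    rw [e1, e2, Ideal.span_pair_comm, Ideal.span_insert, Ideal.span_insert, Ideal.span_singleton_neg]

end Presentation

namespace IsSqrtNeg

open NumberField

variable {K : Type*} [Field K] [NumberField K] {b : Module.Basis (Fin 2) ℚ K} {δ : 𝓞 K} {d : ℕ}

/-- Every ideal class of `ℚ(√-d)` contains an ideal `(a, k + ω)` with small `k² + t k + n`. -/
theorem exists_reduced_presentation (h : IsSqrtNeg b δ d) :
    ∃ (ω : 𝓞 K) (t n : ℤ), (∀ k : ℤ, 0 < k ^ 2 + t * k + n) ∧
      ∀ C : ClassGroup (𝓞 K), ∃ (a : ℕ) (k : ℤ), HasPresentation ω t n C a k ∧ k ^ 2 ≤ 2 * d ∧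
        k ^ 2 + t * k + n ≤ 2 * d := by
  obtain ⟨ω, t, s, hω2, ht0, ht1, hs1, hs2, hgen⟩ := h.exists_generator
  have hd : (0 : ℤ) < d := by exact_mod_cast h.squarefree.ne_zero.bot_lt
  obtain ⟨u, v, huv, hnorm⟩ := h.exists_int_coords ω
  obtain ⟨rfl, rfl⟩ := h.coords_unique (huv.symm.trans hω2)
  set n := Algebra.norm ℤ ω
  have hω : ω * (u - ω) = (n : 𝓞 K) := by
    have h4 : (4 : 𝓞 K) * n = u ^ 2 + d * v ^ 2 := by
      exact_mod_cast congrArg (Int.cast : ℤ → 𝓞 K) hnorm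
    have h4ne : (4 : 𝓞 K) ≠ 0 := by norm_num
    apply mul_left_cancel₀ h4ne
    calc (4 : 𝓞 K) * (ω * (u - ω)) = (2 * ω) * (2 * u - 2 * ω) := by ring
      _ = u ^ 2 - v ^ 2 * (δ * δ) := by rw [hω2]; ring
      _ = 4 * n := by rw [h.mul_self, h4]; ring
  have hv : v ^ 2 * d ≤ 4 * d := by
    have : v ^ 2 ≤ 4 := by nlinarith
    nlinarith
  have hv1 : (d : ℤ) ≤ v ^ 2 * d := by
    have : 1 ≤ v ^ 2 := by nlinarith
    nlinarith
  have h4f : ∀ k : ℤ, 4 * (k ^ 2 + u * k + n) = (2 * k + u) ^ 2 + v ^ 2 * d := by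
    intro k; linear_combination hnorm
  have hpos : ∀ k : ℤ, 0 < k ^ 2 + u * k + n := by
    intro k; nlinarith [h4f k, sq_nonneg (2 * k + u)]
  refine ⟨ω, u, n, hpos, fun C => ?_⟩
  have hInt : ∀ I : Ideal (𝓞 K), I ≠ ⊥ → ∃ a : ℤ, a ≠ 0 ∧ (a : 𝓞 K) ∈ I := by
    intro I hI
    refine ⟨(Ideal.absNorm I : ℕ), ?_, ?_⟩
    · exact_mod_cast fun h0 => hI (Ideal.absNorm_eq_zero_iff.1 h0)
    · exact_mod_cast Ideal.absNorm_mem I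
  have hex : ∃ a k, HasPresentation ω u n C a k := exists_hasPresentation hω hgen hInt C
  classical
  obtain ⟨k₀, hk₀⟩ := Nat.find_spec hex
  have hmin : ∀ a k, HasPresentation ω u n C a k → Nat.find hex ≤ a :=
    fun a k hak => Nat.find_min' hex ⟨k, hak⟩
  set a := Nat.find hex
  have ha : (0 : ℤ) < a := by exact_mod_cast hk₀.1
  set q := (2 * k₀ + u + a) / (2 * a : ℤ) with hq
  set k := k₀ + -q * a with hk
  have hpres : HasPresentation ω u n C a k := hk₀.shift _
  have hka : (2 * k + u) ^ 2 ≤ (a : ℤ) ^ 2 := by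
    have e1 := Int.emod_add_mul_ediv (2 * k₀ + u + a) (2 * a : ℤ)
    have e2 := Int.emod_nonneg (2 * k₀ + u + a) (b := (2 * a : ℤ)) (by positivity)
    have e3 := Int.emod_lt_of_pos (2 * k₀ + u + a) (b := (2 * a : ℤ)) (by positivity)
    rw [← hq] at e1
    refine sq_le_sq' ?_ ?_ <;> rw [hk] <;> nlinarith
  obtain ⟨c, hc⟩ := hpres.2.1
  have hc0 : 0 < c := by
    have := hpos k
    rw [hc] at this
    exact pos_of_mul_pos_right this ha.le
  lift c to ℕ using hc0.le
  have hac : (a : ℤ) ≤ c := by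
    exact_mod_cast hmin _ _ (hpres.flip hω (by exact_mod_cast hc0) hc)
  have hf : k ^ 2 + u * k + n ≤ 2 * d := by
    have : (a : ℤ) ^ 2 ≤ k ^ 2 + u * k + n := by rw [hc]; nlinarith
    have := h4f k
    linarith
  refine ⟨a, k, hpres, ?_, hf⟩
  have h1 : k ^ 2 ≤ (2 * k + u) ^ 2 := by
    have : u = 0 ∨ u = 1 := by omega
    rcases this with rfl | rfl
    · nlinarith [sq_nonneg k]
    · rcases le_or_gt 0 k with h0 | h0
      · nlinarith
      · nlinarith
  have : (a : ℤ) ^ 2 ≤ k ^ 2 + u * k + n := by rw [hc]; nlinarith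
  linarith

theorem exists_card_classGroup_le_mul_rpow {ε : ℝ} (hε : 0 < ε) :
    ∃ A : ℝ, 0 < A ∧ ∀ (K : Type) [Field K] [NumberField K] (b : Module.Basis (Fin 2) ℚ K)
      (δ : 𝓞 K) (d : ℕ), IsSqrtNeg b δ d →
      (Nat.card (ClassGroup (𝓞 K)) : ℝ) ≤ A * (d : ℝ) ^ (1 / 2 + ε) := by
  obtain ⟨A, hA, hdiv⟩ := exists_card_divisors_le_mul_rpow hε
  refine ⟨5 * A * 2 ^ ε, by positivity, fun K _ _ b δ d h => ?_⟩
  have hd : 0 < d := h.squarefree.ne_zero.bot_lt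
  obtain ⟨ω, t, n, hpos, hred⟩ := h.exists_reduced_presentation
  choose a k hpres hk hf using hred
  let M : ℕ := Nat.sqrt (2 * d)
  let T : Finset ((_ : ℤ) × ℕ) := ((Finset.Icc (-M : ℤ) M).filter
    fun k => k ^ 2 + t * k + n ≤ 2 * d).sigma fun k => (k ^ 2 + t * k + n).toNat.divisors
  have hT : Nat.card (ClassGroup (𝓞 K)) ≤ T.card := by
    classical
    rw [Nat.card_eq_fintype_card, ← Finset.card_univ]
    refine Finset.card_le_card_of_injOn (fun C => ⟨k C, a C⟩) (fun C _ => ?_) ?_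
    · simp only [T, Finset.mem_coe, Finset.mem_sigma, Finset.mem_filter, Finset.mem_Icc,
        Nat.mem_divisors]
      refine ⟨⟨?_, hf C⟩, ?_, ?_⟩
      · have : (k C).natAbs ≤ M := by
          rw [Nat.le_sqrt']
          have := hk C
          rw [← Int.natAbs_sq] at this
          exact_mod_cast this
        omega
      · have := (hpres C).2.1
        rw [← Int.natCast_dvd_natCast, Int.toNat_of_nonneg (hpos _).le]
        exact this
      · have := hpos (k C)
        omega
    · intro C _ C' _ he
      simp only [Sigma.mk.injEq, heq_eq_eq] at he
      obtain ⟨-, -, I, hI, hI'⟩ := hpres C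
      obtain ⟨-, -, J, hJ, hJ'⟩ := hpres C'
      rw [← hI, ← hJ]
      congr 1
      apply Subtype.ext
      rw [hI', hJ', he.1, he.2]
  have hsum : (T.card : ℝ) ≤ (2 * M + 1 : ℝ) * (A * (2 * d : ℝ) ^ ε) := by
    rw [Finset.card_sigma]
    push_cast
    refine (Finset.sum_le_card_nsmul _ _ (A * (2 * d : ℝ) ^ ε) fun k hk => ?_).trans ?_
    · obtain ⟨-, hk⟩ := Finset.mem_filter.1 hk
      have hp := hpos k
      refine (hdiv _ (by omega)).trans ?_
      gcongr
      have : (k ^ 2 + t * k + n).toNat ≤ 2 * d := by omega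
      exact_mod_cast this
    · rw [nsmul_eq_mul]
      gcongr
      have := Finset.card_filter_le (Finset.Icc (-M : ℤ) M) (fun k => k ^ 2 + t * k + n ≤ 2 * d)
      rw [Int.card_Icc] at this
      have h2 : ((M : ℤ) + 1 - -M).toNat = 2 * M + 1 := by omega
      rw [h2] at this
      exact_mod_cast this
  have hM : (2 * M + 1 : ℝ) ≤ 5 * (d : ℝ) ^ (1 / 2 : ℝ) := by
    rw [← Real.sqrt_eq_rpow]
    have h1 : (1 : ℝ) ≤ √d := Real.one_le_sqrt.2 (by exact_mod_cast hd)
    have h2 : (M : ℝ) ≤ 2 * √d := by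
      have h3 : (M : ℝ) ≤ √(2 * d : ℕ) := Real.nat_sqrt_le_real_sqrt
      refine h3.trans (Real.sqrt_le_iff.2 ⟨by positivity, ?_⟩)
      rw [mul_pow, Real.sq_sqrt (by positivity)]
      push_cast
      have : (0 : ℝ) ≤ d := by positivity
      linarith
    linarith
  calc (Nat.card (ClassGroup (𝓞 K)) : ℝ) ≤ T.card := by exact_mod_cast hT
    _ ≤ _ := hsum
    _ ≤ 5 * (d : ℝ) ^ (1 / 2 : ℝ) * (A * (2 * d : ℝ) ^ ε) := by gcongr
    _ = _ := by
      rw [Real.mul_rpow (by norm_num) (by positivity), Real.rpow_add (by exact_mod_cast hd)]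
      ring

end IsSqrtNeg

theorem card_pow_eq_one_mul_card_sq_le {G ι : Type*} [CommGroup G] [Finite G] [DecidableEq G]
    (g : ℕ) (P : Finset ι) (c : ι → G) :
    Nat.card {x : G // x ^ g = 1} * P.card ^ 2 ≤
      Nat.card G * ((P ×ˢ P).filter fun x => c x.1 ^ g = c x.2 ^ g).card := by
  have := Fintype.ofFinite G
  let φ : G →* G := powMonoidHom g
  have hker : Nat.card {x : G // x ^ g = 1} = Nat.card φ.ker :=
    Nat.card_congr (Equiv.subtypeEquivRight fun x => by rw [MonoidHom.mem_ker]; rfl)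
  have hG : Nat.card φ.ker * Nat.card φ.range = Nat.card G := by
    rw [← Subgroup.index_ker, Subgroup.card_mul_index]
  let T : Finset G := Finset.univ.image φ
  have hT : T.card = Nat.card φ.range := by
    rw [← Set.ncard_coe_finset, Finset.coe_image, Finset.coe_univ, Set.image_univ]
    rfl
  have hmaps : ∀ p ∈ P, c p ^ g ∈ T := fun p _ => Finset.mem_image_of_mem φ (Finset.mem_univ _)
  have hfib := Finset.card_eq_sum_card_fiberwise hmaps
  have hpairs : ((P ×ˢ P).filter fun x => c x.1 ^ g = c x.2 ^ g).card
      = ∑ y ∈ T, (P.filter fun p => c p ^ g = y).card ^ 2 := by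
    rw [Finset.card_eq_sum_card_fiberwise (f := fun x => c x.1 ^ g) (t := T)]
    · refine Finset.sum_congr rfl fun y _ => ?_
      rw [sq, ← Finset.card_product]
      congr 1
      ext ⟨p, q⟩
      simp only [Finset.mem_filter, Finset.mem_product]
      constructor
      · rintro ⟨⟨⟨hp, hq⟩, h1⟩, h2⟩
        exact ⟨⟨hp, h2⟩, hq, h1 ▸ h2⟩
      · rintro ⟨⟨hp, h2⟩, hq, h1⟩
        exact ⟨⟨⟨hp, hq⟩, h2.trans h1.symm⟩, h2⟩
    · intro x hx
      exact hmaps _ (Finset.mem_product.1 (Finset.mem_filter.1 hx).1).1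
  have hCS : P.card ^ 2 ≤ T.card * ∑ y ∈ T, (P.filter fun p => c p ^ g = y).card ^ 2 := by
    rw [hfib]
    exact sq_sum_le_card_mul_sum_sq
  rw [hker, hpairs, ← hG, mul_assoc, ← hT]
  exact Nat.mul_le_mul_left _ hCS

theorem exists_int_of_jacobiSym_neg_eq_one {p d : ℕ} (hp : p.Prime) (h : jacobiSym (-d) p = 1) :
    ∃ r : ℤ, (p : ℤ) ∣ r ^ 2 + d ∧ ¬ (p : ℤ) ∣ r := by
  have := Fact.mk hp
  rw [← jacobiSym.legendreSym.to_jacobiSym] at h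
  have hne : ((-d : ℤ) : ZMod p) ≠ 0 := by
    intro h0
    rw [(legendreSym.eq_zero_iff p _).2 h0] at h
    exact zero_ne_one h
  obtain ⟨r, hr⟩ := (legendreSym.eq_one_iff p hne).1 h
  have hr' : (((r.val : ℕ) : ℤ) : ZMod p) = r := by simp
  refine ⟨r.val, ?_, ?_⟩
  · rw [← ZMod.intCast_zmod_eq_zero_iff_dvd]
    push_cast at hr hr' ⊢
    rw [hr', sq, ← hr]; ring
  · rw [← ZMod.intCast_zmod_eq_zero_iff_dvd, hr']
    rintro rfl
    exact hne (by simpa using hr)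

section SqrtIdeal

open NumberField

/-- The ideal `(p, √-d - r)`. -/
def sqrtIdeal {R : Type*} [CommRing R] (δ : R) (p : ℕ) (r : ℤ) : Ideal R :=
  Ideal.span {(p : R), δ - r}

/-- `p` is an odd prime, prime to `d`, and `r` is a square root of `-d` modulo `p`. -/
structure IsSplitPrime (d p : ℕ) (r : ℤ) : Prop where
  prime : p.Prime
  ne_two : p ≠ 2
  dvd_sq_add : (p : ℤ) ∣ r ^ 2 + d
  not_dvd : ¬ (p : ℤ) ∣ r

theorem natCast_mem_sqrtIdeal {R : Type*} [CommRing R] (δ : R) (p : ℕ) (r : ℤ) :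
    (p : R) ∈ sqrtIdeal δ p r := Ideal.subset_span (by simp)

theorem sub_mem_sqrtIdeal {R : Type*} [CommRing R] (δ : R) (p : ℕ) (r : ℤ) :
    δ - r ∈ sqrtIdeal δ p r := Ideal.subset_span (by simp)

namespace IsSplitPrime

variable {d p q : ℕ} {r s : ℤ}

theorem neg (hp : IsSplitPrime d p r) : IsSplitPrime d p (-r) :=
  ⟨hp.prime, hp.ne_two, by simpa using hp.dvd_sq_add, by simpa using hp.not_dvd⟩

theorem not_dvd_two_mul (hp : IsSplitPrime d p r) : ¬ (p : ℤ) ∣ 2 * r := by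
  intro h
  rcases (Nat.prime_iff_prime_int.1 hp.prime).dvd_or_dvd h with h | h
  · have h2 : p ∣ 2 := by exact_mod_cast h
    exact hp.ne_two ((Nat.prime_dvd_prime_iff_eq hp.prime Nat.prime_two).1 h2)
  · exact hp.not_dvd h

theorem not_dvd_two (hp : IsSplitPrime d p r) : ¬ (p : ℤ) ∣ 2 :=
  fun h => hp.not_dvd_two_mul (h.mul_right r)

theorem not_dvd_right (hp : IsSplitPrime d p r) : ¬ (p : ℤ) ∣ d := by
  intro h
  have := (Int.dvd_add_left h).1 hp.dvd_sq_add
  exact hp.not_dvd ((Nat.prime_iff_prime_int.1 hp.prime).dvd_of_dvd_pow this)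

theorem isCoprime (hp : IsSplitPrime d p r) {m : ℤ} (hm : ¬ (p : ℤ) ∣ m) : IsCoprime (p : ℤ) m :=
  (Nat.prime_iff_prime_int.1 hp.prime).irreducible.coprime_iff_not_dvd.2 hm

theorem one_mem {R : Type*} [CommRing R] {I : Ideal R} (hp : IsSplitPrime d p r) {m : ℤ}
    (hm : ¬ (p : ℤ) ∣ m) (hpI : (p : R) ∈ I) (hmI : (m : R) ∈ I) : I = ⊤ := by
  obtain ⟨x, y, hxy⟩ := hp.isCoprime hm
  rw [Ideal.eq_top_iff_one]
  have h1 : (1 : R) = x * p + y * m := by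
    rw [← Int.cast_one, ← hxy]; push_cast; rfl
  rw [h1]
  exact I.add_mem (I.mul_mem_left _ hpI) (I.mul_mem_left _ hmI)

theorem sqrtIdeal_mul_neg {R : Type*} [CommRing R] {δ : R} (hδ : δ * δ = -(d : R))
    (hp : IsSplitPrime d p r) :
    sqrtIdeal δ p r * sqrtIdeal δ p (-r) = Ideal.span {(p : R)} := by
  apply le_antisymm
  · rw [sqrtIdeal, sqrtIdeal, Ideal.span_mul_span', Ideal.span_le]
    obtain ⟨e, he⟩ := hp.dvd_sq_add
    have he' : (r : R) ^ 2 + d = p * e := by exact_mod_cast congrArg (Int.cast : ℤ → R) he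
    rintro _ ⟨x, hx, y, hy, rfl⟩
    simp only [Set.mem_insert_iff, Set.mem_singleton_iff] at hx hy
    rw [SetLike.mem_coe, Ideal.mem_span_singleton]
    rcases hx with rfl | rfl
    · exact dvd_mul_right _ _
    · rcases hy with rfl | rfl
      · exact dvd_mul_left _ _
      · refine ⟨-e, ?_⟩
        push_cast
        linear_combination hδ - he'
  · rw [Ideal.span_singleton_le_iff_mem]
    set I := sqrtIdeal δ p r * sqrtIdeal δ p (-r)
    have h1 : (p : R) * p ∈ I :=
      Ideal.mul_mem_mul (natCast_mem_sqrtIdeal _ _ _) (natCast_mem_sqrtIdeal _ _ _)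
    have h2 : (p : R) * (δ - (-r : ℤ)) ∈ I :=
      Ideal.mul_mem_mul (natCast_mem_sqrtIdeal _ _ _) (sub_mem_sqrtIdeal _ _ _)
    have h3 : (δ - r) * (p : R) ∈ I :=
      Ideal.mul_mem_mul (sub_mem_sqrtIdeal _ _ _) (natCast_mem_sqrtIdeal _ _ _)
    obtain ⟨x, y, hxy⟩ := hp.isCoprime hp.not_dvd_two_mul
    have hxy' : (x : R) * p + y * (2 * r) = 1 := by
      exact_mod_cast congrArg (Int.cast : ℤ → R) hxy
    have h4 : (p : R) = x * (p * p) + y * (p * (δ - (-r : ℤ)) - (δ - r) * p) := by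
      push_cast
      linear_combination -(p : R) * hxy'
    rw [h4]
    exact I.add_mem (I.mul_mem_left _ h1) (I.mul_mem_left _ (I.sub_mem h2 h3))

end IsSplitPrime

namespace IsSqrtNeg

variable {K : Type*} [Field K] [NumberField K] {b : Module.Basis (Fin 2) ℚ K} {δ : 𝓞 K}
  {d p q : ℕ} {r s : ℤ}

theorem norm_nonneg (h : IsSqrtNeg b δ d) (x : 𝓞 K) : 0 ≤ Algebra.norm ℤ x := by
  obtain ⟨u, v, -, hn⟩ := h.exists_int_coords x
  have : 0 ≤ u ^ 2 + d * v ^ 2 := by positivity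
  linarith

theorem absNorm_span_natCast (h : IsSqrtNeg b δ d) (p : ℕ) :
    Ideal.absNorm (Ideal.span {(p : 𝓞 K)}) = p ^ 2 := by
  rw [Ideal.absNorm_span_singleton]
  obtain ⟨u, v, h2, hn⟩ := h.exists_int_coords (p : 𝓞 K)
  obtain ⟨rfl, rfl⟩ := h.coords_unique (u := u) (v := v) (u' := 2 * p) (v' := 0) (by
    rw [← h2]; push_cast; ring)
  have : Algebra.norm ℤ (p : 𝓞 K) = ((p ^ 2 : ℕ) : ℤ) := by push_cast; linarith
  rw [this, Int.natAbs_natCast]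

theorem not_sqrtIdeal_le_span (h : IsSqrtNeg b δ d) (hp : IsSplitPrime d p r) :
    ¬ sqrtIdeal δ p r ≤ Ideal.span {(p : 𝓞 K)} := by
  intro hle
  obtain ⟨x, hx⟩ := Ideal.mem_span_singleton.1 (hle (sub_mem_sqrtIdeal δ p r))
  obtain ⟨u, v, h2, -⟩ := h.exists_int_coords x
  obtain ⟨-, hv⟩ := h.coords_unique (u := -(2 * r)) (v := 2) (u' := p * u) (v' := p * v) (by
    push_cast
    linear_combination 2 * hx + p * h2)
  exact hp.not_dvd_two ⟨v, hv⟩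

theorem absNorm_sqrtIdeal (h : IsSqrtNeg b δ d) (hp : IsSplitPrime d p r) :
    Ideal.absNorm (sqrtIdeal δ p r) = p := by
  have hmul : Ideal.absNorm (sqrtIdeal δ p r) * Ideal.absNorm (sqrtIdeal δ p (-r)) = p ^ 2 := by
    rw [← map_mul, hp.sqrtIdeal_mul_neg h.mul_self, h.absNorm_span_natCast]
  have hne : ∀ r : ℤ, IsSplitPrime d p r → Ideal.absNorm (sqrtIdeal δ p r) ≠ 1 := by
    intro r hp h1
    rw [Ideal.absNorm_eq_one_iff] at h1
    have := hp.sqrtIdeal_mul_neg h.mul_self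
    rw [h1, Ideal.top_mul] at this
    exact h.not_sqrtIdeal_le_span hp.neg this.le
  exact ((Nat.Prime.mul_eq_prime_sq_iff hp.prime (hne r hp) (hne _ hp.neg)).1 hmul).1

theorem isPrime_sqrtIdeal (h : IsSqrtNeg b δ d) (hp : IsSplitPrime d p r) :
    (sqrtIdeal δ p r).IsPrime :=
  Ideal.isPrime_of_irreducible_absNorm (by rw [h.absNorm_sqrtIdeal hp]; exact hp.prime)

theorem sqrtIdeal_ne_bot (h : IsSqrtNeg b δ d) (hp : IsSplitPrime d p r) :
    sqrtIdeal δ p r ≠ ⊥ := by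
  intro h0
  have := h.absNorm_sqrtIdeal hp
  rw [h0, Ideal.absNorm_bot] at this
  exact hp.prime.ne_zero this.symm

theorem intCast_notMem_sqrtIdeal (h : IsSqrtNeg b δ d) (hp : IsSplitPrime d p r) {m : ℤ}
    (hm : ¬ (p : ℤ) ∣ m) : (m : 𝓞 K) ∉ sqrtIdeal δ p r := fun hmem =>
  (h.isPrime_sqrtIdeal hp).ne_top (hp.one_mem hm (natCast_mem_sqrtIdeal _ _ _) hmem)

theorem not_dvd_of_sqrtIdeal_pow_eq_span (h : IsSqrtNeg b δ d) (hp : IsSplitPrime d p r)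
    (hq : IsSplitPrime d q s) (hpq : p ≠ q) {g : ℕ} {α : 𝓞 K}
    (hα : (sqrtIdeal δ p r * sqrtIdeal δ q s) ^ g = Ideal.span {α}) {u v : ℤ}
    (huv : 2 * α = u + v * δ) (hpu : (p : ℤ) ∣ u) : ¬ (p : ℤ) ∣ v := by
  rintro ⟨v, rfl⟩
  obtain ⟨u, rfl⟩ := hpu
  have hprime := h.isPrime_sqrtIdeal hp.neg
  have h2α : 2 * α ∈ sqrtIdeal δ p (-r) := by
    have : 2 * α = p * (u + v * δ) := by rw [huv]; push_cast; ring
    rw [this]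
    exact Ideal.mul_mem_right _ _ (natCast_mem_sqrtIdeal _ _ _)
  have hαmem : α ∈ sqrtIdeal δ p (-r) := by
    refine (hprime.mem_or_mem h2α).resolve_left fun h2 => ?_
    exact h.intCast_notMem_sqrtIdeal hp.neg hp.not_dvd_two (by exact_mod_cast h2)
  have hle : sqrtIdeal δ p r * sqrtIdeal δ q s ≤ sqrtIdeal δ p (-r) := by
    refine hprime.le_of_pow_le (n := g) ?_
    rw [hα, Ideal.span_singleton_le_iff_mem]
    exact hαmem
  rcases hprime.mul_le.1 hle with hle | hle
  · refine h.intCast_notMem_sqrtIdeal hp.neg hp.not_dvd_two_mul ?_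
    have := Ideal.sub_mem _ (sub_mem_sqrtIdeal δ p (-r)) (hle (sub_mem_sqrtIdeal δ p r))
    convert this using 1
    push_cast; ring
  · refine h.intCast_notMem_sqrtIdeal hp.neg (m := q) ?_ ?_
    · exact_mod_cast fun hd => hpq ((Nat.prime_dvd_prime_iff_eq hp.prime hq.prime).1 hd)
    · exact_mod_cast hle (natCast_mem_sqrtIdeal δ q s)

/-- If the classes of split prime ideals above `p ≠ q` have the same `g`-th power, then
`4 (p q)^g` is represented by `u² + d v²`. -/
theorem exists_eq_sq_add_of_mk0_pow_eq (h : IsSqrtNeg b δ d) (hp : IsSplitPrime d p r)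
    (hq : IsSplitPrime d q s) (hpq : p ≠ q) {g : ℕ} (hg : 0 < g)
    {I J : nonZeroDivisors (Ideal (𝓞 K))} (hI : (I : Ideal (𝓞 K)) = sqrtIdeal δ p r)
    (hJ : (J : Ideal (𝓞 K)) = sqrtIdeal δ q s)
    (hIJ : ClassGroup.mk0 I ^ g = ClassGroup.mk0 J ^ g) :
    ∃ u v : ℤ, u ≠ 0 ∧ v ≠ 0 ∧ Int.gcd v ((p : ℤ) * q) = 1 ∧
      4 * ((p : ℤ) * q) ^ g = u ^ 2 + (d : ℤ) * v ^ 2 := by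
  let J' : nonZeroDivisors (Ideal (𝓞 K)) :=
    ⟨sqrtIdeal δ q (-s), mem_nonZeroDivisors_of_ne_zero (h.sqrtIdeal_ne_bot hq.neg)⟩
  have hJJ' : ClassGroup.mk0 J * ClassGroup.mk0 J' = 1 := by
    rw [← map_mul]
    refine (ClassGroup.mk0_eq_one_iff (J * J').2).2 ⟨⟨(q : 𝓞 K), ?_⟩⟩
    change (J : Ideal (𝓞 K)) * sqrtIdeal δ q (-s) = _
    rw [hJ, hq.sqrtIdeal_mul_neg h.mul_self]
  have hone : ClassGroup.mk0 ((I * J') ^ g) = 1 := by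
    rw [map_pow, map_mul, mul_pow, hIJ, ← mul_pow, hJJ', one_pow]
  obtain ⟨⟨α, hα⟩⟩ := (ClassGroup.mk0_eq_one_iff ((I * J') ^ g).2).1 hone
  have hα : (sqrtIdeal δ p r * sqrtIdeal δ q (-s)) ^ g = Ideal.span {α} := by
    rw [← hI]; exact hα
  have hα' : (sqrtIdeal δ q (-s) * sqrtIdeal δ p r) ^ g = Ideal.span {α} := by
    rw [mul_comm, hα]
  obtain ⟨u, v, huv, hn⟩ := h.exists_int_coords α
  have hnorm : Algebra.norm ℤ α = ((p : ℤ) * q) ^ g := by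
    have h1 := congrArg Ideal.absNorm hα
    rw [map_pow, map_mul, h.absNorm_sqrtIdeal hp, h.absNorm_sqrtIdeal hq.neg,
      Ideal.absNorm_span_singleton] at h1
    rw [← Int.natAbs_of_nonneg (h.norm_nonneg α), ← h1]
    push_cast; rfl
  rw [hnorm] at hn
  have hpI := Nat.prime_iff_prime_int.1 hp.prime
  have hqI := Nat.prime_iff_prime_int.1 hq.prime
  have hdvd : ∀ l : ℤ, Prime l → l ∣ (p : ℤ) * q → l ∣ v → l ∣ u := by
    intro l hl hlpq hlv
    refine hl.dvd_of_dvd_pow (n := 2) ((Int.dvd_add_left (c := d * v ^ 2) ?_).1 ?_)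
    · exact (dvd_pow hlv two_ne_zero).mul_left _
    · rw [← hn]
      exact (dvd_pow hlpq hg.ne').mul_left _
  have hpv : ¬ (p : ℤ) ∣ v := fun hv => h.not_dvd_of_sqrtIdeal_pow_eq_span hp hq.neg hpq hα huv
    (hdvd p hpI (dvd_mul_right _ _) hv) hv
  have hqv : ¬ (q : ℤ) ∣ v := fun hv => h.not_dvd_of_sqrtIdeal_pow_eq_span hq.neg hp hpq.symm hα'
    huv (hdvd q hqI (dvd_mul_left _ _) hv) hv
  refine ⟨u, v, ?_, ?_, ?_, hn⟩
  · rintro rfl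
    have : (p : ℤ) ∣ d * v ^ 2 := by
      have h0 : (d : ℤ) * v ^ 2 = 4 * ((p : ℤ) * q) ^ g := by rw [hn]; ring
      rw [h0]
      exact (dvd_pow (dvd_mul_right _ _) hg.ne').mul_left _
    rcases hpI.dvd_or_dvd this with h0 | h0
    · exact hp.not_dvd_right h0
    · exact hpv (hpI.dvd_of_dvd_pow h0)
  · rintro rfl
    exact hpv (dvd_zero _)
  · rw [← Int.isCoprime_iff_gcd_eq_one]
    exact ((hp.isCoprime hpv).mul_left (hq.isCoprime hqv)).symm

end IsSqrtNeg

end SqrtIdeal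

theorem Finset.card_le_natCard_subtype {α : Type*} {p : α → Prop} {s t : Finset α}
    (hs : ∀ x ∈ s, p x) (ht : ∀ x, p x → x ∈ t) : s.card ≤ Nat.card {x // p x} := by
  have : Finite {x // p x} := Finite.of_injective (fun x => (⟨x, ht x x.2⟩ : t)) fun x y h =>
    Subtype.ext (congrArg Subtype.val h :)
  rw [← Fintype.card_coe, ← Nat.card_eq_fintype_card]
  exact Nat.card_le_card_of_injective (fun x : s => (⟨x, hs x x.2⟩ : {x // p x}))
    fun x y h => Subtype.ext (congrArg Subtype.val h :)

section Kneg

open NumberField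

theorem sqrt_mul_I_sq (d : ℕ) : ((√d : ℂ) * Complex.I) ^ 2 = -(d : ℂ) := by
  rw [mul_pow, Complex.I_sq, ← Complex.ofReal_pow, Real.sq_sqrt (by positivity)]
  simp

theorem isIntegral_sqrt_mul_I (R : Type*) [CommRing R] [Algebra R ℂ] (d : ℕ) :
    IsIntegral R ((√d : ℂ) * Complex.I) :=
  ⟨Polynomial.X ^ 2 + Polynomial.C (d : R), Polynomial.monic_X_pow_add_C _ two_ne_zero, by
    simp [sqrt_mul_I_sq, -map_mul]⟩

instance numberField_Kneg (d : ℕ) : NumberField (Kneg d) where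
  to_finiteDimensional := IntermediateField.adjoin.finiteDimensional (isIntegral_sqrt_mul_I ℚ d)

theorem natDegree_minpoly_sqrt_mul_I {d : ℕ} (hd : 0 < d) :
    (minpoly ℚ ((√d : ℂ) * Complex.I)).natDegree = 2 := by
  apply le_antisymm
  · have hmonic : (Polynomial.X ^ 2 + Polynomial.C (d : ℚ)).Monic :=
      Polynomial.monic_X_pow_add_C _ two_ne_zero
    have h := Polynomial.natDegree_le_natDegree
      (minpoly.min ℚ ((√d : ℂ) * Complex.I) hmonic (by simp [sqrt_mul_I_sq, -map_mul]))
    rwa [Polynomial.natDegree_X_pow_add_C] at h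
  · rw [minpoly.two_le_natDegree_iff (isIntegral_sqrt_mul_I ℚ d)]
    rintro ⟨q, hq⟩
    have := congrArg Complex.im hq
    simp at this
    exact (Real.sqrt_pos.2 (Nat.cast_pos.2 hd)).ne' (by simpa using this.symm)

theorem exists_isSqrtNeg_Kneg {d : ℕ} (hd : Squarefree d) :
    ∃ (b : Module.Basis (Fin 2) ℚ (Kneg d)) (δ : 𝓞 (Kneg d)), IsSqrtNeg b δ d := by
  have hd0 : 0 < d := hd.ne_zero.bot_lt
  let x : Kneg d := IntermediateField.AdjoinSimple.gen ℚ ((√d : ℂ) * Complex.I)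
  have hx : x * x = -(d : Kneg d) := by
    apply Subtype.ext
    rw [← sq]
    exact (sqrt_mul_I_sq d)
  have hInt : IsIntegral ℤ x :=
    ⟨Polynomial.X ^ 2 + Polynomial.C (d : ℤ), Polynomial.monic_X_pow_add_C _ two_ne_zero, by
      simp [sq, hx]⟩
  let pb : PowerBasis ℚ (Kneg d) := IntermediateField.adjoin.powerBasis (isIntegral_sqrt_mul_I ℚ d)
  have hdim : pb.dim = 2 := natDegree_minpoly_sqrt_mul_I hd0
  refine ⟨pb.basis.reindex (finCongr hdim), ⟨x, hInt⟩, ⟨?_, ?_, ?_, hd⟩⟩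
  · simp
  · simp
    rfl
  · apply FaithfulSMul.algebraMap_injective (𝓞 (Kneg d)) (Kneg d)
    refine (map_mul (algebraMap (𝓞 (Kneg d)) (Kneg d)) _ _).trans (hx.trans ?_)
    rw [map_neg, map_natCast]

theorem hneg_mul_card_sq_le {g d : ℕ} (hg : 0 < g) (hd : Squarefree d) {Z : ℝ} (hZ : 2 < Z) :
    hneg g d * ((dyadicPrimes Z).filter fun p => jacobiSym (-d) p = 1).card ^ 2 ≤
      Nat.card (ClassGroup (𝓞 (Kneg d))) *
        (((dyadicPrimes Z).filter fun p => jacobiSym (-d) p = 1).card + Sg g d Z) := by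
  classical
  obtain ⟨b, δ, h⟩ := exists_isSqrtNeg_Kneg hd
  set P := (dyadicPrimes Z).filter fun p => jacobiSym (-d) p = 1 with hP
  have hsplit : ∀ p : ℕ, ∃ r : ℤ, p ∈ P → IsSplitPrime d p r := by
    intro p
    by_cases hp : p ∈ P
    · obtain ⟨hpZ, hp1⟩ := Finset.mem_filter.1 hp
      obtain ⟨hpp, hp2, -⟩ := mem_dyadicPrimes.1 hpZ
      obtain ⟨r, hr, hr'⟩ := exists_int_of_jacobiSym_neg_eq_one hpp hp1
      refine ⟨r, fun _ => ⟨hpp, ?_, hr, hr'⟩⟩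
      rintro rfl
      norm_num at hp2
      linarith
    · exact ⟨0, fun h => absurd h hp⟩
  choose r hr using hsplit
  have hcls : ∀ p : ℕ, ∃ I : nonZeroDivisors (Ideal (𝓞 (Kneg d))),
      p ∈ P → (I : Ideal (𝓞 (Kneg d))) = sqrtIdeal δ p (r p) := by
    intro p
    by_cases hp : p ∈ P
    · exact ⟨⟨_, mem_nonZeroDivisors_of_ne_zero (h.sqrtIdeal_ne_bot (hr p hp))⟩, fun _ => rfl⟩
    · exact ⟨1, fun h => absurd h hp⟩
  choose I hI using hcls
  refine (card_pow_eq_one_mul_card_sq_le g P fun p => ClassGroup.mk0 (I p)).trans ?_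
  refine Nat.mul_le_mul_left _ ?_
  rw [← Finset.card_filter_add_card_filter_not (fun x : ℕ × ℕ => x.1 = x.2)]
  refine add_le_add ?_ ?_
  · refine Finset.card_le_card_of_injOn Prod.fst (fun x hx => ?_) ?_
    · simp only [Finset.coe_filter, Finset.mem_filter, Finset.mem_product, Set.mem_ofPred_eq] at hx
      exact hx.1.1.1
    · rintro ⟨p, q⟩ hx ⟨p', q'⟩ hy he
      simp only [Finset.coe_filter, Set.mem_ofPred_eq] at hx hy he
      ext
      · exact he
      · rw [← hx.2, ← hy.2, he]
  · refine Finset.card_le_natCard_subtype (t := dyadicPrimes Z ×ˢ dyadicPrimes Z) ?_ ?_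
    · rintro ⟨p, q⟩ hx
      simp only [Finset.mem_filter, Finset.mem_product] at hx
      obtain ⟨⟨⟨hp, hq⟩, he⟩, hne⟩ := hx
      obtain ⟨h1, h2, h3⟩ := mem_dyadicPrimes.1 (Finset.mem_filter.1 hp).1
      obtain ⟨h1', h2', h3'⟩ := mem_dyadicPrimes.1 (Finset.mem_filter.1 hq).1
      exact ⟨h1, h1', hne, h2, h3, h2', h3',
        h.exists_eq_sq_add_of_mk0_pow_eq (hr p hp) (hr q hq) hne hg (hI p hp) (hI q hq) he⟩
    · rintro ⟨p, q⟩ ⟨h1, h1', -, h2, h3, h2', h3', -⟩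
      simp only [Finset.mem_product, mem_dyadicPrimes]
      exact ⟨⟨h1, h2, h3⟩, h1', h2', h3'⟩

end Kneg

theorem card_filter_dvd_dyadicPrimes_le {Z : ℝ} (hZ : 1 < Z) {d m : ℕ} (hd : d ≠ 0)
    (hdm : (d : ℝ) ≤ Z ^ m) : ((dyadicPrimes Z).filter (· ∣ d)).card ≤ m := by
  set T := (dyadicPrimes Z).filter (· ∣ d)
  have hT : ∀ p ∈ T, p.Prime ∧ Z ≤ p ∧ p ∣ d := fun p hp => by
    obtain ⟨h1, h2⟩ := Finset.mem_filter.1 hp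
    obtain ⟨h3, h4, -⟩ := mem_dyadicPrimes.1 h1
    exact ⟨h3, h4, h2⟩
  have hdvd : ∏ p ∈ T, p ∣ d :=
    Finset.prod_primes_dvd d (fun p hp => (hT p hp).1.prime) fun p hp => (hT p hp).2.2
  have hle : Z ^ T.card ≤ Z ^ m := by
    calc Z ^ T.card = ∏ _p ∈ T, Z := by rw [Finset.prod_const]
      _ ≤ ∏ p ∈ T, (p : ℝ) :=
        Finset.prod_le_prod (fun _ _ => by linarith) fun p hp => (hT p hp).2.1
      _ = ((∏ p ∈ T, p : ℕ) : ℝ) := by push_cast; rfl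
      _ ≤ d := by exact_mod_cast Nat.le_of_dvd hd.bot_lt hdvd
      _ ≤ Z ^ m := hdm
  exact (pow_le_pow_iff_right₀ hZ).1 hle

theorem sum_jacobiSym_le (P : Finset ℕ) (hP : ∀ p ∈ P, p.Prime) (d : ℕ) :
    ∑ p ∈ P, jacobiSym (-d) p ≤ 2 * ((P.filter fun p => jacobiSym (-d) p = 1).card : ℤ)
      + (P.filter (· ∣ d)).card - P.card := by
  have h : ∀ p ∈ P, jacobiSym (-d) p ≤
      2 * (if jacobiSym (-d) p = 1 then 1 else 0) + (if p ∣ d then 1 else 0) - 1 := by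
    intro p hp
    rcases jacobiSym.trichotomy (-d) p with h0 | h1 | h1
    · have hdvd : p ∣ d := by
        have := Fact.mk (hP p hp)
        rw [← jacobiSym.legendreSym.to_jacobiSym, legendreSym.eq_zero_iff,
          ZMod.intCast_zmod_eq_zero_iff_dvd, dvd_neg] at h0
        exact_mod_cast h0
      rw [h0, if_pos hdvd]; norm_num
    · rw [h1, if_pos rfl]; split_ifs <;> norm_num
    · rw [h1]; split_ifs <;> norm_num
  refine (Finset.sum_le_sum h).trans_eq ?_
  rw [Finset.sum_sub_distrib, Finset.sum_add_distrib, ← Finset.mul_sum, Finset.sum_boole,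
    Finset.sum_boole]
  simp

/-- The squarefree `d ∈ [X, 2X)` for which few primes `p ∈ [Z, 2Z)` split in `ℚ(√-d)`. -/
noncomputable def fewSplitPrimes (X Z : ℝ) : Finset ℕ :=
  (Finset.range ⌈2 * X⌉₊).filter fun d => Squarefree d ∧ X ≤ d ∧
    4 * ((dyadicPrimes Z).filter fun p => jacobiSym (-d) p = 1).card < (dyadicPrimes Z).card

theorem card_fewSplitPrimes_le {g : ℕ} (hg : 0 < g) {X Z η : ℝ} (hX : 48 ≤ X) (hZ : 2 < Z)
    (hXZ : X ≤ Z ^ (4 * g)) (hP : Z ^ (1 - η) / 2 ≤ (dyadicPrimes Z).card)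
    (hPg : 32 * g ≤ (dyadicPrimes Z).card) :
    ((fewSplitPrimes X Z).card : ℝ) ≤
      2 * (16 * (16 * g)) ^ (16 * g) * 6 ^ (16 * g) * Z ^ (η * (16 * g)) := by
  set k := 16 * g with hk
  set P := dyadicPrimes Z with hPdef
  set D := fewSplitPrimes X Z with hD
  have hZ0 : 0 < Z := by linarith
  have hDmem : ∀ d ∈ D, (d : ℝ) < 2 * X ∧ Squarefree d ∧
      4 * (P.filter fun p => jacobiSym (-d) p = 1).card < P.card := by
    intro d hd
    obtain ⟨h1, h2, -, h3⟩ := Finset.mem_filter.1 hd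
    exact ⟨Nat.lt_ceil.1 (Finset.mem_range.1 h1), h2, h3⟩
  have hcardD : (D.card : ℝ) ≤ 3 * X := by
    have h1 : D.card ≤ ⌈2 * X⌉₊ := (Finset.card_filter_le _ _).trans_eq (Finset.card_range _)
    have h2 := Nat.ceil_lt_add_one (a := 2 * X) (by linarith)
    have h3 : (D.card : ℝ) ≤ ⌈2 * X⌉₊ := by exact_mod_cast h1
    linarith
  have hW : 2 * Z ≤ (⌈2 * Z⌉₊ : ℝ) := Nat.le_ceil _
  have hW3 : (⌈2 * Z⌉₊ : ℝ) ≤ 3 * Z := by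
    have := Nat.ceil_lt_add_one (a := 2 * Z) (by linarith)
    linarith
  have hY : (⌊2 * X⌋₊ : ℝ) ≤ 2 * X := Nat.floor_le (by linarith)
  have hN : D.card * (4 * ⌊2 * X⌋₊ ^ 2) ≤ ⌈2 * Z⌉₊ ^ k := by
    have h1 : (D.card : ℝ) * (4 * (⌊2 * X⌋₊ : ℝ) ^ 2) ≤ (⌈2 * Z⌉₊ : ℝ) ^ k := by
      calc (D.card : ℝ) * (4 * (⌊2 * X⌋₊ : ℝ) ^ 2) ≤ (3 * X) * (4 * (2 * X) ^ 2) := by gcongr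
        _ = 48 * X ^ 3 := by ring
        _ ≤ X * X ^ 3 := by gcongr
        _ = X ^ 4 := by ring
        _ ≤ (Z ^ (4 * g)) ^ 4 := by gcongr
        _ = Z ^ k := by rw [← pow_mul, hk]; congr 1; ring
        _ ≤ (⌈2 * Z⌉₊ : ℝ) ^ k := by gcongr; linarith
    exact_mod_cast h1
  have hP0 : P.Nonempty := by
    rw [← Finset.card_pos]; omega
  have hPprime : ∀ p ∈ P, p.Prime := fun p hp => (mem_dyadicPrimes.1 hp).1
  have hmain := card_mul_card_pow_le (D := D) (P := P) (Y := ⌊2 * X⌋₊) (W := ⌈2 * Z⌉₊) (k := k)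
    (fun d hd => (hDmem d hd).2.1) (fun d hd => Nat.le_floor (hDmem d hd).1.le) (by omega) hN
    hPprime
    (fun p hp => by
      refine (hPprime p hp).odd_of_ne_two ?_
      rintro rfl
      have := (mem_dyadicPrimes.1 hp).2.1
      norm_num at this
      linarith)
    (fun p hp => Nat.lt_ceil.2 (mem_dyadicPrimes.1 hp).2.2)
    hP0
    (fun d hd => by
      obtain ⟨h1, h2, h3⟩ := hDmem d hd
      have h4 := card_filter_dvd_dyadicPrimes_le (Z := Z) (by linarith) (d := d) (m := 8 * g)
        h2.ne_zero (by
          calc (d : ℝ) ≤ X * X := by nlinarith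
            _ ≤ Z ^ (4 * g) * Z ^ (4 * g) := by gcongr
            _ = Z ^ (8 * g) := by rw [← pow_add]; congr 1; ring)
      have h5 := sum_jacobiSym_le P hPprime d
      rw [← hPdef] at h4
      omega)
  have hPpos : (0 : ℝ) < P.card := by exact_mod_cast hP0.card_pos
  have hWP : (⌈2 * Z⌉₊ : ℝ) ≤ 6 * Z ^ η * P.card := by
    calc (⌈2 * Z⌉₊ : ℝ) ≤ 3 * Z := hW3
      _ = 6 * Z ^ η * (Z ^ (1 - η) / 2) := by
        rw [Real.rpow_sub hZ0, Real.rpow_one]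
        have := (Real.rpow_pos_of_pos hZ0 η).ne'
        field_simp; norm_num
      _ ≤ _ := by gcongr
  have hmain' : (D.card : ℝ) * (P.card : ℝ) ^ k ≤
      (2 * (16 * (16 * g)) ^ k * 6 ^ k * Z ^ (η * (16 * g))) * (P.card : ℝ) ^ k := by
    calc (D.card : ℝ) * (P.card : ℝ) ^ k ≤ 2 * (16 * (16 * g)) ^ k * (⌈2 * Z⌉₊ : ℝ) ^ k := by
          exact_mod_cast hmain
      _ ≤ 2 * (16 * (16 * g)) ^ k * (6 * Z ^ η * P.card) ^ k := by gcongr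
      _ = _ := by
        have : Z ^ (η * (16 * g)) = (Z ^ η) ^ k := by
          rw [← Real.rpow_natCast, ← Real.rpow_mul hZ0.le, hk]; push_cast; rfl
        rw [this]; ring
  exact le_of_mul_le_mul_right hmain' (by positivity)

theorem hneg_le_of_many_splitPrimes {g d : ℕ} (hg : 0 < g) (hd : Squarefree d) {X Z η ε A : ℝ}
    (hZ : 2 < Z) (hZX : Z ≤ X) (hdX : (d : ℝ) < 2 * X) (hA : 0 < A) (hη0 : 0 < η) (hηε : η ≤ ε / 4)
    (hP : Z ^ (1 - η) / 2 ≤ (dyadicPrimes Z).card)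
    (hh : (Nat.card (ClassGroup (NumberField.RingOfIntegers (Kneg d))) : ℝ)
      ≤ A * (d : ℝ) ^ (1 / 2 + ε / 4))
    (hsplit : (dyadicPrimes Z).card ≤
      4 * ((dyadicPrimes Z).filter fun p => jacobiSym (-d) p = 1).card) :
    (hneg g d : ℝ) ≤ 64 * A * X ^ ε *
      ((d : ℝ) ^ ((1 : ℝ) / 2) / Z + (d : ℝ) ^ ((1 : ℝ) / 2) / Z ^ 2 * Sg g d Z) := by
  have hmain := hneg_mul_card_sq_le hg hd hZ
  set N := ((dyadicPrimes Z).filter fun p => jacobiSym (-d) p = 1).card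
  set h := Nat.card (ClassGroup (NumberField.RingOfIntegers (Kneg d)))
  set S := Sg g d Z
  have hZ0 : 0 < Z := by linarith
  have hX0 : 0 < X := by linarith
  set w := Z ^ η with hw
  have hw0 : 0 < w := Real.rpow_pos_of_pos hZ0 η
  have hw1 : 1 ≤ w := Real.one_le_rpow (by linarith) hη0.le
  have hd0 : (0 : ℝ) < d := by exact_mod_cast hd.ne_zero.bot_lt
  have hZN : Z ≤ 8 * w * N := by
    have h1 : ((dyadicPrimes Z).card : ℝ) ≤ 4 * N := by exact_mod_cast hsplit
    have h2 : Z / w / 2 ≤ 4 * N := by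
      rw [Real.rpow_sub hZ0, Real.rpow_one] at hP
      exact hP.trans h1
    have h3 : Z / w ≤ 8 * N := by linarith
    rw [div_le_iff₀ hw0] at h3
    linarith
  have hN0 : (0 : ℝ) < N := by
    by_contra hcon
    have : (8 * w * N : ℝ) ≤ 0 := mul_nonpos_of_nonneg_of_nonpos (by positivity) (not_lt.1 hcon)
    linarith
  have hmain' : (hneg g d : ℝ) * (N : ℝ) ^ 2 ≤ h * (N + S) := by exact_mod_cast hmain
  have hinv : (1 : ℝ) / N ≤ 8 * w / Z := by
    rw [div_le_div_iff₀ hN0 hZ0]; linarith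
  have h1 : (hneg g d : ℝ) ≤ h * (64 * w ^ 2 * (1 / Z + S / Z ^ 2)) := by
    calc (hneg g d : ℝ) ≤ h * (N + S) / (N : ℝ) ^ 2 := by
          rw [le_div_iff₀ (by positivity)]; exact hmain'
      _ = h * (1 / N + S * (1 / N) ^ 2) := by field_simp
      _ ≤ h * (8 * w / Z + S * (8 * w / Z) ^ 2) := by gcongr
      _ = h * (8 * w * (1 / Z) + 64 * w ^ 2 * (S / Z ^ 2)) := by ring
      _ ≤ h * (64 * w ^ 2 * (1 / Z) + 64 * w ^ 2 * (S / Z ^ 2)) := by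
        have : w ≤ w ^ 2 := by nlinarith
        gcongr
        linarith
      _ = _ := by ring
  have h2 : w ^ 2 * (d : ℝ) ^ (ε / 4) ≤ X ^ ε := by
    have hw2 : w ^ 2 ≤ X ^ (ε / 2) := by
      calc w ^ 2 = Z ^ (η * 2) := by rw [Real.rpow_mul hZ0.le, hw]; norm_num
        _ ≤ X ^ (η * 2) := by gcongr
        _ ≤ X ^ (ε / 2) := Real.rpow_le_rpow_of_exponent_le (by linarith) (by linarith)
    have hd2 : (d : ℝ) ^ (ε / 4) ≤ X ^ (ε / 2) := by
      have hε : 0 ≤ ε / 4 := by linarith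
      calc (d : ℝ) ^ (ε / 4) ≤ (X ^ 2) ^ (ε / 4) := by
            gcongr
            nlinarith
        _ = X ^ (ε / 2) := by
          rw [← Real.rpow_natCast, ← Real.rpow_mul hX0.le]
          congr 1; push_cast; ring
    calc w ^ 2 * (d : ℝ) ^ (ε / 4) ≤ X ^ (ε / 2) * X ^ (ε / 2) := by gcongr
      _ = X ^ ε := by rw [← Real.rpow_add hX0]; congr 1; ring
  rw [Real.rpow_add hd0] at hh
  calc (hneg g d : ℝ) ≤ h * (64 * w ^ 2 * (1 / Z + S / Z ^ 2)) := h1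
    _ ≤ (A * ((d : ℝ) ^ ((1 : ℝ) / 2) * (d : ℝ) ^ (ε / 4))) *
        (64 * w ^ 2 * (1 / Z + S / Z ^ 2)) := by gcongr
    _ = 64 * A * (w ^ 2 * (d : ℝ) ^ (ε / 4)) *
        ((d : ℝ) ^ ((1 : ℝ) / 2) / Z + (d : ℝ) ^ ((1 : ℝ) / 2) / Z ^ 2 * S) := by ring
    _ ≤ _ := by gcongr

/-- Fix a prime `g ≥ 3`.  For every `ε > 0` there is `C = C(g, ε)` such that for
all `X ≥ 2` and all `Z` with `(1/4)·X^(1/(2g)) ≤ Z ≤ X`, there is a set `E` of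
integers in `[X, 2X)` with `#E ≤ C·X^ε` such that every squarefree
`d ∈ [X, 2X)` outside `E` satisfies
`h_g(-d) ≤ C·X^ε·(d^(1/2)/Z + d^(1/2)·Z⁻²·S_g(d;Z))`. -/
theorem pointwise_hg_bound (g : ℕ) (hg : g.Prime) (hg3 : 3 ≤ g)
    (ε : ℝ) (hε : 0 < ε) :
    ∃ C : ℝ, 0 < C ∧ ∀ X Z : ℝ, 2 ≤ X →
      (1 / 4) * X ^ ((1 : ℝ) / (2 * g)) ≤ Z → Z ≤ X →
      ∃ E : Finset ℕ,
        (∀ d ∈ E, X ≤ (d : ℝ) ∧ (d : ℝ) < 2 * X) ∧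
        (E.card : ℝ) ≤ C * X ^ ε ∧
        ∀ d : ℕ, Squarefree d → X ≤ (d : ℝ) → (d : ℝ) < 2 * X → d ∉ E →
          (hneg g d : ℝ) ≤ C * X ^ ε *
            ((d : ℝ) ^ ((1 : ℝ) / 2) / Z + (d : ℝ) ^ ((1 : ℝ) / 2) / Z ^ 2 * Sg g d Z) := by
  have hg0 : 0 < g := hg.pos
  have hgR : (3 : ℝ) ≤ g := by exact_mod_cast hg3
  set η : ℝ := min (1 / 2) (ε / (16 * g)) with hη
  have hη0 : 0 < η := lt_min (by norm_num) (by positivity)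
  have hη2 : η ≤ 1 / 2 := min_le_left _ _
  have hηg : η * (16 * g) ≤ ε := (le_div_iff₀ (by positivity)).1 (min_le_right _ _)
  have hη4 : η ≤ ε / 4 := by nlinarith
  obtain ⟨Z₀, hZ₀⟩ := exists_rpow_le_card_dyadicPrimes hη0 hη2
  obtain ⟨A, hA, hclass⟩ :=
    IsSqrtNeg.exists_card_classGroup_le_mul_rpow (ε := ε / 4) (by positivity)
  set B : ℝ := max 4 (max Z₀ ((64 * g) ^ 2)) with hB
  have hB4 : 4 ≤ B := le_max_left _ _
  have hBZ₀ : Z₀ ≤ B := (le_max_left _ _).trans (le_max_right _ _)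
  have hBg : (64 * g : ℝ) ^ 2 ≤ B := (le_max_right _ _).trans (le_max_right _ _)
  set M : ℝ := 2 * (16 * (16 * g)) ^ (16 * g) * 6 ^ (16 * g) with hM
  have hM0 : 0 < M := by positivity
  refine ⟨3 * B ^ (4 * g) + M + 64 * A, by positivity, fun X Z hX hXZ hZX => ?_⟩
  have hX0 : 0 < X := by linarith
  have hXε : 1 ≤ X ^ ε := Real.one_le_rpow (by linarith) hε.le
  rcases lt_or_ge X (B ^ (4 * g)) with hXB | hXB
  · refine ⟨(Finset.range ⌈2 * X⌉₊).filter fun d => X ≤ d, fun d hd => ?_, ?_,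
      fun d _ h1 h2 h3 => ?_⟩
    · obtain ⟨h1, h2⟩ := Finset.mem_filter.1 hd
      exact ⟨h2, Nat.lt_ceil.1 (Finset.mem_range.1 h1)⟩
    · have h1 : (((Finset.range ⌈2 * X⌉₊).filter fun d : ℕ => X ≤ d).card : ℝ) ≤ ⌈2 * X⌉₊ := by
        exact_mod_cast (Finset.card_filter_le _ _).trans_eq (Finset.card_range _)
      have h2 := Nat.ceil_lt_add_one (a := 2 * X) (by linarith)
      calc _ ≤ (3 * B ^ (4 * g) + M + 64 * A) * 1 := by linarith
        _ ≤ _ := by gcongr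
    · exact absurd (Finset.mem_filter.2 ⟨Finset.mem_range.2 (Nat.lt_ceil.2 h2), h1⟩) h3
  · set y : ℝ := X ^ ((1 : ℝ) / (4 * g)) with hy
    have hyX : y ^ (4 * g) = X := by
      rw [hy, ← Real.rpow_natCast, ← Real.rpow_mul hX0.le]
      push_cast
      rw [one_div_mul_cancel (by positivity), Real.rpow_one]
    have hy0 : 0 ≤ y := Real.rpow_nonneg hX0.le _
    have hyB : B ≤ y := by
      rw [← hyX] at hXB
      exact (pow_le_pow_iff_left₀ (by linarith) hy0 (by omega)).1 hXB
    have hy2 : X ^ ((1 : ℝ) / (2 * g)) = y ^ 2 := by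
      rw [hy, ← Real.rpow_natCast, ← Real.rpow_mul hX0.le]
      congr 1
      push_cast
      field_simp
      norm_num
    have hyZ : y ≤ Z := by
      rw [hy2] at hXZ
      nlinarith
    have hBZ : B ≤ Z := hyB.trans hyZ
    have hXpow : X ≤ Z ^ (4 * g) := by
      rw [← hyX]; gcongr
    have hX48 : 48 ≤ X := by
      calc (48 : ℝ) ≤ 4 ^ 4 := by norm_num
        _ ≤ B ^ 4 := by gcongr
        _ ≤ B ^ (4 * g) := pow_le_pow_right₀ (by linarith) (by omega)
        _ ≤ X := hXB
    have hP := hZ₀ Z (hBZ₀.trans hBZ)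
    have hPg : 32 * g ≤ (dyadicPrimes Z).card := by
      have h1 : (64 * g : ℝ) ≤ Z ^ (1 - η) := by
        calc (64 * g : ℝ) = ((64 * g : ℝ) ^ 2) ^ (1 / 2 : ℝ) := by
              rw [← Real.sqrt_eq_rpow, Real.sqrt_sq (by positivity)]
          _ ≤ Z ^ (1 / 2 : ℝ) := by gcongr; exact hBg.trans hBZ
          _ ≤ Z ^ (1 - η) := Real.rpow_le_rpow_of_exponent_le (by linarith) (by linarith)
      have h2 : (32 * g : ℝ) ≤ (dyadicPrimes Z).card := by linarith
      exact_mod_cast h2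
    have hZ0 : 0 ≤ Z := by linarith
    refine ⟨fewSplitPrimes X Z, fun d hd => ?_, ?_, fun d hd h1 h2 h3 => ?_⟩
    · obtain ⟨h1, -, h2, -⟩ := Finset.mem_filter.1 hd
      exact ⟨h2, Nat.lt_ceil.1 (Finset.mem_range.1 h1)⟩
    · have h1 := card_fewSplitPrimes_le hg0 hX48 (by linarith) hXpow hP hPg
      have h2 : Z ^ (η * (16 * g)) ≤ X ^ ε := by
        calc Z ^ (η * (16 * g)) ≤ X ^ (η * (16 * g)) := by gcongr
          _ ≤ X ^ ε := Real.rpow_le_rpow_of_exponent_le (by linarith) hηg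
      calc ((fewSplitPrimes X Z).card : ℝ) ≤ M * Z ^ (η * (16 * g)) := h1
        _ ≤ (3 * B ^ (4 * g) + M + 64 * A) * X ^ ε := by
          have : 0 ≤ 3 * B ^ (4 * g) := by positivity
          gcongr
          linarith
    · obtain ⟨b, δ, h⟩ := exists_isSqrtNeg_Kneg hd
      have hsplit : (dyadicPrimes Z).card ≤
          4 * ((dyadicPrimes Z).filter fun p => jacobiSym (-d) p = 1).card := by
        by_contra! hcon
        exact h3 (Finset.mem_filter.2
          ⟨Finset.mem_range.2 (Nat.lt_ceil.2 h2), hd, h1, hcon⟩)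
      have h4 := hneg_le_of_many_splitPrimes hg0 hd (by linarith) hZX h2 hA hη0 hη4 hP
        (hclass _ b δ d h) hsplit
      refine h4.trans ?_
      gcongr
      have : 0 ≤ 3 * B ^ (4 * g) := by positivity
      linarith
end

section
/- Fix a prime g ≥ 3. For every ε > 0 there exists a constant C = C(g, ε) such that for all real X ≥ 2, all but at most C · X^ε of the squarefree integers d ∈ [X, 2X) satisfy h_g(-d) ≤ C · d^{1/2 - 1/(2g) + ε}. -/
/-- Elementary description of the ring of integers of `ℚ(√-d)`: `θ` is a square root of `-d`,
`σ` is the conjugation, every element is half of an element of `ℤ[θ]`, and the ring is integrally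
closed over `ℤ`. -/
structure IsImagQuadratic (R : Type*) [CommRing R] (d : ℕ) (θ : R) (σ : R →+* R) : Prop where
  pos : 0 < d
  theta_mul_self : θ * θ = -(d : R)
  conj : σ θ = -θ
  coords : ∀ α : R, ∃ x y : ℤ, 2 * α = x + y * θ
  int_of_mul : ∀ (α : R) (n m : ℤ), n ≠ 0 → n * α = m → ∃ k : ℤ, α = k

namespace IsImagQuadratic

open nonZeroDivisors

variable {R : Type*} [CommRing R] {d : ℕ} {θ : R} {σ : R →+* R}

lemma eq_zero_of_add_mul_eq_zero [CharZero R] (h : IsImagQuadratic R d θ σ) {x y : ℤ}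
    (hxy : (x : R) + y * θ = 0) : x = 0 ∧ y = 0 := by
  have h1 : ((x ^ 2 + d * y ^ 2 : ℤ) : R) = 0 := by
    push_cast
    linear_combination (x - y * θ) * hxy + (y : R) ^ 2 * h.theta_mul_self
  have h2 : x ^ 2 + d * y ^ 2 = 0 := by exact_mod_cast h1
  have hd : (0 : ℤ) < d := by exact_mod_cast h.pos
  have hy : y = 0 := by
    by_contra hy
    have : 0 < y ^ 2 := by positivity
    nlinarith [sq_nonneg x]
  subst hy
  exact ⟨by simpa using h2, rfl⟩

lemma exists_span_mul_eq [CharZero R] [IsDomain R] (h : IsImagQuadratic R d θ σ) (I : Ideal R)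
    (hI : I ≠ ⊥) : ∃ (a : ℕ) (b : ℤ) (s t : ℤ), 0 < a ∧ (a : ℤ) ∣ b ^ 2 + d ∧ s ≠ 0 ∧ t ≠ 0 ∧
      Ideal.span {(s : R)} * I = Ideal.span {(t : R)} * Ideal.span {(a : R), b + θ} := by
  have hd : (0 : ℤ) < d := by exact_mod_cast h.pos
  let J : Ideal ℤ :=
    { carrier := {y | ∃ x : ℤ, ∃ α ∈ I, 2 * α = x + y * θ}
      add_mem' := by
        rintro y y' ⟨x, α, hα, e⟩ ⟨x', α', hα', e'⟩
        refine ⟨x + x', α + α', I.add_mem hα hα', ?_⟩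
        push_cast
        linear_combination e + e'
      zero_mem' := ⟨0, 0, I.zero_mem, by simp⟩
      smul_mem' := by
        rintro n y ⟨x, α, hα, e⟩
        refine ⟨n * x, n * α, I.mul_mem_left _ hα, ?_⟩
        rw [smul_eq_mul]
        push_cast
        linear_combination (n : R) * e }
  obtain ⟨c, hc⟩ := (IsPrincipalIdealRing.principal J).principal
  obtain ⟨A, hA⟩ := (IsPrincipalIdealRing.principal (I.comap (Int.castRingHom R))).principal
  have hJ : ∀ y : ℤ, (∃ x : ℤ, ∃ α ∈ I, 2 * α = x + y * θ) ↔ c ∣ y := fun y => by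
    rw [← Ideal.mem_span_singleton, ← Ideal.submodule_span_eq, ← hc]; rfl
  have hA' : ∀ y : ℤ, (y : R) ∈ I ↔ A ∣ y := fun y => by
    rw [← Ideal.mem_span_singleton, ← Ideal.submodule_span_eq, ← hA]; rfl
  have two_inj : ∀ {u v : R}, 2 * u = 2 * v → u = v := fun e =>
    mul_left_cancel₀ (two_ne_zero) e
  have hA0 : A ≠ 0 := by
    rintro rfl
    obtain ⟨α, hα, hα0⟩ := Submodule.exists_mem_ne_zero_of_ne_bot hI
    obtain ⟨x, y, e⟩ := h.coords α
    have h1 : ((x ^ 2 + d * y ^ 2 : ℤ) : R) = 4 * (x - α) * α := by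
      push_cast
      linear_combination (-(x - y * θ)) * e + (y : R) ^ 2 * h.theta_mul_self + 2 * α * e
    have h2 : ((x ^ 2 + d * y ^ 2 : ℤ) : R) ∈ I := h1 ▸ I.mul_mem_left _ hα
    rw [hA', zero_dvd_iff] at h2
    have hy : y = 0 := by
      by_contra hy
      have : 0 < y ^ 2 := by positivity
      nlinarith [sq_nonneg x]
    subst hy
    have hx : x = 0 := by simpa using h2
    subst hx
    exact hα0 (by simpa using e)
  have hAI : (A : R) ∈ I := (hA' A).2 dvd_rfl
  obtain ⟨a, ha⟩ : c ∣ 2 * A := (hJ _).1 ⟨0, A * θ, I.mul_mem_right _ hAI, by push_cast; ring⟩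
  have hc0 : c ≠ 0 := by rintro rfl; simp [hA0] at ha
  have ha0 : a ≠ 0 := by rintro rfl; simp [hA0] at ha
  obtain ⟨B, β, hβ, eβ⟩ := (hJ c).2 dvd_rfl
  obtain ⟨b, rfl⟩ : c ∣ B := (hJ _).1 ⟨-(c * d), β * θ, I.mul_mem_right _ hβ, by
    push_cast
    linear_combination θ * eβ + (c : R) * h.theta_mul_self⟩
  have hcR : (c : R) ≠ 0 := by exact_mod_cast hc0
  have haR : (2 : R) * A = c * a := by exact_mod_cast ha
  push_cast at eβ
  refine ⟨a.natAbs, b, 2, c, Int.natAbs_pos.2 ha0, ?_, two_ne_zero, hc0, ?_⟩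
  · rw [Int.natCast_natAbs, abs_dvd]
    have e1 : ((2 : ℤ) : R) * (β * (b - θ)) = ((c * (b ^ 2 + d) : ℤ) : R) := by
      push_cast
      linear_combination (b - θ) * eβ - (c : R) * h.theta_mul_self
    obtain ⟨m, hm⟩ := h.int_of_mul _ _ _ two_ne_zero e1
    obtain ⟨k, rfl⟩ := (hA' m).1 (hm ▸ I.mul_mem_right _ hβ)
    rw [hm] at e1
    have e2 : 2 * (A * k) = c * (b ^ 2 + d) := by exact_mod_cast e1
    refine ⟨k, mul_left_cancel₀ hc0 ?_⟩
    linear_combination -e2 + k * ha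
  · have hspan : Ideal.span {((a.natAbs : ℕ) : R), b + θ} = Ideal.span {(a : R), b + θ} := by
      rcases Int.natAbs_eq a with e | e
      · conv_rhs => rw [e]
        simp
      · conv_rhs => rw [e]
        rw [Ideal.span_insert, Ideal.span_insert]
        simp
    rw [hspan]
    apply le_antisymm
    · rw [Ideal.span_singleton_mul_le_iff]
      intro α hα
      obtain ⟨x, y, e⟩ := h.coords α
      obtain ⟨y', rfl⟩ := (hJ y).1 ⟨x, α, hα, e⟩
      have e1 : ((2 : ℤ) : R) * (α - y' * β) = ((x - y' * (c * b) : ℤ) : R) := by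
        push_cast at e ⊢
        linear_combination e - y' * eβ
      obtain ⟨m, hm⟩ := h.int_of_mul _ _ _ two_ne_zero e1
      obtain ⟨k, rfl⟩ := (hA' m).1 (hm ▸ I.sub_mem hα (I.mul_mem_left _ hβ))
      rw [Ideal.mem_span_singleton_mul]
      refine ⟨k * a + y' * (b + θ), Ideal.mem_span_pair.2 ⟨k, y', rfl⟩, ?_⟩
      push_cast at hm ⊢
      linear_combination -k * haR - y' * eβ - 2 * hm
    · rw [Ideal.span_mul_span', Ideal.span_le]
      rintro _ ⟨_, rfl, u, hu, rfl⟩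
      simp only [SetLike.mem_coe]
      rw [Ideal.mem_span_singleton_mul]
      rcases hu with rfl | rfl
      · exact ⟨A, hAI, by push_cast; linear_combination haR⟩
      · exact ⟨β, hβ, by push_cast; linear_combination eβ⟩

lemma intCast_dvd [CharZero R] [IsDomain R] (h : IsImagQuadratic R d θ σ) {m n : ℤ}
    (hmn : (m : R) ∣ n) : m ∣ n := by
  obtain ⟨α, e⟩ := hmn
  rcases eq_or_ne m 0 with rfl | hm
  · simp at e
    simp [e]
  · obtain ⟨k, rfl⟩ := h.int_of_mul α m n hm e.symm
    exact ⟨k, by exact_mod_cast e⟩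

lemma span_pair_mul_conj [CharZero R] (h : IsImagQuadratic R d θ σ) {p : ℕ}
    (hp : p.Coprime (2 * d)) {r : ℤ} (hr : (p : ℤ) ∣ r ^ 2 + d) :
    Ideal.span {(p : R), r + θ} * Ideal.span {(p : R), ((-r : ℤ) : R) + θ} =
      Ideal.span {(p : R)} := by
  obtain ⟨k, hk⟩ := hr
  have hkR : (r : R) ^ 2 + d = p * k := by exact_mod_cast hk
  apply le_antisymm
  · rw [Ideal.span_mul_span', Ideal.span_le]
    rintro _ ⟨u, hu, v, hv, rfl⟩
    simp only [SetLike.mem_coe, Ideal.mem_span_singleton]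
    rcases hu with rfl | rfl
    · exact dvd_mul_right _ _
    · rcases hv with rfl | rfl
      · exact dvd_mul_left _ _
      · exact ⟨-k, by push_cast; linear_combination h.theta_mul_self - hkR⟩
  · rw [Ideal.span_singleton_le_iff_mem]
    obtain ⟨u, v, huv⟩ : IsCoprime (p : ℤ) ((2 * d : ℕ) : ℤ) := Nat.isCoprime_iff_coprime.2 hp
    have huvR : (u : R) * p + v * (2 * d) = 1 := by exact_mod_cast huv
    have mem₁ : ∀ x : R, (p : R) ∈ Ideal.span {(p : R), x} := fun x => Ideal.subset_span (by simp)
    have mem₂ : ∀ x : R, x ∈ Ideal.span {(p : R), x} := fun x => Ideal.subset_span (by simp)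
    set P := Ideal.span {(p : R), r + θ}
    set P' := Ideal.span {(p : R), ((-r : ℤ) : R) + θ}
    have h1 : (p : R) * p ∈ P * P' := Ideal.mul_mem_mul (mem₁ _) (mem₁ _)
    have h2 : (r + θ) * (p : R) ∈ P * P' := Ideal.mul_mem_mul (mem₂ _) (mem₁ _)
    have h3 : (p : R) * (((-r : ℤ) : R) + θ) ∈ P * P' := Ideal.mul_mem_mul (mem₁ _) (mem₂ _)
    have h4 := Ideal.add_mem _ (Ideal.mul_mem_left _ (u + 2 * v * k : R) h1)
      (Ideal.mul_mem_left _ (-(r * v) : R) (Ideal.sub_mem _ h2 h3))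
    convert h4 using 1
    push_cast
    linear_combination (-(p : R)) * huvR + 2 * v * p * hkR

lemma isCoprime_span_conj [CharZero R] (θ : R) {p : ℕ} (hp : p.Coprime (2 * d)) {r : ℤ}
    (hr : (p : ℤ) ∣ r ^ 2 + d) :
    IsCoprime (Ideal.span {(p : R), r + θ}) (Ideal.span {(p : R), ((-r : ℤ) : R) + θ}) := by
  obtain ⟨k, hk⟩ := hr
  have hkR : (r : R) ^ 2 + d = p * k := by exact_mod_cast hk
  obtain ⟨u, v, huv⟩ : IsCoprime (p : ℤ) ((2 * d : ℕ) : ℤ) := Nat.isCoprime_iff_coprime.2 hp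
  have huvR : (u : R) * p + v * (2 * d) = 1 := by exact_mod_cast huv
  rw [Ideal.isCoprime_iff_exists]
  refine ⟨(u + 2 * v * k) * p + (-(r * v)) * (r + θ), Ideal.mem_span_pair.2 ⟨_, _, rfl⟩,
    0 * p + (r * v) * (((-r : ℤ) : R) + θ), Ideal.mem_span_pair.2 ⟨_, _, rfl⟩, ?_⟩
  push_cast
  linear_combination huvR - 2 * v * hkR

lemma map_conj_span (h : IsImagQuadratic R d θ σ) (p : ℕ) (r : ℤ) :
    (Ideal.span {(p : R), r + θ}).map σ = Ideal.span {(p : R), ((-r : ℤ) : R) + θ} := by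
  have : (r : R) + -θ = -(((-r : ℤ) : R) + θ) := by push_cast; ring
  rw [Ideal.map_span, Set.image_pair, map_add, map_natCast, map_intCast, h.conj, this,
    Ideal.span_insert, Ideal.span_insert, Ideal.span_singleton_neg]

variable [CharZero R] [IsDedekindDomain R]

lemma span_pair_mem_nonZeroDivisors {a : ℕ} (ha : 0 < a) (u : R) :
    Ideal.span {(a : R), u} ∈ (Ideal R)⁰ := by
  rw [mem_nonZeroDivisors_iff_ne_zero]
  intro h0
  have : (a : R) ∈ Ideal.span {(a : R), u} := Ideal.subset_span (by simp)
  rw [h0] at this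
  simp at this
  omega

/-- Every ideal class contains a reduced ideal `(a, b + θ)`. -/
lemma exists_reduced (h : IsImagQuadratic R d θ σ) (c : ClassGroup R) :
    ∃ (a : ℕ) (b : ℤ) (ha : 0 < a), (a : ℤ) ∣ b ^ 2 + d ∧ 2 * |b| ≤ a ∧ (a : ℤ) ^ 2 ≤ b ^ 2 + d ∧
      ClassGroup.mk0 ⟨_, span_pair_mem_nonZeroDivisors ha ((b : R) + θ)⟩ = c := by
  have hd : (0 : ℤ) < d := by exact_mod_cast h.pos
  let p : ℕ → Prop := fun a => ∃ (b : ℤ) (ha : 0 < a), (a : ℤ) ∣ b ^ 2 + d ∧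
      ClassGroup.mk0 ⟨_, span_pair_mem_nonZeroDivisors ha ((b : R) + θ)⟩ = c
  have hp : ∃ a, p a := by
    obtain ⟨I, rfl⟩ := ClassGroup.mk0_surjective c
    obtain ⟨a, b, s, t, ha, hab, hs, ht, e⟩ :=
      h.exists_span_mul_eq I (nonZeroDivisors.coe_ne_zero I)
    refine ⟨a, b, ha, hab, ?_⟩
    rw [ClassGroup.mk0_eq_mk0_iff]
    exact ⟨t, s, by exact_mod_cast ht, by exact_mod_cast hs, e.symm⟩
  classical
  obtain ⟨b₀, ha, hab₀, hc₀⟩ := Nat.find_spec hp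
  have hmin : ∀ m, p m → Nat.find hp ≤ m := fun m => Nat.find_min' hp
  generalize Nat.find hp = a at *
  have ha' : (0 : ℤ) < a := by exact_mod_cast ha
  obtain ⟨b, q, hbq, hb⟩ : ∃ b q : ℤ, b = b₀ + q * a ∧ 2 * |b| ≤ a := by
    refine ⟨b₀.bmod a, -(b₀.bdiv a), ?_, ?_⟩
    · have := Int.bmod_add_bdiv' b₀ a
      linear_combination this
    · have h1 := Int.bmod_le (x := b₀) (m := a) (by omega)
      have h2 := Int.le_bmod (x := b₀) (m := a) (by omega)
      rcases abs_cases (b₀.bmod a) with ⟨h3, -⟩ | ⟨h3, -⟩ <;> rw [h3] <;> omega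
  have hab : (a : ℤ) ∣ b ^ 2 + d := by
    have : b ^ 2 + d = b₀ ^ 2 + d + a * (2 * b₀ * q + q ^ 2 * a) := by rw [hbq]; ring
    rw [this]
    exact dvd_add hab₀ (dvd_mul_right _ _)
  have hspan : Ideal.span {(a : R), (b₀ : R) + θ} = Ideal.span {(a : R), (b : R) + θ} := by
    have : (b : R) + θ = b₀ + θ + q * a := by rw [hbq]; push_cast; ring
    rw [this, mul_comm, Ideal.span_pair_add_left_mul]
  have hc : ClassGroup.mk0 ⟨_, span_pair_mem_nonZeroDivisors ha ((b : R) + θ)⟩ = c := by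
    rw [← hc₀]; congr 2; exact hspan.symm
  refine ⟨a, b, ha, hab, hb, ?_, hc⟩
  obtain ⟨a', ha'e⟩ := hab
  have ha'0 : 0 < a' := by
    have : 0 < (a : ℤ) * a' := by rw [← ha'e]; positivity
    exact pos_of_mul_pos_right this ha'.le
  lift a' to ℕ using ha'0.le
  have ha'1 : 0 < a' := by exact_mod_cast ha'0
  have hle := hmin a' ⟨-b, ha'1, ⟨a, by rw [neg_sq, ha'e, mul_comm]⟩, by
    rw [← hc, ClassGroup.mk0_eq_mk0_iff]
    have e : (a : R) * a' = b ^ 2 + d := by exact_mod_cast ha'e.symm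
    refine ⟨a, b - θ, by exact_mod_cast ha.ne', ?_, ?_⟩
    · intro h0
      have := (h.eq_zero_of_add_mul_eq_zero (x := b) (y := -1)
        (by push_cast; linear_combination h0)).2
      omega
    · have h1 : (a : R) * ((-b : ℤ) + θ) = -((b - θ) * a) := by push_cast; ring
      have h2 : (b - θ) * (b + θ) = (a : R) * a' := by
        rw [e]; linear_combination -h.theta_mul_self
      simp only [Ideal.span_insert, Ideal.mul_sup, Ideal.span_singleton_mul_span_singleton, h1, h2]
      rw [Ideal.span_singleton_neg, sup_comm]⟩
  rw [ha'e, pow_two]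
  exact mul_le_mul_of_nonneg_left (by exact_mod_cast hle) ha'.le

lemma finite_and_card_classGroup_le (h : IsImagQuadratic R d θ σ) {T : ℕ}
    (hT : ∀ n : ℕ, 0 < n → n ≤ 2 * d → n.divisors.card ≤ T) :
    Finite (ClassGroup R) ∧ Nat.card (ClassGroup R) ≤ (2 * d.sqrt + 1) * T := by
  have hd : (0 : ℤ) < d := by exact_mod_cast h.pos
  choose a b ha hab hb hsq hc using h.exists_reduced
  have hbsq : ∀ c, b c ^ 2 ≤ d := fun c => by
    have h1 : (2 * |b c|) ^ 2 ≤ (a c : ℤ) ^ 2 := by gcongr; exact hb c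
    rw [mul_pow, sq_abs] at h1
    nlinarith [hsq c, sq_nonneg (b c)]
  let F : Finset (Σ _ : ℤ, ℕ) :=
    (Finset.Icc (-(d.sqrt : ℤ)) d.sqrt).sigma fun b => (b ^ 2 + d).natAbs.divisors
  have hF : ∀ c, (⟨b c, a c⟩ : Σ _ : ℤ, ℕ) ∈ F := fun c => by
    simp only [F, Finset.mem_sigma, Finset.mem_Icc, Nat.mem_divisors]
    have h2 : (b c).natAbs ≤ d.sqrt := by
      rw [Nat.le_sqrt']
      have := hbsq c
      rw [← Int.natAbs_sq] at this
      exact_mod_cast this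
    refine ⟨by omega, Int.natCast_dvd.1 (hab c), ?_⟩
    have : 0 < b c ^ 2 + d := by positivity
    omega
  let φ : ClassGroup R → F := fun c => ⟨⟨b c, a c⟩, hF c⟩
  have hφ : Function.Injective φ := by
    intro c c' e
    simp only [φ, Subtype.mk.injEq, Sigma.mk.injEq, heq_eq_eq] at e
    rw [← hc c, ← hc c']
    simp only [e.1, e.2]
  have hfin : Finite (ClassGroup R) := Finite.of_injective φ hφ
  refine ⟨hfin, (Nat.card_le_card_of_injective φ hφ).trans ?_⟩
  rw [Nat.card_eq_fintype_card, Fintype.card_coe, Finset.card_sigma]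
  refine (Finset.sum_le_card_nsmul _ _ T fun x hx => hT _ ?_ ?_).trans_eq ?_
  · have : 0 < x ^ 2 + d := by positivity
    omega
  · rw [Finset.mem_Icc] at hx
    have h1 : x.natAbs ≤ d.sqrt := by omega
    have h2 : x.natAbs ^ 2 ≤ d := Nat.le_sqrt'.1 h1
    have h3 : x ^ 2 ≤ d := by rw [← Int.natAbs_sq]; exact_mod_cast h2
    have : 0 < x ^ 2 + d := by positivity
    omega
  · rw [smul_eq_mul, Int.card_Icc]
    congr 1
    omega

/-- Classes of split primes of small norm have distinct `g`-th powers. -/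
lemma mk0_pow_ne (h : IsImagQuadratic R d θ σ) {g : ℕ} (hg : g ≠ 0) {p q : ℕ} (hpq : p.Coprime q)
    (hpp : p.Prime) (hq1 : 0 < q) (hp : p.Coprime (2 * d)) (hq : q.Coprime (2 * d)) {r s : ℤ}
    (hr : (p : ℤ) ∣ r ^ 2 + d) (hs : (q : ℤ) ∣ s ^ 2 + d) (hlt : 4 * (p * q) ^ g < d) :
    (ClassGroup.mk0 ⟨_, span_pair_mem_nonZeroDivisors hpp.pos ((r : R) + θ)⟩) ^ g ≠
      (ClassGroup.mk0 ⟨_, span_pair_mem_nonZeroDivisors hq1 ((s : R) + θ)⟩) ^ g := by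
  intro heq
  have hp1 := hpp.one_lt
  have hQ : ClassGroup.mk0 ⟨_, span_pair_mem_nonZeroDivisors hq1 ((s : R) + θ)⟩ =
      (ClassGroup.mk0 ⟨_, span_pair_mem_nonZeroDivisors hq1 (((-s : ℤ) : R) + θ)⟩)⁻¹ := by
    rw [ClassGroup.mk0_eq_mk0_inv_iff]
    exact ⟨q, by exact_mod_cast hq1.ne', h.span_pair_mul_conj hq hs⟩
  rw [hQ, inv_pow, eq_inv_iff_mul_eq_one, ← map_pow, ← map_pow, ← map_mul] at heq
  obtain ⟨α, hα⟩ := ((ClassGroup.mk0_eq_one_iff _).1 heq).principal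
  simp only [Ideal.submodule_span_eq, SubmonoidClass.coe_pow] at hα
  have hPP := h.span_pair_mul_conj hp hr
  have hQQ := h.span_pair_mul_conj hq hs
  have hcopP := isCoprime_span_conj θ hp hr
  have hmapP := h.map_conj_span p r
  have hmapQ := h.map_conj_span q (-s)
  rw [neg_neg] at hmapQ
  have hcopPQ : IsCoprime (Ideal.span {(q : R), ((-s : ℤ) : R) + θ})
      (Ideal.span {(p : R), ((-r : ℤ) : R) + θ}) := by
    obtain ⟨u, v, huv⟩ : IsCoprime (p : ℤ) (q : ℤ) := Nat.isCoprime_iff_coprime.2 hpq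
    have huvR : (u : R) * p + v * q = 1 := by exact_mod_cast huv
    rw [Ideal.isCoprime_iff_exists]
    exact ⟨v * q, Ideal.mul_mem_left _ _ (Ideal.subset_span (by simp)),
      u * p, Ideal.mul_mem_left _ _ (Ideal.subset_span (by simp)), by rw [add_comm]; exact huvR⟩
  have hP0 := (mem_nonZeroDivisors_iff_ne_zero.1
    (span_pair_mem_nonZeroDivisors hpp.pos ((r : R) + θ)))
  have hPne : Ideal.span {(p : R), ((-r : ℤ) : R) + θ} ≠ ⊤ := by
    intro htop
    have hm := h.map_conj_span p (-r)
    rw [htop, neg_neg, Ideal.map_top] at hm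
    rw [← hm, htop, Ideal.top_mul, eq_comm, Ideal.span_singleton_eq_top] at hPP
    have h1 : ((p : ℤ) : R) ∣ ((1 : ℤ) : R) := by simpa using hPP.dvd
    have := Int.le_of_dvd one_pos (h.intCast_dvd h1)
    omega
  set P := Ideal.span {(p : R), r + θ}
  set P' := Ideal.span {(p : R), ((-r : ℤ) : R) + θ}
  set Q := Ideal.span {(q : R), s + θ}
  set Q' := Ideal.span {(q : R), ((-s : ℤ) : R) + θ}
  obtain ⟨x, y, hxy⟩ := h.coords α
  have hxy' : 2 * σ α = x - y * θ := by
    have := congrArg σ hxy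
    simp only [map_mul, map_add, map_intCast, h.conj, map_ofNat] at this
    rw [this]; ring
  have hnorm : Ideal.span {α * σ α} = Ideal.span {(((p * q) ^ g : ℤ) : R)} := by
    have hα' : P' ^ g * Q ^ g = Ideal.span {σ α} := by
      rw [← hmapP, ← hmapQ, ← Ideal.map_pow, ← Ideal.map_pow, ← Ideal.map_mul, hα, Ideal.map_span,
        Set.image_singleton]
    rw [← Ideal.span_singleton_mul_span_singleton, ← hα, ← hα']
    calc P ^ g * Q' ^ g * (P' ^ g * Q ^ g) = (P * P') ^ g * (Q * Q') ^ g := by ring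
      _ = _ := by
        rw [hPP, hQQ, Ideal.span_singleton_pow, Ideal.span_singleton_pow,
          Ideal.span_singleton_mul_span_singleton]
        push_cast
        rw [mul_pow]
  have e4 : ((4 : ℤ) : R) * (α * σ α) = ((x ^ 2 + d * y ^ 2 : ℤ) : R) := by
    push_cast
    linear_combination 2 * σ α * hxy + (x + y * θ) * hxy' - (y : R) ^ 2 * h.theta_mul_self
  obtain ⟨n, hn⟩ := h.int_of_mul _ _ _ four_ne_zero e4
  rw [hn] at hnorm e4
  have e4' : 4 * n = x ^ 2 + d * y ^ 2 := by exact_mod_cast e4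
  rw [Ideal.span_singleton_eq_span_singleton] at hnorm
  have hn1 : n ∣ (p * q) ^ g := h.intCast_dvd hnorm.dvd
  have hn2 : ((p * q) ^ g : ℤ) ∣ n := h.intCast_dvd hnorm.symm.dvd
  have hpos : (0 : ℤ) < (p * q) ^ g := by positivity
  have hle := Int.le_of_dvd hpos hn1
  have hlt' : 4 * ((p : ℤ) * q) ^ g < d := by exact_mod_cast hlt
  have hy : y = 0 := by
    by_contra hy
    have : 0 < y ^ 2 := by positivity
    nlinarith [sq_nonneg x]
  subst hy
  obtain ⟨m, rfl⟩ := h.int_of_mul α 2 x two_ne_zero (by push_cast; simpa using hxy)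
  rw [map_intCast, ← Int.cast_mul] at hn
  have hnm : m * m = n := by exact_mod_cast hn
  have hpm : (p : ℤ) ∣ m := by
    have hprod : (p : ℤ) ∣ m * m := by
      rw [hnm]
      exact ((dvd_mul_right _ _).trans (dvd_pow_self _ hg)).trans hn2
    exact (or_self_iff.1 ((Nat.prime_iff_prime_int.1 hpp).dvd_or_dvd hprod))
  have hle' : P ^ g * Q' ^ g ≤ P * P' := by
    rw [hα, hPP, Ideal.span_singleton_le_span_singleton]
    obtain ⟨k, rfl⟩ := hpm
    exact ⟨k, by push_cast; rfl⟩
  obtain ⟨g', rfl⟩ := Nat.exists_eq_succ_of_ne_zero hg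
  have hdvd : P' ∣ P ^ g' * Q' ^ (g' + 1) := by
    rw [← Ideal.dvd_iff_le, Nat.succ_eq_add_one, pow_succ', mul_assoc] at hle'
    exact (mul_dvd_mul_iff_left hP0).1 hle'
  have hcop : IsCoprime (P ^ g' * Q' ^ (g' + 1)) P' := hcopP.pow_left.mul_left hcopPQ.pow_left
  exact hPne (Ideal.isUnit_iff.1 (hcop.isUnit_of_dvd' hdvd dvd_rfl))

/-- If the primes in `S` split and have small norm, then `#S * h_g ≤ h`. -/
lemma card_mul_card_torsion_le (h : IsImagQuadratic R d θ σ) [Finite (ClassGroup R)] {g : ℕ}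
    (hg : g ≠ 0) (S : Finset ℕ) (hS : ∀ p ∈ S, p.Prime ∧ p.Coprime (2 * d) ∧
      ∃ r : ℤ, (p : ℤ) ∣ r ^ 2 + d) {Y : ℕ} (hY : ∀ p ∈ S, p ≤ Y) (hYd : 4 * Y ^ (2 * g) < d) :
    S.card * Nat.card {c : ClassGroup R // c ^ g = 1} ≤ Nat.card (ClassGroup R) := by
  let f : ClassGroup R →* ClassGroup R := powMonoidHom g
  have hker : Nat.card {c : ClassGroup R // c ^ g = 1} = Nat.card f.ker :=
    Nat.card_congr (Equiv.refl _)
  rw [hker, ← f.ker.index_mul_card, Subgroup.index_ker]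
  refine Nat.mul_le_mul_right _ ?_
  choose hpr hcop r hr using hS
  let φ : S → f.range := fun p =>
    ⟨f (ClassGroup.mk0
      ⟨_, span_pair_mem_nonZeroDivisors (hpr p p.2).pos ((r p p.2 : R) + θ)⟩), ⟨_, rfl⟩⟩
  have hφ : Function.Injective φ := by
    rintro ⟨p, hp⟩ ⟨q, hq⟩ e
    by_contra hne
    have hpq : p ≠ q := fun e' => hne (Subtype.ext e')
    refine h.mk0_pow_ne hg ((Nat.coprime_primes (hpr p hp) (hpr q hq)).2 hpq) (hpr p hp)
      (hpr q hq).pos (hcop p hp) (hcop q hq) (hr p hp) (hr q hq) (lt_of_le_of_lt ?_ hYd)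
      (congrArg Subtype.val e)
    rw [pow_mul, pow_two]
    gcongr
    exacts [hY p hp, hY q hq]
  simpa using Nat.card_le_card_of_injective φ hφ

end IsImagQuadratic

section Kneg

open NumberField

lemma kneg_gen_mul_self (d : ℕ) :
    ((Real.sqrt d : ℂ) * Complex.I) * ((Real.sqrt d : ℂ) * Complex.I) = -(d : ℂ) := by
  have h1 : ((Real.sqrt d : ℂ)) * (Real.sqrt d : ℂ) = (d : ℂ) := by
    rw [← Complex.ofReal_mul, Real.mul_self_sqrt (Nat.cast_nonneg d), Complex.ofReal_natCast]
  linear_combination ((Real.sqrt d : ℂ)) * (Real.sqrt d : ℂ) * Complex.I_mul_I - h1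

lemma kneg_gen_isIntegral (d : ℕ) : IsIntegral ℤ ((Real.sqrt d : ℂ) * Complex.I) := by
  refine IsIntegral.of_pow (n := 2) two_pos ?_
  rw [pow_two, kneg_gen_mul_self, show -(d : ℂ) = algebraMap ℤ ℂ (-d) by simp]
  exact isIntegral_algebraMap

instance (d : ℕ) : NumberField (Kneg d) where
  to_charZero := inferInstance
  to_finiteDimensional :=
    IntermediateField.adjoin.finiteDimensional (kneg_gen_isIntegral d).tower_top

lemma kneg_coords {d : ℕ} (hd : 0 < d) {z : ℂ} (hz : z ∈ Kneg d) :
    ∃ a b : ℚ, z = a + b * ((Real.sqrt d : ℂ) * Complex.I) := by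
  have hθ := kneg_gen_mul_self d
  generalize hθ' : (Real.sqrt d : ℂ) * Complex.I = θ at *
  rw [Kneg, hθ'] at hz
  induction hz using IntermediateField.adjoin_induction with
  | mem x hx => exact ⟨0, 1, by simpa using hx⟩
  | algebraMap x => exact ⟨x, 0, by simp⟩
  | add x y _ _ hx hy =>
    obtain ⟨a, b, rfl⟩ := hx
    obtain ⟨a', b', rfl⟩ := hy
    exact ⟨a + a', b + b', by push_cast; ring⟩
  | mul x y _ _ hx hy =>
    obtain ⟨a, b, rfl⟩ := hx
    obtain ⟨a', b', rfl⟩ := hy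
    exact ⟨a * a' - d * b * b', a * b' + a' * b, by
      push_cast; linear_combination (b * b' : ℂ) * hθ⟩
  | inv x _ hx =>
    obtain ⟨a, b, rfl⟩ := hx
    rcases eq_or_ne (a ^ 2 + d * b ^ 2) 0 with h0 | h0
    · have hb : b = 0 := by
        by_contra hb
        have : 0 < (d : ℚ) * b ^ 2 := by positivity
        nlinarith [sq_nonneg a]
      subst hb
      exact ⟨a⁻¹, 0, by simp⟩
    · refine ⟨a / (a ^ 2 + d * b ^ 2), -b / (a ^ 2 + d * b ^ 2), ?_⟩
      have h0' : ((a : ℂ) ^ 2 + d * (b : ℂ) ^ 2) ≠ 0 := by exact_mod_cast h0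
      apply inv_eq_of_mul_eq_one_right
      push_cast
      rw [← div_self h0']
      linear_combination (-(b : ℂ) ^ 2 / (a ^ 2 + d * b ^ 2)) * hθ

lemma kneg_gen_mem (d : ℕ) : (Real.sqrt d : ℂ) * Complex.I ∈ Kneg d :=
  IntermediateField.mem_adjoin_simple_self ℚ _

lemma conj_kneg_gen (d : ℕ) : (starRingEnd ℂ) ((Real.sqrt d : ℂ) * Complex.I) =
    -((Real.sqrt d : ℂ) * Complex.I) := by
  simp

lemma conj_mem_kneg {d : ℕ} (hd : 0 < d) {z : ℂ} (hz : z ∈ Kneg d) :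
    (starRingEnd ℂ) z ∈ Kneg d := by
  obtain ⟨a, b, rfl⟩ := kneg_coords hd hz
  rw [map_add, map_mul, conj_kneg_gen]
  have ha : ∀ q : ℚ, (starRingEnd ℂ) (q : ℂ) = q := fun q => map_ratCast _ q
  rw [ha, ha]
  exact add_mem (SubfieldClass.ratCast_mem _ _)
    (mul_mem (SubfieldClass.ratCast_mem _ _) (neg_mem (kneg_gen_mem d)))

/-- Complex conjugation on `ℚ(√-d)`. -/
noncomputable def knegConj {d : ℕ} (hd : 0 < d) : Kneg d →+* Kneg d :=
  ((starRingEnd ℂ).comp (Kneg d).val.toRingHom).codRestrict (Kneg d) fun z =>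
    conj_mem_kneg hd z.2

/-- `√-d` as an element of the ring of integers. -/
noncomputable def knegSqrt (d : ℕ) : 𝓞 (Kneg d) :=
  ⟨⟨_, kneg_gen_mem d⟩, by
    show IsIntegral ℤ _
    exact (isIntegral_algHom_iff ((Kneg d).val.restrictScalars ℤ) Subtype.val_injective).1
      (kneg_gen_isIntegral d)⟩

lemma exists_int_of_isIntegral {q : ℚ} (h : IsIntegral ℤ (q : ℂ)) : ∃ k : ℤ, (k : ℚ) = q := by
  have : IsIntegral ℤ q :=
    (isIntegral_algHom_iff ((Algebra.ofId ℚ ℂ).restrictScalars ℤ) (algebraMap ℚ ℂ).injective).1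
      (by simpa using! h)
  exact IsIntegrallyClosed.isIntegral_iff.1 this

lemma exists_int_of_squarefree_mul_sq {d : ℕ} (hd : Squarefree d) {q : ℚ} {n : ℤ}
    (h : d * q ^ 2 = n) : ∃ k : ℤ, (k : ℚ) = q := by
  have hq0 : (q.den : ℚ) ≠ 0 := by exact_mod_cast q.den_ne_zero
  have h1 : (d : ℤ) * q.num ^ 2 = n * q.den ^ 2 := by
    rw [← Rat.num_div_den q, div_pow, mul_div_assoc', div_eq_iff (pow_ne_zero 2 hq0)] at h
    exact_mod_cast h
  have h2 : (q.den : ℤ) ^ 2 ∣ d := by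
    have hcop : IsCoprime ((q.den : ℤ) ^ 2) (q.num ^ 2) :=
      (Int.isCoprime_iff_gcd_eq_one.2 (by
        have := q.reduced
        rw [Int.gcd, Int.natAbs_natCast]; exact this.symm)).pow
    exact hcop.dvd_of_dvd_mul_right ⟨n, by rw [h1]; ring⟩
  have h3 : q.den * q.den ∣ d := by
    rw [← pow_two]; exact_mod_cast h2
  have h4 : q.den = 1 := Nat.isUnit_iff.1 (hd _ h3)
  exact ⟨q.num, Rat.coe_int_num_of_den_eq_one h4⟩

lemma isImagQuadratic_kneg {d : ℕ} (hd : Squarefree d) (hd0 : 0 < d) :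
    IsImagQuadratic (𝓞 (Kneg d)) d (knegSqrt d) (RingOfIntegers.mapRingHom (knegConj hd0)) := by
  have hinj : Function.Injective (fun α : 𝓞 (Kneg d) => ((α : Kneg d) : ℂ)) :=
    Subtype.val_injective.comp RingOfIntegers.coe_injective
  have hinteg : ∀ α : 𝓞 (Kneg d), IsIntegral ℤ ((α : Kneg d) : ℂ) := fun α =>
    (RingOfIntegers.isIntegral_coe α).map ((Kneg d).val.restrictScalars ℤ)
  refine ⟨hd0, hinj ?_, hinj ?_, fun α => ?_, fun α n m hn e => ?_⟩
  · simpa using! kneg_gen_mul_self d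
  · exact conj_kneg_gen d
  · obtain ⟨a, b, hab⟩ := kneg_coords hd0 (α : Kneg d).2
    have hθ := kneg_gen_mul_self d
    have hconj : IsIntegral ℤ ((starRingEnd ℂ) ((α : Kneg d) : ℂ)) :=
      (hinteg α).map ((starRingEnd ℂ).toIntAlgHom)
    have hc : (starRingEnd ℂ) ((α : Kneg d) : ℂ) = a - b * ((Real.sqrt d : ℂ) * Complex.I) := by
      have ha : ∀ q : ℚ, (starRingEnd ℂ) (q : ℂ) = q := fun q => map_ratCast _ q
      rw [hab, map_add, map_mul, conj_kneg_gen, ha, ha]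
      ring
    obtain ⟨x, hx⟩ : ∃ k : ℤ, (k : ℚ) = 2 * a := exists_int_of_isIntegral (by
      rw [show ((2 * a : ℚ) : ℂ) = (α : Kneg d) + (starRingEnd ℂ) ((α : Kneg d) : ℂ) by
        rw [hc, hab]; push_cast; ring]
      exact (hinteg α).add hconj)
    obtain ⟨n, hn⟩ : ∃ k : ℤ, (k : ℚ) = a ^ 2 + d * b ^ 2 := exists_int_of_isIntegral (by
      rw [show ((a ^ 2 + d * b ^ 2 : ℚ) : ℂ) = (α : Kneg d) * (starRingEnd ℂ) ((α : Kneg d) : ℂ) by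
        rw [hc, hab]; push_cast; linear_combination (b : ℂ) ^ 2 * hθ]
      exact (hinteg α).mul hconj)
    obtain ⟨y, hy⟩ : ∃ k : ℤ, (k : ℚ) = 2 * b :=
      exists_int_of_squarefree_mul_sq hd (n := 4 * n - x ^ 2) (by
        push_cast
        rw [hx, hn]
        ring)
    refine ⟨x, y, hinj ?_⟩
    have hx' : (x : ℂ) = 2 * a := by exact_mod_cast congrArg (Rat.cast : ℚ → ℂ) hx
    have hy' : (y : ℂ) = 2 * b := by exact_mod_cast congrArg (Rat.cast : ℚ → ℂ) hy
    suffices h : 2 * ((α : Kneg d) : ℂ) = x + y * ((Real.sqrt d : ℂ) * Complex.I) by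
      simpa [knegSqrt] using! h
    rw [hx', hy', hab]
    ring
  · have e' : (n : ℂ) * ((α : Kneg d) : ℂ) = m := by
      simpa using! congrArg (fun α : 𝓞 (Kneg d) => ((α : Kneg d) : ℂ)) e
    have hnC : (n : ℂ) ≠ 0 := by exact_mod_cast hn
    have hα : ((α : Kneg d) : ℂ) = ((m / n : ℚ) : ℂ) := by
      push_cast
      rw [eq_div_iff hnC, mul_comm, e']
    obtain ⟨k, hk⟩ := exists_int_of_isIntegral (q := m / n) (hα ▸ hinteg α)
    refine ⟨k, hinj ?_⟩
    rw [← hk] at hα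
    simpa using! hα

end Kneg

section DivisorBound

/-- The divisor bound `τ(n) ≪ n ^ δ`. -/
lemma exists_card_divisors_le {δ : ℝ} (hδ : 0 < δ) :
    ∃ C : ℝ, 0 < C ∧ ∀ n : ℕ, n ≠ 0 → (n.divisors.card : ℝ) ≤ C * (n : ℝ) ^ δ := by
  have hlog : 0 < Real.log 2 := Real.log_pos one_lt_two
  obtain ⟨A, hA⟩ := exists_nat_gt ((2 : ℝ) ^ (1 / δ))
  set K : ℝ := max 1 (1 / (δ * Real.log 2)) with hK
  have hK1 : 1 ≤ K := le_max_left _ _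
  refine ⟨K ^ A, by positivity, fun n hn => ?_⟩
  have key : ∀ p ∈ n.primeFactors, ((n.factorization p + 1 : ℕ) : ℝ) ≤
      (if p < A then K else 1) * (((p ^ n.factorization p : ℕ) : ℝ) ^ δ) := by
    intro p hp
    have hp2 : (2 : ℝ) ≤ p := by exact_mod_cast (Nat.prime_of_mem_primeFactors hp).two_le
    generalize n.factorization p = v
    have hpow : (((p ^ v : ℕ) : ℝ) ^ δ) = ((p : ℝ) ^ δ) ^ v := by
      push_cast
      rw [← Real.rpow_natCast, ← Real.rpow_natCast, ← Real.rpow_mul (by positivity),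
        ← Real.rpow_mul (by positivity), mul_comm]
    rw [hpow]
    push_cast
    split_ifs with h
    · have h1 : (1 + δ * Real.log 2 * v) ≤ ((2 : ℝ) ^ δ) ^ v := by
        rw [← Real.rpow_natCast, ← Real.rpow_mul zero_le_two, Real.rpow_def_of_pos two_pos]
        refine le_trans (le_of_eq (by ring)) (Real.add_one_le_exp _)
      have h2 : ((2 : ℝ) ^ δ) ^ v ≤ ((p : ℝ) ^ δ) ^ v := by gcongr
      have h3 : 1 ≤ K * (δ * Real.log 2) := by
        rw [← div_le_iff₀ (by positivity)]
        exact le_max_right _ _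
      calc (v : ℝ) + 1 ≤ K * (δ * Real.log 2) * v + K := by
            nlinarith [Nat.cast_nonneg (α := ℝ) v]
        _ = K * (1 + δ * Real.log 2 * v) := by ring
        _ ≤ K * ((p : ℝ) ^ δ) ^ v := by gcongr; exact h1.trans h2
    · rw [one_mul]
      have h1 : (2 : ℝ) ≤ (p : ℝ) ^ δ := by
        have h2 : (2 : ℝ) ^ (1 / δ) ≤ p := hA.le.trans (by exact_mod_cast not_lt.1 h)
        calc (2 : ℝ) = ((2 : ℝ) ^ (1 / δ)) ^ δ := by
              rw [← Real.rpow_mul zero_le_two, one_div_mul_cancel hδ.ne', Real.rpow_one]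
          _ ≤ _ := by gcongr
      calc (v : ℝ) + 1 ≤ 2 ^ v := by exact_mod_cast Nat.lt_two_pow_self (n := v)
        _ ≤ _ := by gcongr
  have hprod : (n : ℝ) ^ δ = ∏ p ∈ n.primeFactors, (((p ^ n.factorization p : ℕ) : ℝ) ^ δ) := by
    rw [Real.finsetProd_rpow _ _ fun _ _ => by positivity, ← Nat.cast_prod]
    congr 2
    exact (Nat.prod_factorization_pow_eq_self hn).symm
  rw [Nat.card_divisors hn, Nat.cast_prod, hprod]
  refine (Finset.prod_le_prod (fun _ _ => by positivity) key).trans ?_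
  rw [Finset.prod_mul_distrib]
  gcongr
  rw [Finset.prod_ite, Finset.prod_const, Finset.prod_const_one, mul_one]
  refine pow_le_pow_right₀ hK1 ?_
  calc _ ≤ (Finset.range A).card := Finset.card_le_card fun p hp => by
        simpa using (Finset.mem_filter.1 hp).2
    _ = A := Finset.card_range A

end DivisorBound

section CharacterSums

open scoped NumberTheorySymbols

/-- The Jacobi symbol `J(a | n)`, restricted to odd `n`. -/
def oddJacobi (a : ℤ) (n : ℕ) : ℤ := if Odd n then J(a | n) else 0

lemma oddJacobi_abs_le (a : ℤ) (n : ℕ) : |oddJacobi a n| ≤ 1 := by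
  unfold oddJacobi
  split_ifs
  · rcases jacobiSym.trichotomy a n with h | h | h <;> simp [h]
  · simp

lemma oddJacobi_mul_left (a b : ℤ) (n : ℕ) :
    oddJacobi (a * b) n = oddJacobi a n * oddJacobi b n := by
  unfold oddJacobi
  split_ifs
  · exact jacobiSym.mul_left a b n
  · simp

lemma oddJacobi_mul_right (a : ℤ) (m n : ℕ) :
    oddJacobi a (m * n) = oddJacobi a m * oddJacobi a n := by
  unfold oddJacobi
  by_cases hm : Odd m
  · by_cases hn : Odd n
    · have := hm.pos.ne'
      have := hn.pos.ne'
      simp [hm, hn, jacobiSym.mul_right' a ‹m ≠ 0› ‹n ≠ 0›]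
    · simp [hn, Nat.odd_mul]
  · simp [hm, Nat.odd_mul]

lemma oddJacobi_prod (a : ℤ) {ι : Type*} (s : Finset ι) (f : ι → ℕ) :
    oddJacobi a (∏ i ∈ s, f i) = ∏ i ∈ s, oddJacobi a (f i) := by
  classical
  induction s using Finset.induction_on with
  | empty => simp [oddJacobi]
  | insert i s hi ih => rw [Finset.prod_insert hi, Finset.prod_insert hi, oddJacobi_mul_right, ih]

lemma oddJacobi_mod (D n : ℕ) : oddJacobi D (n % (4 * D)) = oddJacobi D n := by
  unfold oddJacobi
  have hodd : Odd (n % (4 * D)) ↔ Odd n := by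
    rw [Nat.odd_iff, Nat.odd_iff, Nat.mod_mod_of_dvd _ ⟨2 * D, by ring⟩]
  simp only [hodd]
  split_ifs with h
  · exact (jacobiSym.mod_right' D h).symm
  · rfl

/-- A Jacobi symbol `J(D | ·)` takes the value `-1` if some prime divides `D` exactly once. -/
lemma exists_oddJacobi_eq_neg_one {q D' : ℕ} (hq : q.Prime) (hqD : ¬ q ∣ D') :
    ∃ n : ℕ, oddJacobi ((q * D' : ℕ) : ℤ) n = -1 := by
  have hcop : q.Coprime D' := (Nat.Prime.coprime_iff_not_dvd hq).2 hqD
  rcases hq.eq_two_or_odd' with rfl | hodd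
  · have hD' : Odd D' := Nat.not_even_iff_odd.1 fun h => hqD h.two_dvd
    obtain ⟨n, hn8, hnD⟩ := Nat.chineseRemainder (n := 8) (m := D')
      (Nat.Coprime.pow_left 3 hcop) 5 1
    have hn8' : n % 8 = 5 := hn8
    have hn : Odd n := Nat.odd_iff.2 (by omega)
    refine ⟨n, ?_⟩
    unfold oddJacobi
    rw [if_pos hn]
    push_cast
    rw [jacobiSym.mul_left, jacobiSym.at_two hn,
      jacobiSym.quadratic_reciprocity_one_mod_four' hD' (by omega), jacobiSym.mod_left (n : ℤ),
      show (n : ℤ) % D' = (1 : ℤ) % D' by exact_mod_cast hnD, ← jacobiSym.mod_left,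
      jacobiSym.one_left, mul_one, ZMod.χ₈_nat_eq_if_mod_eight]
    simp [hn8', show n % 2 ≠ 0 by omega]
  · have := Fact.mk hq
    obtain ⟨a, ha⟩ := FiniteField.exists_nonsquare (F := ZMod q) (by
      rw [ZMod.ringChar_zmod_n]; rintro rfl; exact absurd hodd (by decide))
    have hcop' : q.Coprime (8 * D') :=
      ((Nat.coprime_primes hq Nat.prime_two).2 (by rintro rfl; exact absurd hodd (by decide))
        |>.pow_right 3).mul_right hcop
    obtain ⟨n, hnq, hn8⟩ := Nat.chineseRemainder hcop' a.val 1
    have hn8' : n % 8 = 1 := (hn8.of_mul_right D' : n ≡ 1 [MOD 8])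
    have hn4D : n ≡ 1 [MOD 4 * D'] := hn8.of_dvd ⟨2, by ring⟩
    have hn : Odd n := Nat.odd_iff.2 (by omega)
    refine ⟨n, ?_⟩
    have h1 : J((D' : ℤ) | n) = 1 := by
      rw [jacobiSym.mod_right' D' hn, hn4D, ← jacobiSym.mod_right' D' odd_one, jacobiSym.one_right]
    unfold oddJacobi
    rw [if_pos hn]
    push_cast
    rw [jacobiSym.mul_left, h1, mul_one,
      jacobiSym.quadratic_reciprocity_one_mod_four' hodd (by omega),
      ZMod.nonsquare_iff_jacobiSym_eq_neg_one]
    have : ((n : ℤ) : ZMod q) = a := by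
      rw [Int.cast_natCast, (ZMod.natCast_eq_natCast_iff _ _ _).2 hnq, ZMod.natCast_zmod_val]
    rwa [this]

lemma abs_sum_oddJacobi_le {D : ℕ} (hD : 0 < D) (hminus : ∃ n : ℕ, oddJacobi D n = -1) (N : ℕ) :
    |∑ n ∈ Finset.range N, oddJacobi D n| ≤ 4 * D := by
  obtain ⟨m, hm⟩ := hminus
  have : NeZero (4 * D) := ⟨by positivity⟩
  have hperiod : ∀ n, oddJacobi D (n + 4 * D) = oddJacobi D n := fun n => by
    rw [← oddJacobi_mod, Nat.add_mod_right, oddJacobi_mod]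
  have hmcop : m.Coprime (4 * D) := by
    unfold oddJacobi at hm
    split_ifs at hm with hodd
    · refine Nat.Coprime.mul_right (Nat.Coprime.pow_right 2 (Nat.coprime_two_right.2 hodd)) ?_
      by_contra hc
      have h0 : J((D : ℤ) | m) = 0 := jacobiSym.eq_zero_iff.2 ⟨hodd.pos.ne', fun h => hc (by
        rw [Int.gcd_natCast_natCast] at h; exact Nat.Coprime.symm h)⟩
      omega
  let F : ZMod (4 * D) → ℤ := fun x => oddJacobi D x.val
  have hF : ∀ n : ℕ, F n = oddJacobi D n := fun n => by
    simp only [F, ZMod.val_natCast, oddJacobi_mod]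
  have hsumF : ∑ x, F x = 0 := by
    have h1 : ∑ x, F x = ∑ x, F (ZMod.unitOfCoprime m hmcop * x) :=
      (Fintype.sum_equiv (Units.mulLeft (ZMod.unitOfCoprime m hmcop)) _ _ fun x => rfl).symm
    have h2 : ∀ x, F (ZMod.unitOfCoprime m hmcop * x) = - F x := fun x => by
      rw [ZMod.coe_unitOfCoprime]
      conv_lhs => rw [← ZMod.natCast_zmod_val x, ← Nat.cast_mul, hF, oddJacobi_mul_right, hm]
      simp [F]
    simp only [h2, Finset.sum_neg_distrib] at h1
    omega
  have hzero : ∑ n ∈ Finset.range (4 * D), oddJacobi D n = 0 := by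
    rw [← hsumF]
    refine Finset.sum_nbij' (fun n => (n : ZMod (4 * D))) ZMod.val (fun _ _ => Finset.mem_univ _)
      (fun x _ => Finset.mem_range.2 x.val_lt)
      (fun n hn => ZMod.val_natCast_of_lt (Finset.mem_range.1 hn))
      (fun x _ => ZMod.natCast_zmod_val x) (fun n _ => (hF n).symm)
  induction N using Nat.strong_induction_on with
  | _ N ih =>
    rcases lt_or_ge N (4 * D) with h | h
    · refine (Finset.abs_sum_le_sum_abs _ _).trans ?_
      refine (Finset.sum_le_card_nsmul _ _ 1 fun n _ => oddJacobi_abs_le _ _).trans ?_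
      rw [Finset.card_range, nsmul_one]
      exact_mod_cast h.le
    · obtain ⟨M, rfl⟩ := Nat.exists_eq_add_of_le h
      rw [Finset.sum_range_add, hzero, zero_add]
      simp only [add_comm (4 * D), hperiod]
      exact ih M (by omega)

end CharacterSums

section LargeSieve

lemma card_prod_eq_le_factorial {P : Finset ℕ} (hP : ∀ p ∈ P, p.Prime) (k n : ℕ) :
    ((Fintype.piFinset fun _ : Fin k => P).filter fun t => ∏ i, t i = n).card ≤ k.factorial := by
  classical
  have hperm : ∀ t ∈ (Fintype.piFinset fun _ : Fin k => P).filter fun t => ∏ i, t i = n,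
      (List.ofFn t).Perm n.primeFactorsList := by
    intro t ht
    rw [Finset.mem_filter, Fintype.mem_piFinset] at ht
    refine Nat.primeFactorsList_unique (by rw [List.prod_ofFn, ht.2]) fun p hp => ?_
    obtain ⟨i, rfl⟩ := List.mem_ofFn.1 hp
    exact hP _ (ht.1 i)
  rcases Finset.eq_empty_or_nonempty
    ((Fintype.piFinset fun _ : Fin k => P).filter fun t => ∏ i, t i = n) with h | ⟨t₀, ht₀⟩
  · simp [h]
  · calc _ ≤ (n.primeFactorsList.permutations.toFinset).card :=
          Finset.card_le_card_of_injOn List.ofFn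
            (fun t ht => by simpa using hperm t ht) List.ofFn_injective.injOn
      _ ≤ _ := List.toFinset_card_le _
      _ = k.factorial := by
          rw [List.length_permutations, ← (hperm t₀ ht₀).length_eq, List.length_ofFn]

/-- Orthogonality of the characters attached to distinct squarefree integers. -/
lemma sum_oddJacobi_mul_le {d e Z N : ℕ} (hd : Squarefree d) (he : Squarefree e) (hde : d ≠ e)
    (hdZ : d ≤ Z) (heZ : e ≤ Z) :
    ∑ n ∈ Finset.range N, oddJacobi (-d) n * oddJacobi (-e) n ≤ 4 * (Z : ℤ) ^ 2 := by
  have hd0 := hd.ne_zero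
  have he0 := he.ne_zero
  have key : ∃ q D' : ℕ, q.Prime ∧ ¬ q ∣ D' ∧ d * e = q * D' := by
    have aux : ∀ {a b : ℕ}, Squarefree a → Squarefree b → ¬ a ∣ b →
        ∃ q D' : ℕ, q.Prime ∧ ¬ q ∣ D' ∧ a * b = q * D' := by
      intro a b ha hb hab
      have hsub : ¬ a.primeFactors ⊆ b.primeFactors := fun h => hab <| by
        rw [← Nat.prod_primeFactors_of_squarefree ha, ← Nat.prod_primeFactors_of_squarefree hb]
        exact Finset.prod_dvd_prod_of_subset _ _ _ h
      obtain ⟨q, hqa, hqb⟩ := Finset.not_subset.1 hsub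
      have hq := Nat.prime_of_mem_primeFactors hqa
      obtain ⟨c, rfl⟩ := Nat.dvd_of_mem_primeFactors hqa
      refine ⟨q, c * b, hq, fun h => ?_, by ring⟩
      rcases hq.dvd_mul.1 h with h | h
      · exact hq.one_lt.ne' (Nat.isUnit_iff.1 (ha q (mul_dvd_mul_left q h)))
      · exact hqb (Nat.mem_primeFactors.2 ⟨hq, h, hb.ne_zero⟩)
    by_cases h : d ∣ e
    · obtain ⟨q, D', h1, h2, h3⟩ := aux he hd fun h' => hde (Nat.dvd_antisymm h h')
      exact ⟨q, D', h1, h2, by rw [mul_comm, h3]⟩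
    · exact aux hd he h
  obtain ⟨q, D', hq, hqD, hprod⟩ := key
  have hminus : ∃ n : ℕ, oddJacobi ((d * e : ℕ) : ℤ) n = -1 := by
    rw [hprod]; exact exists_oddJacobi_eq_neg_one hq hqD
  calc _ = ∑ n ∈ Finset.range N, oddJacobi ((d * e : ℕ) : ℤ) n := by
        refine Finset.sum_congr rfl fun n _ => ?_
        rw [← oddJacobi_mul_left]
        push_cast
        rw [neg_mul_neg]
    _ ≤ 4 * ((d * e : ℕ) : ℤ) :=
        (le_abs_self _).trans (abs_sum_oddJacobi_le (Nat.pos_of_ne_zero (by positivity)) hminus N)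
    _ ≤ _ := by
        push_cast
        have : (d : ℤ) ≤ Z := by exact_mod_cast hdZ
        have : (e : ℤ) ≤ Z := by exact_mod_cast heZ
        rw [sq]
        gcongr

lemma sum_sq_sum_oddJacobi_le {B : Finset ℕ} {Z : ℕ} (hB : ∀ d ∈ B, Squarefree d ∧ d ≤ Z)
    (N : ℕ) :
    ∑ n ∈ Finset.range N, (∑ d ∈ B, oddJacobi (-d) n) ^ 2 ≤
      B.card * N + (B.card : ℤ) ^ 2 * (4 * (Z : ℤ) ^ 2) := by
  have hterm : ∀ d ∈ B, ∀ e ∈ B, ∑ n ∈ Finset.range N, oddJacobi (-d) n * oddJacobi (-e) n ≤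
      (if d = e then (N : ℤ) else 0) + 4 * (Z : ℤ) ^ 2 := by
    intro d hd e he
    split_ifs with h
    · refine le_add_of_le_of_nonneg ?_ (by positivity)
      calc _ ≤ ∑ n ∈ Finset.range N, (1 : ℤ) := Finset.sum_le_sum fun n _ => by
            refine (le_abs_self _).trans ?_
            rw [abs_mul]
            exact mul_le_one₀ (oddJacobi_abs_le _ _) (abs_nonneg _) (oddJacobi_abs_le _ _)
        _ = N := by simp
    · rw [zero_add]
      exact sum_oddJacobi_mul_le (hB d hd).1 (hB e he).1 h (hB d hd).2 (hB e he).2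
  calc _ = ∑ d ∈ B, ∑ e ∈ B, ∑ n ∈ Finset.range N, oddJacobi (-d) n * oddJacobi (-e) n := by
        simp_rw [sq, Finset.sum_mul_sum]
        rw [Finset.sum_comm]
        exact Finset.sum_congr rfl fun d _ => Finset.sum_comm
    _ ≤ ∑ d ∈ B, ∑ e ∈ B, ((if d = e then (N : ℤ) else 0) + 4 * (Z : ℤ) ^ 2) :=
        Finset.sum_le_sum fun d hd => Finset.sum_le_sum fun e he => hterm d hd e he
    _ = _ := by
        simp only [Finset.sum_add_distrib, Finset.sum_ite_eq, Finset.sum_const, nsmul_eq_mul,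
          Finset.sum_ite_mem, Finset.inter_self]
        ring

/-- A large sieve inequality, by duality and amplification: few discriminants have a large
character sum over the primes in `P`. -/
lemma sq_card_mul_pow_le {B P : Finset ℕ} {Z Y k m : ℕ}
    (hB : ∀ d ∈ B, Squarefree d ∧ d ≤ Z) (hP : ∀ p ∈ P, p.Prime ∧ p ≤ Y) (hk : Even k)
    (hm : ∀ d ∈ B, (m : ℤ) ≤ |∑ p ∈ P, oddJacobi (-d) p|) :
    ((B.card : ℤ) * (m : ℤ) ^ k) ^ 2 ≤ (P.card : ℤ) ^ k * (k.factorial *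
      (B.card * ((Y ^ k + 1 : ℕ) : ℤ) + (B.card : ℤ) ^ 2 * (4 * (Z : ℤ) ^ 2))) := by
  classical
  set T := Fintype.piFinset fun _ : Fin k => P with hT
  set G : ℕ → ℤ := fun n => ∑ d ∈ B, oddJacobi (-d) n with hG
  have hlower : (B.card : ℤ) * (m : ℤ) ^ k ≤ ∑ t ∈ T, G (∏ i, t i) := by
    calc (B.card : ℤ) * (m : ℤ) ^ k = ∑ d ∈ B, (m : ℤ) ^ k := by simp
      _ ≤ ∑ d ∈ B, (∑ p ∈ P, oddJacobi (-d) p) ^ k := Finset.sum_le_sum fun d hd => by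
          rw [← hk.pow_abs (∑ p ∈ P, oddJacobi (-d) p)]
          exact pow_le_pow_left₀ (by positivity) (hm d hd) k
      _ = ∑ d ∈ B, ∑ t ∈ T, oddJacobi (-d) (∏ i, t i) := Finset.sum_congr rfl fun d _ => by
          simp_rw [oddJacobi_prod]
          rw [hT, ← Finset.prod_univ_sum]
          simp
      _ = _ := Finset.sum_comm
  have hmaps : ∀ t ∈ T, ∏ i, t i ∈ Finset.range (Y ^ k + 1) := fun t ht => by
    rw [Finset.mem_range, Nat.lt_succ_iff]
    calc ∏ i, t i ≤ ∏ _i : Fin k, Y :=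
          Finset.prod_le_prod' fun i _ => (hP _ (Fintype.mem_piFinset.1 ht i)).2
      _ = Y ^ k := by simp
  have hfib : ∑ t ∈ T, G (∏ i, t i) ^ 2 ≤
      k.factorial * ∑ n ∈ Finset.range (Y ^ k + 1), G n ^ 2 := by
    rw [← Finset.sum_fiberwise_of_maps_to hmaps, Finset.mul_sum]
    refine Finset.sum_le_sum fun n _ => ?_
    rw [Finset.sum_congr rfl fun t ht => by rw [(Finset.mem_filter.1 ht).2], Finset.sum_const,
      nsmul_eq_mul]
    gcongr
    exact card_prod_eq_le_factorial (fun p hp => (hP p hp).1) k n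
  calc ((B.card : ℤ) * (m : ℤ) ^ k) ^ 2 ≤ (∑ t ∈ T, G (∏ i, t i)) ^ 2 :=
        pow_le_pow_left₀ (by positivity) hlower 2
    _ ≤ T.card * ∑ t ∈ T, G (∏ i, t i) ^ 2 := sq_sum_le_card_mul_sum_sq
    _ = (P.card : ℤ) ^ k * ∑ t ∈ T, G (∏ i, t i) ^ 2 := by
        rw [hT, Fintype.card_piFinset]; simp
    _ ≤ _ := by
        gcongr
        refine hfib.trans ?_
        gcongr
        exact sum_sq_sum_oddJacobi_le hB _

end LargeSieve

section GoodDiscriminants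

lemma sub_mul_hneg_le {g d T Y m : ℕ} {P : Finset ℕ} (hg : g ≠ 0) (hd : Squarefree d)
    (hP : ∀ p ∈ P, p.Prime ∧ p ≠ 2 ∧ p ≤ Y) (hY : 4 * Y ^ (2 * g) < d)
    (hT : ∀ n, 0 < n → n ≤ 2 * d → n.divisors.card ≤ T)
    (hm : |∑ p ∈ P, oddJacobi (-d) p| < m) :
    ((P.card : ℤ) - T - m) * hneg g d ≤ 2 * ((2 * d.sqrt + 1) * T) := by
  have hd0 : 0 < d := Nat.pos_of_ne_zero hd.ne_zero
  have hI := isImagQuadratic_kneg hd hd0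
  obtain ⟨hfin, hclass⟩ := hI.finite_and_card_classGroup_le hT
  have hodd : ∀ p ∈ P, Odd p := fun p hp =>
    (hP p hp).1.eq_two_or_odd'.resolve_left (hP p hp).2.1
  set S := P.filter fun p => oddJacobi (-d) p = 1 with hS
  set R := P.filter fun p => oddJacobi (-d) p = 0 with hR
  have hsum : (P.card : ℤ) + ∑ p ∈ P, oddJacobi (-d) p ≤ 2 * S.card + R.card := by
    rw [hS, hR, Finset.card_filter, Finset.card_filter, Finset.card_eq_sum_ones]
    push_cast
    rw [Finset.mul_sum, ← Finset.sum_add_distrib, ← Finset.sum_add_distrib]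
    refine Finset.sum_le_sum fun p hp => ?_
    rw [oddJacobi, if_pos (hodd p hp)]
    rcases jacobiSym.trichotomy (-d) p with h | h | h <;> simp [h]
  have hRT : R.card ≤ T := by
    refine (Finset.card_le_card fun p hp => ?_).trans (hT d hd0 (by omega))
    obtain ⟨hpP, hp0⟩ := Finset.mem_filter.1 hp
    rw [oddJacobi, if_pos (hodd p hpP), jacobiSym.eq_zero_iff, Int.neg_gcd,
      Int.gcd_natCast_natCast] at hp0
    rw [Nat.mem_divisors]
    refine ⟨?_, hd0.ne'⟩
    by_contra h
    exact hp0.2 ((Nat.Prime.coprime_iff_not_dvd (hP p hpP).1).2 h).symm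
  have hSprop : ∀ p ∈ S, p.Prime ∧ p.Coprime (2 * d) ∧ ∃ r : ℤ, (p : ℤ) ∣ r ^ 2 + d := by
    intro p hp
    obtain ⟨hpP, hp1⟩ := Finset.mem_filter.1 hp
    obtain ⟨hprime, hp2, -⟩ := hP p hpP
    rw [oddJacobi, if_pos (hodd p hpP)] at hp1
    have := Fact.mk hprime
    refine ⟨hprime, ?_, ?_⟩
    · refine Nat.Coprime.mul_right ((Nat.coprime_primes hprime Nat.prime_two).2 hp2) ?_
      by_contra h
      have h0 : jacobiSym (-d) p = 0 := jacobiSym.eq_zero_iff.2 ⟨hprime.ne_zero, fun h' => h (by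
        rw [Int.neg_gcd, Int.gcd_natCast_natCast] at h'; exact Nat.Coprime.symm h')⟩
      omega
    · obtain ⟨x, hx⟩ := ZMod.isSquare_of_jacobiSym_eq_one hp1
      refine ⟨x.val, ?_⟩
      rw [← ZMod.intCast_zmod_eq_zero_iff_dvd]
      push_cast at hx ⊢
      rw [ZMod.natCast_zmod_val, sq, ← hx, neg_add_cancel]
  have htor := hI.card_mul_card_torsion_le hg S hSprop
    (fun p hp => (hP p (Finset.mem_filter.1 hp).1).2.2) hY
  have hmain : (S.card : ℤ) * hneg g d ≤ (2 * d.sqrt + 1) * T := by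
    exact_mod_cast htor.trans hclass
  have hcard : (P.card : ℤ) - T - m ≤ 2 * S.card := by
    have := neg_abs_le (∑ p ∈ P, oddJacobi (-d) p)
    have : (R.card : ℤ) ≤ T := by exact_mod_cast hRT
    linarith
  calc _ ≤ 2 * (S.card : ℤ) * hneg g d := by gcongr
    _ = 2 * ((S.card : ℤ) * hneg g d) := by ring
    _ ≤ _ := by gcongr

end GoodDiscriminants

section PrimeCounting

open Filter

lemma eventually_mul_rpow_le {a b : ℝ} (h : a < b) (K : ℝ) :
    ∀ᶠ x : ℝ in atTop, K * x ^ a ≤ x ^ b := by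
  filter_upwards [(tendsto_rpow_atTop (sub_pos.2 h)).eventually (eventually_ge_atTop K),
    eventually_gt_atTop 0] with x hx hx0
  calc K * x ^ a ≤ x ^ (b - a) * x ^ a := by gcongr
    _ = x ^ b := by rw [← Real.rpow_add hx0, sub_add_cancel]

lemma eventually_rpow_add_one_le_primeCounting {β : ℝ} (hβ0 : 0 < β) (hβ : β < 1) :
    ∀ᶠ n : ℕ in atTop, (n : ℝ) ^ β + 1 ≤ Nat.primeCounting n := by
  obtain ⟨γ, hγ, hγ1⟩ := exists_between hβ
  have h1 := eventually_mul_rpow_le hγ 16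
  have h2 : ∀ᶠ x : ℝ in atTop, Real.log x ≤ x ^ (1 - γ) := by
    have := (isLittleO_log_rpow_atTop (sub_pos.2 hγ1)).bound (c := 1) one_pos
    filter_upwards [this, eventually_ge_atTop 1] with x hx hx0
    rw [Real.norm_of_nonneg (Real.log_nonneg hx0), Real.norm_of_nonneg (by positivity)] at hx
    linarith
  have h3 : ∀ᶠ x : ℝ in atTop, Real.log x ≤ (1 / 8) * x := by
    have := Real.isLittleO_log_id_atTop.bound (c := 1 / 8) (by norm_num)
    filter_upwards [this, eventually_ge_atTop 1] with x hx hx0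
    rw [Real.norm_of_nonneg (Real.log_nonneg hx0), id, Real.norm_of_nonneg (by positivity)] at hx
    linarith
  filter_upwards [tendsto_natCast_atTop_atTop.eventually h1,
    tendsto_natCast_atTop_atTop.eventually h2,
    (tendsto_natCast_atTop_atTop.comp (tendsto_add_atTop_nat 1)).eventually h3,
    eventually_ge_atTop 2] with n h1 h2 h3 hn
  refine le_trans ?_ (Chebyshev.pi_ge n)
  have hn' : (2 : ℝ) ≤ n := by exact_mod_cast hn
  have hlog : 0 < Real.log n := Real.log_pos (by linarith)
  rw [le_div_iff₀ hlog]
  simp only [Function.comp_apply, Nat.cast_add, Nat.cast_one] at h3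
  have hone : 1 ≤ (n : ℝ) ^ β := Real.one_le_rpow (by linarith) hβ0.le
  have hlog2 := Real.log_two_gt_d9
  have hsplit : (n : ℝ) ^ γ * (n : ℝ) ^ (1 - γ) = n := by
    rw [← Real.rpow_add (by linarith), add_sub_cancel, Real.rpow_one]
  calc ((n : ℝ) ^ β + 1) * Real.log n ≤ ((1 / 8) * (n : ℝ) ^ γ) * (n : ℝ) ^ (1 - γ) := by
        gcongr; linarith
    _ = (1 / 8) * n := by rw [mul_assoc, hsplit]
    _ ≤ n * Real.log 2 - Real.log (n + 1) := by nlinarith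

lemma eventually_rpow_le_card_primes {g : ℕ} (hg : 0 < g) {α : ℝ} (hα0 : 0 < α)
    (hα : α < 1 / (2 * g)) : ∀ᶠ X : ℝ in atTop,
      X ^ α ≤ ((⌊(X / 8) ^ (1 / (2 * g : ℝ))⌋₊.primesLE.erase 2).card : ℝ) := by
  have hg' : (0 : ℝ) < 1 / (2 * g) := by positivity
  set a : ℝ := 1 / (2 * g) with ha
  obtain ⟨α', hαα', hα'⟩ := exists_between hα
  set β := α' / a with hβ
  have hβ0 : 0 < β := by have := hα0.trans hαα'; positivity
  have hβ1 : β < 1 := (div_lt_one hg').2 hα'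
  have haβ : a * β = α' := by rw [hβ]; field_simp
  have hbase : Tendsto (fun X : ℝ => (X / 8) ^ a) atTop atTop :=
    (tendsto_rpow_atTop hg').comp (tendsto_id.atTop_div_const (by norm_num))
  set c : ℝ := (1 / 2 : ℝ) ^ β * (1 / 8) ^ α' with hc
  have hc0 : 0 < c := by positivity
  have h1 := eventually_mul_rpow_le hαα' c⁻¹
  filter_upwards [h1, (tendsto_nat_floor_atTop.comp hbase).eventually
    (eventually_rpow_add_one_le_primeCounting hβ0 hβ1), hbase.eventually (eventually_ge_atTop 2),
    eventually_gt_atTop 0] with X h1 h2 h3 hX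
  rw [inv_mul_le_iff₀ hc0] at h1
  simp only [Function.comp_apply] at h2
  have hfl : (1 / 2) * (X / 8) ^ a ≤ ⌊(X / 8) ^ a⌋₊ := by
    have := Nat.lt_floor_add_one ((X / 8) ^ a)
    linarith
  have hcard : (Nat.primeCounting ⌊(X / 8) ^ a⌋₊ : ℝ) - 1 ≤
      ((⌊(X / 8) ^ a⌋₊.primesLE.erase 2).card : ℝ) := by
    rw [← Nat.primesLE_card_eq_primeCounting, sub_le_iff_le_add]
    have := Finset.pred_card_le_card_erase (s := ⌊(X / 8) ^ a⌋₊.primesLE) (a := 2)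
    exact_mod_cast Nat.sub_le_iff_le_add.1 this
  calc X ^ α ≤ c * X ^ α' := h1
    _ = ((1 / 2) * (X / 8) ^ a) ^ β := by
        rw [hc, Real.mul_rpow (by positivity) (by positivity), ← Real.rpow_mul (by positivity), haβ,
          mul_assoc, ← Real.mul_rpow (by positivity) (by positivity)]
        ring_nf
    _ ≤ (⌊(X / 8) ^ a⌋₊ : ℝ) ^ β := by gcongr
    _ ≤ _ := by linarith

end PrimeCounting

section ExceptionalSet

lemma card_mul_pow_le {B P : Finset ℕ} {Z Y k m : ℕ}
    (hB : ∀ d ∈ B, Squarefree d ∧ d ≤ Z) (hP : ∀ p ∈ P, p.Prime ∧ p ≤ Y) (hk : Even k)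
    (hk0 : k ≠ 0) (hm : ∀ d ∈ B, (m : ℤ) ≤ |∑ p ∈ P, oddJacobi (-d) p|)
    (hPm : P.card ≤ 4 * m) (hZ : 16 ^ k * k.factorial * (8 * Z ^ 2) ≤ P.card ^ k) :
    B.card * P.card ^ k ≤ 2 * (16 ^ k * k.factorial * (Y ^ k + 1)) := by
  have key := sq_card_mul_pow_le hB hP hk hm
  rcases Nat.eq_zero_or_pos B.card with hb | hb
  · simp [hb]
  rcases Nat.eq_zero_or_pos P.card with hl | hl
  · simp [hl, hk0]
  norm_cast at key
  generalize B.card = b at *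
  generalize P.card = l at *
  set M := 16 ^ k * k.factorial with hM
  have h1 : (b * l ^ k) ^ 2 ≤ l ^ k * (M * (b * (Y ^ k + 1) + b ^ 2 * (4 * Z ^ 2))) := by
    calc (b * l ^ k) ^ 2 ≤ (b * (4 * m) ^ k) ^ 2 := by gcongr
      _ = 16 ^ k * (b * m ^ k) ^ 2 := by
          rw [show 16 ^ k = (4 ^ k) ^ 2 by rw [← pow_mul, mul_comm, pow_mul]; norm_num]
          ring
      _ ≤ 16 ^ k * (l ^ k * (k.factorial * (b * (Y ^ k + 1) + b ^ 2 * (4 * Z ^ 2)))) := by gcongr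
      _ = _ := by rw [hM]; ring
  have h2 : b * l ^ k ≤ M * (Y ^ k + 1) + b * (M * (4 * Z ^ 2)) := by
    refine le_of_mul_le_mul_left (a := b * l ^ k) ?_ (by positivity)
    calc b * l ^ k * (b * l ^ k) = (b * l ^ k) ^ 2 := by ring
      _ ≤ _ := h1
      _ = b * l ^ k * (M * (Y ^ k + 1) + b * (M * (4 * Z ^ 2))) := by ring
  have h3 : b * (M * (8 * Z ^ 2)) ≤ b * l ^ k := by gcongr
  linarith

end ExceptionalSet

/-- Fix a prime `g ≥ 3`.  For every `ε > 0` there is `C = C(g, ε)` such that for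
all `X ≥ 2`, all but at most `C·X^ε` of the squarefree integers `d ∈ [X, 2X)`
satisfy `h_g(-d) ≤ C · d^(1/2 - 1/(2g) + ε)`. -/
theorem hg_bound_almost_all (g : ℕ) (hg : g.Prime) (hg3 : 3 ≤ g)
    (ε : ℝ) (hε : 0 < ε) :
    ∃ C : ℝ, 0 < C ∧ ∀ X : ℝ, 2 ≤ X →
      (((Finset.range (⌈2 * X⌉₊ + 1)).filter
          (fun d : ℕ => Squarefree d ∧ X ≤ (d : ℝ) ∧ (d : ℝ) < 2 * X ∧
            ¬ ((hneg g d : ℝ) ≤ C * (d : ℝ) ^ ((1 : ℝ) / 2 - 1 / (2 * g) + ε)))).card : ℝ)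
        ≤ C * X ^ ε := by
  have hg0 : (0 : ℝ) < g := by exact_mod_cast hg.pos
  have hg3' : (3 : ℝ) ≤ g := by exact_mod_cast hg3
  obtain ⟨η, hη0, hηε, hη1⟩ : ∃ η : ℝ, 0 < η ∧ 4 * η ≤ ε ∧ 4 * η ≤ 1 :=
    ⟨min ε 1 / 4, by positivity, by linarith [min_le_left ε 1], by linarith [min_le_right ε 1]⟩
  set α : ℝ := (1 - η) / (2 * g) with hα
  have hα0 : 0 < α := div_pos (by linarith) (by positivity)
  have hαlt : α < 1 / (2 * g) := by rw [hα]; gcongr; linarith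
  have hαε : 1 / (2 * g) - α ≤ ε / 2 := by
    rw [hα, ← sub_div, sub_sub_cancel, div_le_iff₀ (by positivity)]
    nlinarith
  obtain ⟨δ, hδ0, hδε, hδα⟩ : ∃ δ : ℝ, 0 < δ ∧ δ ≤ ε / 2 ∧ δ < α :=
    ⟨min (ε / 2) (α / 2), by positivity, min_le_left _ _,
      (min_le_right _ _).trans_lt (half_lt_self hα0)⟩
  obtain ⟨c, hc0, hdiv⟩ := exists_card_divisors_le hδ0
  set k := 8 * g with hk
  have hαk : α * k = 4 - 4 * η := by rw [hα, hk]; push_cast; field_simp; ring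
  set M := 16 ^ k * k.factorial with hM
  have hM0 : 0 < M := by positivity
  obtain ⟨X₀, hX₀⟩ := Filter.eventually_atTop.1 <|
    (eventually_rpow_le_card_primes hg.pos hα0 hαlt).and <|
    (eventually_mul_rpow_le hδα (4 * (c * 4 ^ δ))).and <|
    (eventually_mul_rpow_le hα0 2).and <|
    (eventually_mul_rpow_le (a := 2) (b := 4 - 4 * η) (by linarith) (32 * M))
  set C : ℝ := max (2 * |X₀| + 3) (max (24 * (c * 4 ^ δ) * 2 ^ α) (4 * M)) with hC
  have hC₀ : 2 * |X₀| + 3 ≤ C := le_max_left _ _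
  have hC₁ : 24 * (c * 4 ^ δ) * 2 ^ α ≤ C := (le_max_left _ _).trans (le_max_right _ _)
  have hC₂ : 4 * M ≤ C := (le_max_right _ _).trans (le_max_right _ _)
  have hCpos : 0 < C := by linarith [abs_nonneg X₀]
  refine ⟨C, hCpos, fun X hX => ?_⟩
  rcases lt_or_ge X X₀ with hlt | hge
  · calc _ ≤ ((⌈2 * X⌉₊ + 1 : ℕ) : ℝ) := by
          exact_mod_cast (Finset.card_filter_le _ _).trans (Finset.card_range _).le
      _ ≤ C * 1 := by
          push_cast
          have := Nat.ceil_lt_add_one (show 0 ≤ 2 * X by linarith)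
          linarith [le_abs_self X₀]
      _ ≤ C * X ^ ε := by gcongr; exact Real.one_le_rpow (by linarith) hε.le
  obtain ⟨hL, hT, hL2, hZ⟩ := hX₀ X hge
  have hXpos : 0 < X := by linarith
  rw [Real.rpow_zero, mul_one] at hL2
  set Y := ⌊(X / 8) ^ (1 / (2 * g : ℝ))⌋₊ with hYdef
  set P := Y.primesLE.erase 2 with hPdef
  have hP : ∀ p ∈ P, p.Prime ∧ p ≠ 2 ∧ p ≤ Y := by
    intro p hp
    rw [hPdef, Finset.mem_erase, Nat.mem_primesLE] at hp
    exact ⟨hp.2.2, hp.1, hp.2.1⟩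
  have hYpow : (Y : ℝ) ^ (2 * g) ≤ X / 8 := by
    calc (Y : ℝ) ^ (2 * g) ≤ ((X / 8) ^ (1 / (2 * g : ℝ))) ^ (2 * g) := by
          gcongr; exact Nat.floor_le (by positivity)
      _ = X / 8 := by
          rw [← Real.rpow_natCast, ← Real.rpow_mul (by positivity)]
          push_cast
          rw [one_div_mul_cancel (by positivity), Real.rpow_one]
  have hP2 : 2 ≤ P.card := by exact_mod_cast hL2.trans hL
  set m := P.card / 2 with hm
  set T := ⌊c * (4 * X) ^ δ⌋₊ with hTdef
  have hTle : (T : ℝ) ≤ c * 4 ^ δ * X ^ δ := by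
    refine (Nat.floor_le (by positivity)).trans (le_of_eq ?_)
    rw [Real.mul_rpow (by norm_num) hXpos.le, mul_assoc]
  set B := (Finset.range (⌈2 * X⌉₊ + 1)).filter fun d : ℕ =>
    (Squarefree d ∧ d ≤ ⌊2 * X⌋₊) ∧ (m : ℤ) ≤ |∑ p ∈ P, oddJacobi (-d) p| with hB
  have hgood : ∀ d : ℕ, Squarefree d → X ≤ d → (d : ℝ) < 2 * X →
      |∑ p ∈ P, oddJacobi (-d) p| < m →
      (hneg g d : ℝ) ≤ C * (d : ℝ) ^ ((1 : ℝ) / 2 - 1 / (2 * g) + ε) := by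
    intro d hd hXd hdX hsum
    have hd0 : (0 : ℝ) < d := by linarith
    have hd1 : (1 : ℝ) ≤ d := by linarith
    have hYd : 4 * Y ^ (2 * g) < d := by
      have : (4 : ℝ) * (Y : ℝ) ^ (2 * g) < d := by linarith
      exact_mod_cast this
    have hdT : ∀ n, 0 < n → n ≤ 2 * d → n.divisors.card ≤ T := by
      intro n hn hnd
      refine Nat.le_floor ((hdiv n hn.ne').trans ?_)
      have : (n : ℝ) ≤ 2 * d := by exact_mod_cast hnd
      gcongr
      linarith
    have hmain := sub_mul_hneg_le hg.ne_zero hd hP hYd hdT hsum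
    have hmain' : ((P.card : ℝ) - T - m) * hneg g d ≤ 2 * ((2 * d.sqrt + 1) * T) := by
      exact_mod_cast hmain
    have hm2 : (m : ℝ) ≤ P.card / 2 := Nat.cast_div_le
    have hsqrt : (2 * d.sqrt + 1 : ℝ) ≤ 3 * (d : ℝ) ^ (1 / 2 : ℝ) := by
      have h1 : (1 : ℝ) ≤ (d : ℝ) ^ (1 / 2 : ℝ) := Real.one_le_rpow hd1 (by norm_num)
      have h2 : (d.sqrt : ℝ) ≤ (d : ℝ) ^ (1 / 2 : ℝ) := by
        rw [← Real.sqrt_eq_rpow]; exact Real.nat_sqrt_le_real_sqrt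
      linarith
    have h1 : X ^ α / 4 * hneg g d ≤ 2 * (3 * (d : ℝ) ^ (1 / 2 : ℝ) * (c * 4 ^ δ * X ^ δ)) := by
      calc X ^ α / 4 * hneg g d ≤ ((P.card : ℝ) - T - m) * hneg g d := by
            gcongr; linarith
        _ ≤ 2 * ((2 * d.sqrt + 1) * T) := hmain'
        _ ≤ _ := by gcongr
    have h2 : (d : ℝ) ^ α ≤ 2 ^ α * X ^ α := by
      rw [← Real.mul_rpow (by norm_num) hXpos.le]; gcongr
    have h3 : (hneg g d : ℝ) * (d : ℝ) ^ α ≤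
        24 * (c * 4 ^ δ) * 2 ^ α * (d : ℝ) ^ (1 / 2 + δ) := by
      calc (hneg g d : ℝ) * (d : ℝ) ^ α ≤ hneg g d * (2 ^ α * X ^ α) := by gcongr
        _ = 4 * 2 ^ α * (X ^ α / 4 * hneg g d) := by ring
        _ ≤ 4 * 2 ^ α * (2 * (3 * (d : ℝ) ^ (1 / 2 : ℝ) * (c * 4 ^ δ * X ^ δ))) := by gcongr
        _ ≤ 4 * 2 ^ α * (2 * (3 * (d : ℝ) ^ (1 / 2 : ℝ) * (c * 4 ^ δ * (d : ℝ) ^ δ))) := by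
            gcongr
        _ = _ := by rw [Real.rpow_add hd0]; ring
    calc (hneg g d : ℝ) ≤ 24 * (c * 4 ^ δ) * 2 ^ α * (d : ℝ) ^ (1 / 2 + δ - α) := by
          rw [Real.rpow_sub hd0, ← mul_div_assoc, le_div_iff₀ (by positivity)]
          exact h3
      _ ≤ _ := by
          gcongr
          linarith
  have hsub : (Finset.range (⌈2 * X⌉₊ + 1)).filter
      (fun d : ℕ => Squarefree d ∧ X ≤ (d : ℝ) ∧ (d : ℝ) < 2 * X ∧
        ¬ ((hneg g d : ℝ) ≤ C * (d : ℝ) ^ ((1 : ℝ) / 2 - 1 / (2 * g) + ε))) ⊆ B := by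
    refine Finset.monotone_filter_right _ fun d _ hd => ?_
    obtain ⟨h1, h2, h3, h4⟩ := hd
    exact ⟨⟨h1, Nat.le_floor h3.le⟩, not_lt.1 fun h => h4 (hgood d h1 h2 h3 h)⟩
  have hLk : X ^ (4 - 4 * η) ≤ (P.card : ℝ) ^ k := by
    calc X ^ (4 - 4 * η) = (X ^ α) ^ k := by
          rw [← hαk, Real.rpow_mul hXpos.le, Real.rpow_natCast]
      _ ≤ _ := by gcongr
  have hZ2 : 16 ^ k * k.factorial * (8 * ⌊2 * X⌋₊ ^ 2) ≤ P.card ^ k := by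
    rw [← hM]
    have : (M : ℝ) * (8 * (⌊2 * X⌋₊ : ℝ) ^ 2) ≤ (P.card : ℝ) ^ k := by
      calc (M : ℝ) * (8 * (⌊2 * X⌋₊ : ℝ) ^ 2) ≤ M * (8 * (2 * X) ^ 2) := by
            gcongr; exact Nat.floor_le (by positivity)
        _ = 32 * M * X ^ (2 : ℝ) := by rw [Real.rpow_two]; ring
        _ ≤ _ := hZ.trans hLk
    exact_mod_cast this
  have hBcard := card_mul_pow_le (B := B) (fun d hd => (Finset.mem_filter.1 hd).2.1)
    (fun p hp => ⟨(hP p hp).1, (hP p hp).2.2⟩) (show Even k from ⟨4 * g, by rw [hk]; ring⟩)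
    (by have := hg.pos; omega) (fun d hd => (Finset.mem_filter.1 hd).2.2) (by omega) hZ2
  rw [← hM] at hBcard
  have hBcard' : (B.card : ℝ) * (P.card : ℝ) ^ k ≤ 2 * (M * ((Y : ℝ) ^ k + 1)) := by
    exact_mod_cast hBcard
  have hYk : (Y : ℝ) ^ k + 1 ≤ 2 * X ^ (4 : ℝ) := by
    have h1 : (Y : ℝ) ^ k ≤ X ^ 4 := by
      calc (Y : ℝ) ^ k = ((Y : ℝ) ^ (2 * g)) ^ 4 := by rw [hk, ← pow_mul]; ring_nf
        _ ≤ X ^ 4 := by gcongr; linarith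
    have h2 : 1 ≤ X ^ 4 := one_le_pow₀ (by linarith)
    have h3 : X ^ (4 : ℝ) = X ^ 4 := by exact_mod_cast Real.rpow_natCast X 4
    rw [h3]
    linarith
  calc _ ≤ (B.card : ℝ) := by exact_mod_cast Finset.card_le_card hsub
    _ ≤ 4 * M * X ^ (4 * η) := by
        have h : (B.card : ℝ) * X ^ (4 - 4 * η) ≤ 4 * M * X ^ (4 : ℝ) := by
          calc (B.card : ℝ) * X ^ (4 - 4 * η) ≤ B.card * (P.card : ℝ) ^ k := by gcongr
            _ ≤ 2 * (M * ((Y : ℝ) ^ k + 1)) := hBcard'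
            _ ≤ 2 * (M * (2 * X ^ (4 : ℝ))) := by gcongr
            _ = _ := by ring
        rw [← le_div_iff₀ (by positivity), mul_div_assoc, ← Real.rpow_sub hXpos,
          sub_sub_cancel] at h
        exact h
    _ ≤ C * X ^ ε := by
        gcongr
        linarith
end
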